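/- For every i ∈ {1,…,n}, every j ∈ {1,…,N}, and every nonzero vector v ∈ M[m], there exists an M[m]-valued holomorphic function f on a neighborhood of z_i satisfying D_{K,M}(u,∂) f = 0 (away from z_i) and f(u) = v·(u − z_i)^{Λ^{(i)}_j + N − j} + O((u − z_i)^{Λ^{(i)}_j + N − j + 1}) as u → z_i. -/

import Mathlib

noncomputable section

namespace GaudinModel

/-- A vector-valued quasi-exponential: a finite sum of functions `e^{λu} p(u)` with `p` a
vector-valued polynomial. -/
def IsQE {M : Type*} [AddCommGroup M] [Module ℂ M] (f : ℂ → M) : Prop :=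
  ∃ (k d : ℕ) (lam : Fin k → ℂ) (v : Fin k → Fin d → M),
    ∀ u : ℂ, f u = ∑ i : Fin k, ∑ j : Fin d,
      (Complex.exp (lam i * u) * u ^ (j : ℕ)) • v i j

variable {N n : ℕ}

/-- Points away from the singular points `z_1, …, z_n`. -/
def GoodG {n : ℕ} (z : Fin n → ℂ) (u : ℂ) : Prop := ∀ j : Fin n, u ≠ z j

section Setup

variable (V : Fin n → Type*) [∀ i, AddCommGroup (V i)] [∀ i, Module ℂ (V i)]
  (M : Type*) [NormedAddCommGroup M] [NormedSpace ℂ M]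
  (E : ∀ i : Fin n, Fin N → Fin N → (V i →ₗ[ℂ] V i))
  (φ : M ≃ₗ[ℂ] PiTensorProduct ℂ V)

/-- The commutation relations of `gl_N`: `[e_{ab}, e_{cd}] = δ_{bc} e_{ad} − δ_{da} e_{cb}`,
for the operators `E i a b` (the action of `e_{ab}` on the `i`-th factor `V i`). -/
def GlRel : Prop :=
  ∀ (i : Fin n) (a b c d : Fin N),
    E i a b ∘ₗ E i c d - E i c d ∘ₗ E i a b =
      (if b = c then (1 : ℂ) else 0) • E i a d - (if d = a then (1 : ℂ) else 0) • E i c b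

/-- Each `V i` is the irreducible finite-dimensional `gl_N`-module with highest weight
`Λ i`: it is generated by a nonzero vector `v` with `e_{ab} v = 0` for `a < b` and
`e_{aa} v = Λ_a v`. -/
def IsHW (Λ : Fin n → Fin N → ℤ) : Prop :=
  ∀ i : Fin n, ∃ v : V i, v ≠ 0 ∧
    (∀ a b : Fin N, a < b → E i a b v = 0) ∧
    (∀ a : Fin N, E i a a v = (Λ i a : ℂ) • v) ∧
    ∀ W : Submodule ℂ (V i), (∀ a b : Fin N, ∀ x ∈ W, E i a b x ∈ W) → v ∈ W →
      ∀ x : V i, x ∈ W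

/-- `e_{ab}` acting in the `j`-th tensor factor of `M ≃ V 1 ⊗ ⋯ ⊗ V n`. -/
def EE (j : Fin n) (a b : Fin N) : Module.End ℂ M :=
  φ.symm.toLinearMap ∘ₗ
    (PiTensorProduct.map
      (Function.update (fun i : Fin n => (LinearMap.id : V i →ₗ[ℂ] V i)) j (E j a b))) ∘ₗ
    φ.toLinearMap

variable (z : Fin n → ℂ) (K : Matrix (Fin N) (Fin N) ℂ)

/-- `X_{ab}(u,∂) = δ_{ab} ∂ − K_{ab} − ∑_j e_{ba}^{(j)}/(u − z_j)`,
acting on `M`-valued functions. -/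
def Xg (a b : Fin N) (f : ℂ → M) : ℂ → M :=
  fun u => (if a = b then deriv f u else 0) - K a b • f u
    - ∑ j : Fin n, (u - z j)⁻¹ • (EE V M E φ j b a) (f u)

/-- The universal differential operator
`D_{K,M}(u,∂) = ∑_{σ ∈ S_N} sgn(σ) X_{1σ(1)}(u,∂) ⋯ X_{Nσ(N)}(u,∂)`. -/
def Dg (f : ℂ → M) : ℂ → M :=
  fun u => ∑ σ : Equiv.Perm (Fin N),
    ((Equiv.Perm.sign σ : ℤˣ) : ℤ) •
      (((List.ofFn fun a : Fin N => Xg V M E φ z K a (σ a)).foldr (· ∘ ·) id) f u)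

/-- The weight subspace `M[m]`. -/
def Wt (m : Fin N → ℤ) : Submodule ℂ M :=
  ⨅ a : Fin N, LinearMap.ker
    ((∑ j : Fin n, EE V M E φ j a a) - (m a : ℂ) • (1 : Module.End ℂ M))

/-- The subspace `sing M[m]` of `gl_N`-singular vectors of weight `m`. -/
def SingWt (m : Fin N → ℤ) : Submodule ℂ M :=
  Wt V M E φ m ⊓ ⨅ a : Fin N, ⨅ b : Fin N, ⨅ _ : a < b,
    LinearMap.ker (∑ j : Fin n, EE V M E φ j a b)

end Setup

end GaudinModel

section PartA1
namespace GaudinModel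

section ListLemmas
variable {A : Type*} [Ring A] {I : Type*}

/-- sum over positions of a list of the product with the entry there replaced -/
def insSum (y θ : I → A) : List I → A
  | [] => 0
  | i :: l => θ i * (l.map y).prod + y i * insSum y θ l

theorem prod_anti (y : I → A) (x : A) (h : ∀ k, x * y k = - (y k * x)) (l : List I) :
    (l.map y).prod * x = (-1) ^ l.length * (x * (l.map y).prod) := by
  induction l with
  | nil => simp
  | cons k l ih =>
    rw [List.map_cons, List.prod_cons, mul_assoc, ih, List.length_cons, pow_succ]
    have hc : y k * (-1) ^ l.length = (-1) ^ l.length * y k :=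
      (((Commute.one_right (y k)).neg_right).pow_right _).eq
    rw [← mul_assoc, hc, mul_assoc, ← mul_assoc (y k) x]
    have := h k
    rw [eq_neg_iff_add_eq_zero, add_comm, ← eq_neg_iff_add_eq_zero] at this
    rw [this]; noncomm_ring

theorem insSum_kill (y η : I → A) (χ : A) (h1 : ∀ k, χ * y k = - (y k * χ))
    (h2 : ∀ k, χ * η k = 0) (l : List I) : χ * insSum y η l = 0 := by
  induction l with
  | nil => simp [insSum]
  | cons k l ih =>
    rw [insSum, mul_add, ← mul_assoc, h2, ← mul_assoc, h1, neg_mul, mul_assoc, ih]; simp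

theorem prod_sub_ins (y η ψ : I → A) (r : A)
    (h1 : ∀ i k, η i * y k = - (y k * η i)) (h2 : ∀ i k, ψ i * y k = - (y k * ψ i))
    (h3 : ∀ i k, ψ i * η k + η i * η k = 0)
    (h4 : ∀ i, y i * r = r * y i - r * r * ψ i) (h5 : ∀ i, η i * r = r * η i) (l : List I) :
    (l.map fun i => y i - r * η i).prod = (l.map y).prod - r * insSum y η l := by
  induction l with
  | nil => simp [insSum]
  | cons i l ih =>
    have hk := insSum_kill y η (ψ i + η i)
      (fun k => by rw [add_mul, h1, h2]; noncomm_ring) (fun k => by rw [add_mul, h3]) l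
    rw [List.map_cons, List.prod_cons, ih, List.map_cons, List.prod_cons, insSum]
    set P := (l.map y).prod
    set Q := insSum y η l
    have e1 : y i * (r * Q) = r * y i * Q - r * r * ψ i * Q := by
      rw [← mul_assoc, h4]; noncomm_ring
    have e2 : r * η i * (r * Q) = r * r * η i * Q := by
      rw [← mul_assoc, mul_assoc r, h5]; noncomm_ring
    have e3 : r * r * ψ i * Q + r * r * η i * Q = 0 := by
      rw [← add_mul, ← mul_add, mul_assoc, hk, mul_zero]
    rw [sub_mul, mul_sub, mul_sub, e1, e2]
    have : r * r * ψ i * Q = - (r * r * η i * Q) := eq_neg_of_add_eq_zero_left e3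
    rw [this]; noncomm_ring

theorem mul_insSum (y η θ : I → A) (Y : A)
    (h1 : ∀ i k, η i * y k = - (y k * η i)) (h2 : ∀ i k, θ i * y k = - (y k * θ i))
    (h3 : ∀ i, Y * η i = θ i) (l p : List I) :
    Y * ((p.map y).prod * insSum y η l) = (p.map y).prod * insSum y θ l := by
  induction l generalizing p with
  | nil => simp [insSum]
  | cons i l ih =>
    have e1 : Y * ((p.map y).prod * η i) = (p.map y).prod * θ i := by
      rw [prod_anti y _ (h1 i), prod_anti y _ (h2 i), ← h3]
      have hc : Y * (-1) ^ p.length = (-1) ^ p.length * Y :=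
        (((Commute.one_right Y).neg_right).pow_right _).eq
      rw [← mul_assoc, hc, mul_assoc, ← mul_assoc Y]
    have e2 := ih (p ++ [i])
    simp only [List.map_append, List.prod_append, List.map_cons, List.map_nil, List.prod_cons,
      List.prod_nil, mul_one] at e2
    rw [insSum, insSum, mul_add, mul_add, mul_add]
    congr 1
    · rw [← mul_assoc, ← mul_assoc, mul_assoc Y, e1, mul_assoc]
    · rw [← mul_assoc _ (y i), e2, mul_assoc]

theorem prod_dup (y : I → A) (h1 : ∀ i k, y i * y k = - (y k * y i)) (h0 : ∀ i, y i * y i = 0)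
    (l : List I) (hl : ¬ l.Nodup) : (l.map y).prod = 0 := by
  induction l with
  | nil => simp at hl
  | cons i l ih =>
    by_cases hi : i ∈ l
    · obtain ⟨s, t, rfl⟩ := List.append_of_mem hi
      have := prod_anti y (y i) (h1 i) s
      simp only [List.map_cons, List.map_append, List.prod_cons, List.prod_append]
      rw [← mul_assoc, ← mul_assoc]
      have e : y i * (s.map y).prod * y i = 0 := by
        rw [mul_assoc, this, ← mul_assoc]
        have hc : y i * (-1) ^ s.length = (-1) ^ s.length * y i :=
          (((Commute.one_right (y i)).neg_right).pow_right _).eq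
        rw [hc, mul_assoc, ← mul_assoc (y i) (y i), h0]; simp
      rw [e, zero_mul]
    · rw [List.nodup_cons] at hl
      rw [List.map_cons, List.prod_cons, ih (by tauto), mul_zero]

theorem insSum_full [DecidableEq I] [Fintype I] (y : I → A) (e : I → I → A)
    (h1 : ∀ i k, y i * y k = - (y k * y i)) (h0 : ∀ i, y i * y i = 0)
    (he : ∀ a b k, e a b * y k = y k * e a b)
    (l p : List I) (hfull : ∀ c, c ∈ p ++ l) :
    (p.map y).prod * insSum y (fun a => ∑ c, e c a * y c) l =
      (l.map fun i => e i i).sum * ((p ++ l).map y).prod := by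
  induction l generalizing p with
  | nil => simp [insSum]
  | cons i l ih =>
    have hep : ∀ a b (q : List I), e a b * (q.map y).prod = (q.map y).prod * e a b := by
      intro a b q
      induction q with
      | nil => simp
      | cons k q ihq => rw [List.map_cons, List.prod_cons, ← mul_assoc, he, mul_assoc, ihq, mul_assoc]
    have e2 := ih (p ++ [i]) (by intro c; simpa using hfull c)
    simp only [List.append_assoc, List.singleton_append] at e2
    rw [insSum, mul_add, ← mul_assoc _ (y i)]
    rw [List.map_append, List.prod_append] at e2
    simp only [List.map_cons, List.map_nil, List.prod_cons, List.prod_nil, mul_one] at e2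
    rw [e2, List.map_cons, List.sum_cons, add_mul]
    congr 1
    rw [Finset.sum_mul, Finset.mul_sum, Finset.sum_eq_single i]
    · rw [List.map_append, List.prod_append, ← mul_assoc (e i i), hep, List.map_cons, List.prod_cons]
      simp only [mul_assoc]
    · intro c _ hc
      have hd := prod_dup y h1 h0 (p ++ c :: l) (by
        intro hnd
        have := hfull c
        simp only [List.mem_append, List.mem_cons, hc, false_or] at this
        rw [List.nodup_append] at hnd
        rcases this with h | h
        · exact hnd.2.2 c h c (by simp) rfl
        · exact (List.nodup_cons.1 hnd.2.1).1 h)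
      rw [List.map_append, List.prod_append, List.map_cons, List.prod_cons] at hd
      rw [mul_assoc (e c i), ← mul_assoc _ (e c i), ← hep, mul_assoc, hd, mul_zero]
    · simp

end ListLemmas
end GaudinModel
end PartA1

section PartA2
open scoped TensorProduct
namespace GaudinModel

section Rdet
variable {N : ℕ} {R : Type*} [Ring R] [Algebra ℂ R]

/-- row determinant -/
def rdet (X : Fin N → Fin N → R) : R :=
  ∑ σ : Equiv.Perm (Fin N), ((Equiv.Perm.sign σ : ℤˣ) : ℤ) •
    (List.ofFn fun a => X a (σ a)).prod

abbrev Ext (N : ℕ) := ExteriorAlgebra ℂ (Fin N → ℂ)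

/-- generators -/
def ψg {N : ℕ} (b : Fin N) : Ext N := ExteriorAlgebra.ι ℂ (Pi.single b 1)

def topg (N : ℕ) : Ext N := (List.ofFn fun b : Fin N => ψg b).prod

theorem ψg_anti (a b : Fin N) : ψg a * ψg b = - (ψg b * ψg a) :=
  eq_neg_of_add_eq_zero_left (ExteriorAlgebra.ι_add_mul_swap _ _)

/-- top coefficient functional -/
def topc (N : ℕ) : Ext N →ₗ[ℂ] ℂ :=
  ExteriorAlgebra.liftAlternating (R := ℂ) (M := Fin N → ℂ) (N := ℂ)
    (fun i => if h : i = N then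
      (Matrix.detRowAlternating (n := Fin N) (R := ℂ)).domDomCongr (finCongr h.symm) else 0)

theorem topc_top : topc N (topg N) = 1 := by
  have : topg N = ExteriorAlgebra.ιMulti ℂ N (fun b : Fin N => (Pi.single b 1 : Fin N → ℂ)) := by
    rw [ExteriorAlgebra.ιMulti_apply]; rfl
  rw [this, topc, ExteriorAlgebra.liftAlternating_apply_ιMulti]
  simp
  have : (fun i : Fin N => (Pi.single ((finCongr rfl : Fin N ≃ Fin N) i) 1 : Fin N → ℂ)) = (1 : Matrix (Fin N) (Fin N) ℂ) := by
    ext i j; simp [Matrix.one_apply, Pi.single_apply, eq_comm]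
  exact (congrArg Matrix.det this).trans Matrix.det_one

/-- left R-linear projection -/
def epsR (N : ℕ) (R : Type*) [Ring R] [Algebra ℂ R] : R ⊗[ℂ] Ext N →ₗ[ℂ] R :=
  (TensorProduct.rid ℂ R).toLinearMap ∘ₗ TensorProduct.map LinearMap.id (topc N)

theorem epsR_tmul (r : R) (x : Ext N) : epsR N R (r ⊗ₜ x) = topc N x • r := by
  simp [epsR]

theorem epsR_mul (r : R) (x : R ⊗[ℂ] Ext N) : epsR N R ((r ⊗ₜ 1) * x) = r * epsR N R x := by
  induction x using TensorProduct.induction_on with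
  | zero => simp
  | tmul s y => simp [epsR_tmul]
  | add x y hx hy => rw [mul_add, map_add, map_add, hx, hy, mul_add]

/-- the row vectors in `R ⊗ Λ` -/
def yv (X : Fin N → Fin N → R) (a : Fin N) : R ⊗[ℂ] Ext N := ∑ b, X a b ⊗ₜ ψg b

theorem prod_tmul (k : ℕ) (x : Fin k → R) (p : Fin k → Ext N) :
    (List.ofFn fun a => (x a ⊗ₜ[ℂ] p a)).prod = (List.ofFn x).prod ⊗ₜ (List.ofFn p).prod := by
  induction k with
  | zero => simp [Algebra.TensorProduct.one_def]
  | succ k ih => simp [List.ofFn_succ, ih]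

theorem top_perm (g : Fin N → Fin N) :
    (List.ofFn fun a => ψg (g a)).prod =
      if h : Function.Bijective g then
        ((Equiv.Perm.sign (Equiv.ofBijective g h) : ℤˣ) : ℤ) • topg N else 0 := by
  have e0 : ∀ g : Fin N → Fin N, (List.ofFn fun a => ψg (g a)).prod =
    ExteriorAlgebra.ιMulti ℂ N (fun b : Fin N => (Pi.single (g b) 1 : Fin N → ℂ)) := by
    intro g
    rw [ExteriorAlgebra.ιMulti_apply]; rfl
  split_ifs with h
  · have h2 := (ExteriorAlgebra.ιMulti ℂ N (M := Fin N → ℂ)).map_perm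
      (fun b : Fin N => (Pi.single b 1 : Fin N → ℂ)) (Equiv.ofBijective g h)
    rw [e0]
    have : topg N = ExteriorAlgebra.ιMulti ℂ N (fun b : Fin N => (Pi.single b 1 : Fin N → ℂ)) :=
      e0 id
    rw [this]
    exact h2
  · rw [e0]
    have : ¬ Function.Injective g := fun hi => h (Finite.injective_iff_bijective.1 hi)
    apply AlternatingMap.map_eq_zero_of_not_injective
    intro hi
    apply this
    intro a b hab
    apply hi
    simp [hab]

theorem yv_prod (X : Fin N → Fin N → R) :
    (List.ofFn fun a => yv X a).prod = rdet X ⊗ₜ topg N := by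
  have h := (MultilinearMap.mkPiAlgebraFin ℂ N (R ⊗[ℂ] Ext N)).map_sum
    (fun (a : Fin N) (b : Fin N) => X a b ⊗ₜ[ℂ] ψg b)
  simp only [MultilinearMap.mkPiAlgebraFin_apply] at h
  have : (fun a => yv X a) = fun i => ∑ j, X i j ⊗ₜ[ℂ] ψg j := rfl
  rw [this, h]
  simp_rw [prod_tmul, top_perm]
  rw [rdet, TensorProduct.sum_tmul]
  have inj : Function.Injective (fun σ : Equiv.Perm (Fin N) => (σ : Fin N → Fin N)) :=
    DFunLike.coe_injective
  rw [← Finset.sum_subset (Finset.subset_univ (Finset.univ.map ⟨_, inj⟩))]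
  · rw [Finset.sum_map]
    apply Finset.sum_congr rfl
    intro σ _
    simp only [Function.Embedding.coeFn_mk]
    rw [dif_pos σ.bijective]
    have : Equiv.ofBijective σ σ.bijective = σ := by ext; rfl
    rw [this, TensorProduct.tmul_smul, TensorProduct.smul_tmul']
  · intro g _ hg
    rw [dif_neg, TensorProduct.tmul_zero]
    intro hb
    apply hg
    rw [Finset.mem_map]
    exact ⟨Equiv.ofBijective g hb, Finset.mem_univ _, rfl⟩

theorem rdet_eq_eps (X : Fin N → Fin N → R) :
    rdet X = epsR N R (List.ofFn fun a => yv X a).prod := by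
  rw [yv_prod, epsR_tmul, topc_top, one_smul]

theorem eq_zero_of_eq_neg' {W : Type*} [AddCommGroup W] [Module ℂ W] {x : W} (h : x = -x) :
    x = 0 := by
  have : (2 : ℂ) • x = 0 := by rw [two_smul]; nth_rw 1 [h]; simp
  simpa using this

theorem antisym_sum_zero (S : Fin N → Fin N → R) (hS : ∀ b d, S b d = S d b) :
    ∑ b, ∑ d, S b d ⊗ₜ[ℂ] (ψg b * ψg d : Ext N) = 0 := by
  apply eq_zero_of_eq_neg'
  conv_lhs => rw [Finset.sum_comm]
  rw [← Finset.sum_neg_distrib]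
  refine Finset.sum_congr rfl fun b _ => ?_
  rw [← Finset.sum_neg_distrib]
  refine Finset.sum_congr rfl fun d _ => ?_
  rw [ψg_anti, hS, TensorProduct.tmul_neg]

theorem yv_mul (X Z : Fin N → Fin N → R) (a c : Fin N) :
    yv X a * yv Z c = ∑ b, ∑ d, (X a b * Z c d) ⊗ₜ[ℂ] (ψg b * ψg d : Ext N) := by
  simp [yv, Finset.sum_mul, Finset.mul_sum]
  rw [Finset.sum_comm]

theorem yv_mul_swap (X Z : Fin N → Fin N → R) (a c : Fin N) :
    yv Z c * yv X a = - ∑ b, ∑ d, (Z c d * X a b) ⊗ₜ[ℂ] (ψg b * ψg d : Ext N) := by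
  rw [yv_mul, Finset.sum_comm, ← Finset.sum_neg_distrib]
  refine Finset.sum_congr rfl fun b _ => ?_
  rw [← Finset.sum_neg_distrib]
  refine Finset.sum_congr rfl fun d _ => ?_
  rw [ψg_anti, TensorProduct.tmul_neg]

theorem yv_anti_of_comm (X Z : Fin N → Fin N → R) (a c : Fin N)
    (h : ∀ b d, X a b * Z c d = Z c d * X a b) : yv X a * yv Z c = -(yv Z c * yv X a) := by
  rw [yv_mul_swap X Z a c, yv_mul, neg_neg]
  simp_rw [h]

/-- Manin relations -/
def Manin (X : Fin N → Fin N → R) : Prop :=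
  ∀ a b c d, X a b * X c d - X c d * X a b = X a d * X c b - X c b * X a d

theorem Manin.anti {X : Fin N → Fin N → R} (h : Manin X) (a c : Fin N) :
    yv X a * yv X c = -(yv X c * yv X a) := by
  rw [yv_mul_swap X X a c, yv_mul, neg_neg, ← sub_eq_zero, ← Finset.sum_sub_distrib]
  simp_rw [← Finset.sum_sub_distrib, ← TensorProduct.sub_tmul]
  exact antisym_sum_zero (fun b d => X a b * X c d - X c d * X a b) (fun b d => h a b c d)

theorem Manin.sq {X : Fin N → Fin N → R} (h : Manin X) (a : Fin N) :
    yv X a * yv X a = 0 := eq_zero_of_eq_neg' (h.anti a a)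

theorem rdet_rows_zero {X : Fin N → Fin N → R} (h : Manin X) (g : Fin N → Fin N)
    (hg : ¬ Function.Injective g) : rdet (fun a => X (g a)) = 0 := by
  rw [rdet_eq_eps]
  have : (List.ofFn fun a => yv (fun a => X (g a)) a) = (List.ofFn g).map (yv X) := by
    rw [List.map_ofFn]; rfl
  rw [this, prod_dup (yv X) h.anti h.sq, map_zero]
  rwa [List.nodup_ofFn]

end Rdet
end GaudinModel
end PartA2

section PartA3
open scoped TensorProduct
set_option linter.unusedSectionVars false
namespace GaudinModel

section Sys
variable {N : ℕ} {R : Type*} [Ring R] [Algebra ℂ R] {J : Type*} [DecidableEq J]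

/-- abstract Gaudin system: derivation `D`, simple poles `r j`, and `gl_N` actions `e j`. -/
structure GSys (D : R) (r : J → R) (e : J → Fin N → Fin N → R) : Prop where
  Dr : ∀ j, D * r j = r j * D - r j * r j
  rr : ∀ j k, r j * r k = r k * r j
  re : ∀ j k a b, r j * e k a b = e k a b * r j
  De : ∀ k a b, D * e k a b = e k a b * D
  gl : ∀ j a b c d, e j a b * e j c d - e j c d * e j a b =
    (if b = c then e j a d else 0) - (if d = a then e j c b else 0)
  ee : ∀ j k, j ≠ k → ∀ a b c d, e j a b * e k c d = e k c d * e j a b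

/-- the matrix `X` of a system, using the sites in `S` -/
def Xm (D : R) (r : J → R) (e : J → Fin N → Fin N → R) (K : Fin N → ℂ) (S : Finset J)
    (a b : Fin N) : R :=
  (if a = b then D - algebraMap ℂ R (K a) else 0) - ∑ j ∈ S, r j * e j b a

variable {D : R} {r : J → R} {e : J → Fin N → Fin N → R}

/-- `∑ r_j e^j_{ba}` -/
def Em (r : J → R) (e : J → Fin N → Fin N → R) (S : Finset J) (a b : Fin N) : R :=
  ∑ j ∈ S, r j * e j b a
/-- `∑ r_j^2 e^j_{ba}` -/
def Qm (r : J → R) (e : J → Fin N → Fin N → R) (S : Finset J) (a b : Fin N) : R :=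
  ∑ j ∈ S, r j * r j * e j b a

theorem GSys.DE (h : GSys D r e) (S : Finset J) (a b : Fin N) :
    D * Em r e S a b - Em r e S a b * D = - Qm r e S a b := by
  rw [Em, Qm, Finset.mul_sum, Finset.sum_mul, ← Finset.sum_sub_distrib, ← Finset.sum_neg_distrib]
  refine Finset.sum_congr rfl fun j _ => ?_
  rw [← mul_assoc, h.Dr, mul_assoc (r j), ← h.De]; noncomm_ring

theorem GSys.eE (h : GSys D r e) (S : Finset J) (k : J) (hk : k ∈ S) (a b c d : Fin N) :
    e k a b * Em r e S c d - Em r e S c d * e k a b =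
      (if b = d then r k * e k a c else 0) - (if c = a then r k * e k d b else 0) := by
  rw [Em, Finset.mul_sum, Finset.sum_mul, ← Finset.sum_sub_distrib, Finset.sum_eq_single k]
  · rw [← mul_assoc, ← h.re, mul_assoc, mul_assoc, ← mul_sub, h.gl, mul_sub]
    split_ifs <;> simp
  · intro j _ hj
    rw [← mul_assoc, ← h.re, mul_assoc, mul_assoc, h.ee j k hj]; simp
  · exact fun h => absurd hk h

theorem GSys.EEc (h : GSys D r e) (S : Finset J) (a b c d : Fin N) :
    Em r e S a b * Em r e S c d - Em r e S c d * Em r e S a b =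
      (if a = d then Qm r e S c b else 0) - (if c = b then Qm r e S a d else 0) := by
  have h1 : ∀ k ∈ S, r k * e k b a * Em r e S c d - Em r e S c d * (r k * e k b a) =
      (if a = d then r k * r k * e k b c else 0) - (if c = b then r k * r k * e k d a else 0) := by
    intro k hk
    have e1 : Em r e S c d * r k = r k * Em r e S c d := by
      rw [Em, Finset.mul_sum, Finset.sum_mul]
      refine Finset.sum_congr rfl fun j _ => ?_
      rw [mul_assoc, ← h.re, ← mul_assoc, ← mul_assoc, h.rr]
    rw [← mul_assoc (Em r e S c d), e1, mul_assoc, mul_assoc, ← mul_sub, h.eE S k hk, mul_sub]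
    split_ifs <;> simp [mul_assoc]
  conv_lhs => rw [Em, Finset.sum_mul, Finset.mul_sum, ← Finset.sum_sub_distrib]
  rw [Finset.sum_congr rfl h1, Finset.sum_sub_distrib, Qm, Qm]
  split_ifs <;> simp

theorem GSys.manin (h : GSys D r e) (K : Fin N → ℂ) (S : Finset J) : Manin (Xm D r e K S) := by
  have key : ∀ a b c d, Xm D r e K S a b * Xm D r e K S c d - Xm D r e K S c d * Xm D r e K S a b
      = (if a = b then Qm r e S c d else 0) - (if c = d then Qm r e S a b else 0)
        + ((if a = d then Qm r e S c b else 0) - (if c = b then Qm r e S a d else 0)) := by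
    intro a b c d
    rw [← h.EEc S a b c d]
    have h1 := h.DE S c d
    have h2 := h.DE S a b
    have k1 := Algebra.commutes (K a) (Em r e S c d)
    have k2 := Algebra.commutes (K c) (Em r e S a b)
    have k3 := Algebra.commutes (K a) D
    have k4 := Algebra.commutes (K c) D
    have k5 := Algebra.commutes (K a) (algebraMap ℂ R (K c))
    have hX : ∀ a b, Xm D r e K S a b
      = (if a = b then D - algebraMap ℂ R (K a) else 0) - Em r e S a b := fun _ _ => rfl
    rw [hX, hX]
    generalize Em r e S a b = E1 at *
    generalize Em r e S c d = E2 at *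
    generalize Qm r e S a b = Q1 at *
    generalize Qm r e S c d = Q2 at *
    generalize algebraMap ℂ R (K a) = p at *
    generalize algebraMap ℂ R (K c) = q at *
    have h1' : Q2 = E2 * D - D * E2 := by rw [← neg_sub, h1, neg_neg]
    have h2' : Q1 = E1 * D - D * E1 := by rw [← neg_sub, h2, neg_neg]
    subst h1' h2'
    split_ifs <;> simp only [sub_mul, mul_sub, zero_mul, mul_zero, k1, k2, k3, k4, k5] <;>
      abel
  intro a b c d
  rw [key, key]
  abel

theorem GSys.insert_eq (S : Finset J) (j : J) (hj : j ∉ S) (K : Fin N → ℂ) (a b : Fin N) :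
    Xm D r e K (insert j S) a b = Xm D r e K S a b - r j * e j b a := by
  rw [Xm, Xm, Finset.sum_insert hj]; abel

theorem GSys.e_comm_X (h : GSys D r e) (S : Finset J) (j : J) (hj : j ∉ S) (K : Fin N → ℂ)
    (a b c d : Fin N) : e j c d * Xm D r e K S a b = Xm D r e K S a b * e j c d := by
  rw [Xm, mul_sub, sub_mul, Finset.mul_sum, Finset.sum_mul]
  congr 1
  · split_ifs
    · rw [mul_sub, sub_mul, h.De, Algebra.commutes]
    · simp
  · refine Finset.sum_congr rfl fun k hk => ?_
    have : j ≠ k := fun h => hj (h ▸ hk)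
    rw [← mul_assoc, ← h.re, mul_assoc, mul_assoc, h.ee j k this]

theorem GSys.X_r (h : GSys D r e) (S : Finset J) (j : J) (K : Fin N → ℂ)
    (a b : Fin N) : Xm D r e K S a b * r j = r j * Xm D r e K S a b
      - (if a = b then r j * r j else 0) := by
  rw [Xm, sub_mul, mul_sub, Finset.sum_mul, Finset.mul_sum]
  have : ∑ i ∈ S, r i * e i b a * r j = ∑ i ∈ S, r j * (r i * e i b a) := by
    refine Finset.sum_congr rfl fun k _ => ?_
    rw [mul_assoc, ← h.re, ← mul_assoc, ← mul_assoc, h.rr]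
  rw [this]
  split_ifs
  · rw [sub_mul, mul_sub, h.Dr, Algebra.commutes]; abel
  · simp

/-- box condition: matrix units -/
def IsBox (e : Fin N → Fin N → R) : Prop :=
  (∀ a b c d, e a b * e c d = if b = c then e a d else 0) ∧ ∑ a, e a a = 1

/-- `η_a = ∑_b e_{ba} ψ_b` -/
abbrev ηv (e : Fin N → Fin N → R) (a : Fin N) : R ⊗[ℂ] Ext N := yv (fun a b => e b a) a

theorem tmul_one_mul_yv (x : R) (X : Fin N → Fin N → R) (a : Fin N) :
    (x ⊗ₜ[ℂ] (1 : Ext N)) * yv X a = yv (fun a b => x * X a b) a := by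
  simp [yv, Finset.mul_sum]

theorem yv_mul_tmul_one (x : R) (X : Fin N → Fin N → R) (a : Fin N) :
    yv X a * (x ⊗ₜ[ℂ] (1 : Ext N)) = yv (fun a b => X a b * x) a := by
  simp [yv, Finset.sum_mul]

theorem yv_sub (X Z : Fin N → Fin N → R) (a : Fin N) :
    yv (fun a b => X a b - Z a b) a = yv X a - yv Z a := by
  simp [yv, TensorProduct.sub_tmul]

theorem yv_sum {ι : Type*} (s : Finset ι) (X : ι → Fin N → Fin N → R) (a : Fin N) :
    yv (fun a b => ∑ i ∈ s, X i a b) a = ∑ i ∈ s, yv (X i) a := by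
  simp [yv, TensorProduct.sum_tmul]
  rw [Finset.sum_comm]

theorem yv_delta (x : R) (a : Fin N) :
    yv (fun a b => if a = b then x else 0) a = x ⊗ₜ ψg a := by
  rw [yv, Finset.sum_eq_single a]
  · simp
  · intro b _ hb; simp [hb.symm]
  · simp

variable (K : Fin N → ℂ) (S : Finset J) (j : J)

theorem GSys.η_anti (h : GSys D r e) (hj : j ∉ S) (a c : Fin N) :
    ηv (e j) a * yv (Xm D r e K S) c = -(yv (Xm D r e K S) c * ηv (e j) a) :=
  yv_anti_of_comm _ _ _ _ fun b d => h.e_comm_X S j hj K c d b a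

/-- removing a box from the product -/
theorem GSys.prod_insert (h : GSys D r e) (hj : j ∉ S) (hb : IsBox (e j)) (l : List (Fin N)) :
    (l.map (yv (Xm D r e K (insert j S)))).prod =
      (l.map (yv (Xm D r e K S))).prod -
        (r j ⊗ₜ 1) * insSum (yv (Xm D r e K S)) (ηv (e j)) l := by
  rw [← prod_sub_ins (yv (Xm D r e K S)) (ηv (e j)) (fun a => (1 : R) ⊗ₜ ψg a) (r j ⊗ₜ 1)]
  · congr 2
    funext a
    rw [tmul_one_mul_yv, ← yv_sub]
    congr 1
    funext a b
    exact GSys.insert_eq S j hj K a b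
  · exact fun a c => h.η_anti K S j hj a c
  · intro a c
    have := yv_anti_of_comm (fun a b => if a = b then (1 : R) else 0) (Xm D r e K S) a c
      (fun b d => by split_ifs <;> simp)
    rwa [yv_delta] at this
  · intro a c
    have e1 : (1 : R) ⊗ₜ[ℂ] ψg a * ηv (e j) c = - (ηv (e j) c * (1 : R) ⊗ₜ[ℂ] ψg a) := by
      have := yv_anti_of_comm (fun a b => if a = b then (1 : R) else 0) (fun a b => e j b a) a c
        (fun b d => by split_ifs <;> simp)
      rwa [yv_delta] at this
    have e2 : ηv (e j) a * ηv (e j) c = ηv (e j) c * (1 : R) ⊗ₜ[ℂ] ψg a := by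
      rw [yv_mul]
      simp only [hb.1]
      rw [show ηv (e j) c = ∑ b, e j b c ⊗ₜ[ℂ] ψg b from rfl, Finset.sum_mul]
      refine Finset.sum_congr rfl fun b _ => ?_
      rw [Finset.sum_eq_single a]
      · simp
      · intro d _ hd; simp [hd.symm]
      · simp
    rw [e1, e2]; simp
  · intro a
    rw [yv_mul_tmul_one, tmul_one_mul_yv]
    have : (fun a b => Xm D r e K S a b * r j) = fun a b => r j * Xm D r e K S a b
      - (if a = b then r j * r j else 0) := by
      funext a b; exact h.X_r S j K a b
    rw [this, yv_sub, yv_delta]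
    simp
  · intro a
    rw [yv_mul_tmul_one, tmul_one_mul_yv]
    congr 1
    funext a b
    exact (h.re _ _ _ _).symm

/-- the coefficient operator of the box `j` -/
def Tm (D : R) (r : J → R) (e : J → Fin N → Fin N → R) (K : Fin N → ℂ) (S : Finset J) (j : J) : R :=
  epsR N R (insSum (yv (Xm D r e K S)) (ηv (e j)) (List.ofFn id))

theorem rdet_eq_eps' (X : Fin N → Fin N → R) :
    rdet X = epsR N R ((List.ofFn id).map (yv X)).prod := by
  rw [rdet_eq_eps, List.map_ofFn]; rfl

theorem GSys.rdet_insert (h : GSys D r e) (hj : j ∉ S) (hb : IsBox (e j)) :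
    rdet (Xm D r e K (insert j S)) = rdet (Xm D r e K S) - r j * Tm D r e K S j := by
  rw [rdet_eq_eps', h.prod_insert K S j hj hb, map_sub, ← rdet_eq_eps', epsR_mul, Tm]

/-- `𝒴 = ∑ e_{cd} Y_{cd}` -/
def Ym (D : R) (r : J → R) (e : J → Fin N → Fin N → R) (K : Fin N → ℂ) (S : Finset J) (j : J) : R :=
  ∑ c, ∑ d, e j c d * Xm D r e K S c d

theorem GSys.Y_T (h : GSys D r e) (hj : j ∉ S) (hb : IsBox (e j)) :
    Ym D r e K S j * Tm D r e K S j = rdet (Xm D r e K S) := by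
  set y := yv (Xm D r e K S) with hy
  set Y1 : R ⊗[ℂ] Ext N := Ym D r e K S j ⊗ₜ 1
  have hm := h.manin K S
  have hcomm : ∀ a b k, (e j a b ⊗ₜ[ℂ] (1 : Ext N)) * y k = y k * (e j a b ⊗ₜ[ℂ] (1 : Ext N)) := by
    intro a b k
    rw [hy, yv_mul_tmul_one, tmul_one_mul_yv]
    congr 1
    funext c d
    exact h.e_comm_X S j hj K c d a b
  have h1 := mul_insSum y (ηv (e j)) (fun a => ∑ c, (e j c a ⊗ₜ[ℂ] (1 : Ext N)) * y c) Y1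
    (fun a c => h.η_anti K S j hj a c)
    (fun i k => by
      rw [Finset.sum_mul, Finset.mul_sum, ← Finset.sum_neg_distrib]
      refine Finset.sum_congr rfl fun c _ => ?_
      rw [mul_assoc, hm.anti c k, mul_neg, ← mul_assoc, hcomm, mul_assoc])
    (fun a => by
      rw [tmul_one_mul_yv]
      have : (fun c : Fin N => e j c a ⊗ₜ[ℂ] (1 : Ext N) * y c) = fun c =>
        yv (fun k b => e j c a * Xm D r e K S c b) a := by
        funext c; rw [hy, tmul_one_mul_yv]; rfl
      rw [this, ← yv_sum]
      have e2 : ∀ b, Ym D r e K S j * e j b a = ∑ c, e j c a * Xm D r e K S c b := by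
        intro b
        rw [Ym, Finset.sum_mul]
        refine Finset.sum_congr rfl fun c _ => ?_
        rw [Finset.sum_mul, Finset.sum_eq_single b]
        · rw [mul_assoc, ← h.e_comm_X S j hj, ← mul_assoc, hb.1]; simp
        · intro d _ hd
          rw [mul_assoc, ← h.e_comm_X S j hj, ← mul_assoc, hb.1]; simp [hd]
        · simp
      simp only [yv, e2])
    (List.ofFn id) []
  have h2 := insSum_full y (fun a b => e j a b ⊗ₜ[ℂ] (1 : Ext N)) hm.anti hm.sq hcomm
    (List.ofFn id) [] (by simp)
  rw [h2] at h1
  simp only [List.map_nil, List.prod_nil, one_mul, List.nil_append] at h1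
  have h3 : ((List.ofFn id).map fun i : Fin N => e j i i ⊗ₜ[ℂ] (1 : Ext N)).sum = 1 := by
    rw [List.map_ofFn, List.sum_ofFn]
    simp only [Function.comp, id]
    rw [← TensorProduct.sum_tmul, hb.2]; rfl
  rw [h3, one_mul] at h1
  rw [rdet_eq_eps', ← hy, ← h1, epsR_mul]; rfl

end Sys
end GaudinModel
end PartA3

section PartA4
open scoped TensorProduct
set_option linter.unusedSectionVars false
namespace GaudinModel

section Central
variable {N : ℕ} {R : Type*} [Ring R] [Algebra ℂ R] {J : Type*} [DecidableEq J]

theorem comm_prod {A I : Type*} [Ring A] (y : I → A) (g : A) (l : List I) :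
    g * (l.map y).prod - (l.map y).prod * g = insSum y (fun a => g * y a - y a * g) l := by
  induction l with
  | nil => simp [insSum]
  | cons i l ih => 
    rw [insSum, ← ih, List.map_cons, List.prod_cons]; noncomm_ring

theorem insSum_single {A I : Type*} [Ring A] [DecidableEq I] (y t : I → A) (k : I) (l : List I)
    (hl : l.Nodup) : insSum y (fun a => if a = k then t a else 0) l =
      if k ∈ l then (l.map (Function.update y k (t k))).prod else 0 := by
  induction l with
  | nil => simp [insSum]
  | cons i l ih =>
    rw [List.nodup_cons] at hl
    rw [insSum, ih hl.2]
    by_cases hik : i = k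
    · subst hik
      have : l.map (Function.update y i (t i)) = l.map y := by
        apply List.map_congr_left
        intro a ha
        rw [Function.update_of_ne]
        rintro rfl; exact hl.1 ha
      simp [hl.1, this]
    · have hki : k ≠ i := fun h => hik h.symm
      by_cases hk : k ∈ l <;> simp [hik, hk, hki]

theorem insSum_sub {A I : Type*} [Ring A] (y s t : I → A) (l : List I) :
    insSum y (fun a => s a - t a) l = insSum y s l - insSum y t l := by
  induction l with
  | nil => simp [insSum]
  | cons i l ih => simp only [insSum, ih]; noncomm_ring

theorem rdet_comm (X : Fin N → Fin N → R) (g : R) (c d : Fin N)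
    (hg : ∀ a b, g * X a b - X a b * g =
      (if b = d then X a c else 0) - (if a = c then X d b else 0))
    (hX : c ≠ d → Manin X) : g * rdet X = rdet X * g := by
  rw [← sub_eq_zero]
  have key : g * rdet X - rdet X * g =
      (∑ σ : Equiv.Perm (Fin N), ((Equiv.Perm.sign σ : ℤˣ) : ℤ) •
        (List.ofFn fun a => X a (Function.update id d c (σ a))).prod)
      - rdet (fun a => X (Function.update id c d a)) := by
    rw [rdet, rdet, Finset.mul_sum, Finset.sum_mul, ← Finset.sum_sub_distrib,
      ← Finset.sum_sub_distrib]
    refine Finset.sum_congr rfl fun σ _ => ?_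
    rw [mul_smul_comm, smul_mul_assoc, ← smul_sub, ← smul_sub]
    congr 1
    have h1 := comm_prod (fun a => X a (σ a)) g (List.ofFn id)
    simp only [hg, insSum_sub] at h1
    have h2 : (fun a => if σ a = d then X a c else 0) =
        (fun a => if a = σ.symm d then X a c else 0) := by
      funext a
      simp only [Equiv.eq_symm_apply]
    rw [h2, insSum_single _ _ _ _ (by simp [List.nodup_ofFn, Function.injective_id]),
      insSum_single _ _ _ _ (by simp [List.nodup_ofFn, Function.injective_id])] at h1
    simp only [List.mem_ofFn, id, exists_eq, if_true, List.map_ofFn] at h1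
    simp only [Function.comp_id] at h1
    rw [h1]
    congr 3
    · funext a
      by_cases ha : σ a = d
      · have : a = σ.symm d := by rw [← ha]; simp
        subst this; simp
      · have : a ≠ σ.symm d := by rintro rfl; simp at ha
        simp [ha, this]
    · funext a
      by_cases ha : a = c
      · subst ha; simp
      · simp [ha]
  rw [key]
  by_cases hcd : c = d
  · subst hcd
    rw [Function.update_eq_self_iff.2 (by simp)]
    simp [rdet]
  · rw [rdet_rows_zero (hX hcd), sub_zero]
    · apply eq_zero_of_eq_neg'
      rw [← Finset.sum_neg_distrib]
      refine Finset.sum_equiv (Equiv.mulLeft (Equiv.swap c d)) (by simp) ?_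
      intro σ _
      simp only [Equiv.coe_mulLeft, Equiv.Perm.sign_mul, Equiv.Perm.sign_swap hcd]
      have : (fun a => X a (Function.update id d c ((Equiv.swap c d * σ) a))) =
          fun a => X a (Function.update id d c (σ a)) := by
        funext a
        congr 1
        simp only [Equiv.Perm.mul_apply]
        by_cases h1 : σ a = c
        · simp [h1, hcd]
        · by_cases h2 : σ a = d
          · simp [h2, hcd]
          · rw [Equiv.swap_apply_of_ne_of_ne h1 h2]
      rw [this]
      simp
    · intro hi
      have := @hi c d (by simp [Function.update_of_ne (Ne.symm hcd)])
      exact hcd this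

theorem GSys.rdet_total_comm {D : R} {r : J → R} {e : J → Fin N → Fin N → R} (h : GSys D r e)
    (K : Fin N → ℂ) (S : Finset J) (c d : Fin N) (hK : K c = K d) :
    (∑ j ∈ S, e j c d) * rdet (Xm D r e K S) = rdet (Xm D r e K S) * (∑ j ∈ S, e j c d) := by
  apply rdet_comm _ _ c d _ (fun _ => h.manin K S)
  intro a b
  have hX : ∀ a b, Xm D r e K S a b
      = (if a = b then D - algebraMap ℂ R (K a) else 0) - Em r e S a b := fun _ _ => rfl
  have h1 : (∑ j ∈ S, e j c d) * Em r e S a b - Em r e S a b * (∑ j ∈ S, e j c d) =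
      (if d = b then Em r e S a c else 0) - (if a = c then Em r e S d b else 0) := by
    rw [Finset.sum_mul, Finset.mul_sum, ← Finset.sum_sub_distrib,
      Finset.sum_congr rfl (fun k hk => h.eE S k hk c d a b), Finset.sum_sub_distrib]
    split_ifs <;> simp [Em]
  have h2 : ∀ a, (∑ j ∈ S, e j c d) * (D - algebraMap ℂ R (K a)) =
      (D - algebraMap ℂ R (K a)) * (∑ j ∈ S, e j c d) := by
    intro a
    rw [mul_sub, sub_mul, Algebra.commutes, Finset.sum_mul, Finset.mul_sum]
    simp only [h.De]
  have h3 : (∑ j ∈ S, e j c d) * Xm D r e K S a b - Xm D r e K S a b * (∑ j ∈ S, e j c d) =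
      - ((if d = b then Em r e S a c else 0) - (if a = c then Em r e S d b else 0)) := by
    rw [← h1, hX, mul_sub, sub_mul]
    split_ifs
    · rw [h2]; abel
    · simp only [mul_zero, zero_mul]; abel
  rw [h3, hX, hX]
  by_cases h4 : d = b <;> by_cases h5 : a = c
  · subst h4 h5; simp [hK]
  · subst h4; simp [h5]
  · subst h5; simp [h4, Ne.symm h4]
  · simp [h4, h5, Ne.symm h4]

end Central

section PF
variable {N : ℕ} {R : Type*} [Ring R] [Algebra ℂ R] {J : Type*} [DecidableEq J]

/-- partial-fraction module -/
def PFMod {A : Type*} [Ring A] [Algebra ℂ A] (B : Subalgebra ℂ A) (s : J → A) (S : Finset J)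
    (x : A) : Prop :=
  ∃ b0 ∈ B, ∃ b : J → A, (∀ k, b k ∈ B) ∧ x = b0 + ∑ k ∈ S, s k * b k

variable {A : Type*} [Ring A] [Algebra ℂ A] {B : Subalgebra ℂ A} {s : J → A} {S : Finset J}

theorem PFMod.add {x y : A} (hx : PFMod B s S x) (hy : PFMod B s S y) : PFMod B s S (x + y) := by
  obtain ⟨b0, h0, b, hb, rfl⟩ := hx
  obtain ⟨c0, k0, c, hc, rfl⟩ := hy
  refine ⟨b0 + c0, B.add_mem h0 k0, fun k => b k + c k, fun k => B.add_mem (hb k) (hc k), ?_⟩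
  simp only [mul_add, Finset.sum_add_distrib]; abel

theorem PFMod.mul {x g : A} (hx : PFMod B s S x) (hg : g ∈ B) (hc : ∀ k, g * s k = s k * g) :
    PFMod B s S (g * x) := by
  obtain ⟨b0, h0, b, hb, rfl⟩ := hx
  refine ⟨g * b0, B.mul_mem hg h0, fun k => g * b k, fun k => B.mul_mem hg (hb k), ?_⟩
  simp only [mul_add, Finset.mul_sum, ← mul_assoc, hc]

theorem PFMod.zero : PFMod B s S 0 :=
  ⟨0, B.zero_mem, fun _ => 0, fun _ => B.zero_mem, by simp⟩

theorem PFMod.insSum {I : Type*} (y η : I → A) (h1 : ∀ i k, η i * y k = - (y k * η i))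
    (hη : ∀ i, η i ∈ B) (hc : ∀ i k, η i * s k = s k * η i)
    (hp : ∀ l : List I, PFMod B s S (l.map y).prod) (l : List I) :
    PFMod B s S (insSum y η l) := by
  have key : ∀ l p : List I, PFMod B s S ((p.map y).prod * GaudinModel.insSum y η l) := by
    intro l
    induction l with
    | nil => intro p; simpa [GaudinModel.insSum] using PFMod.zero
    | cons i l ih =>
      intro p
      rw [GaudinModel.insSum, mul_add]
      refine PFMod.add ?_ ?_
      · rw [← mul_assoc, prod_anti y _ (h1 i), mul_assoc, mul_assoc]
        apply PFMod.mul
        · apply PFMod.mul _ (hη i) (hc i)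
          have := hp (p ++ l)
          rwa [List.map_append, List.prod_append] at this
        · exact B.pow_mem (B.neg_mem B.one_mem) _
        · intro k
          exact ((((Commute.one_right (s k)).neg_right).pow_right _).eq).symm
      · have := ih (p ++ [i])
        simpa [List.map_append, List.prod_append, mul_assoc] using this
  simpa using key l []

theorem PFMod.pole {x : A} (ρ : J → J → ℂ) (j : J)
    (hpf : ∀ k ∈ S, s j * s k = ρ j k • (s j - s k)) (hj : j ∉ S) (hx : PFMod B s S x) :
    ∃ b : J → A, (∀ k, b k ∈ B) ∧ s j * x = ∑ k ∈ insert j S, s k * b k := by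
  obtain ⟨b0, h0, b, hb, rfl⟩ := hx
  refine ⟨fun k => if k = j then b0 + ∑ l ∈ S, ρ j l • b l else - (ρ j k • b k), ?_, ?_⟩
  · intro k
    dsimp only
    split_ifs
    · exact B.add_mem h0 (B.sum_mem fun l _ => B.smul_mem (hb l) _)
    · exact B.neg_mem (B.smul_mem (hb k) _)
  · rw [Finset.sum_insert hj]
    simp only [if_true]
    have : ∑ k ∈ S, s k * (if k = j then b0 + ∑ l ∈ S, ρ j l • b l else - (ρ j k • b k)) =
        ∑ k ∈ S, - (ρ j k • (s k * b k)) := by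
      refine Finset.sum_congr rfl fun k hk => ?_
      have : k ≠ j := fun h => hj (h ▸ hk)
      rw [if_neg this]; simp
    rw [this, mul_add, mul_add, add_assoc]
    congr 1
    rw [Finset.mul_sum, Finset.mul_sum, ← Finset.sum_add_distrib]
    refine Finset.sum_congr rfl fun k hk => ?_
    have : j ≠ k := fun h => hj (h ▸ hk)
    rw [← mul_assoc, hpf k hk]
    rw [smul_mul_assoc, sub_mul, smul_sub, mul_smul_comm, sub_eq_add_neg]

theorem GSys.pf {D : R} {r : J → R} {e : J → Fin N → Fin N → R} (h : GSys D r e)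
    (K : Fin N → ℂ) (B : Subalgebra ℂ (R ⊗[ℂ] Ext N))
    (ρ : J → J → ℂ) (S : Finset J)
    (hpf : ∀ j ∈ S, ∀ k ∈ S, j ≠ k → r j * r k = ρ j k • (r j - r k))
    (hbox : ∀ j, IsBox (e j)) (hη : ∀ j a, ηv (e j) a ∈ B)
    (hD : ∀ a, yv (Xm D r e K ∅) a ∈ B) (l : List (Fin N)) :
    ∃ b : J → R ⊗[ℂ] Ext N, (∀ k, b k ∈ B) ∧ (l.map (yv (Xm D r e K S))).prod =
      (l.map (yv (Xm D r e K ∅))).prod + ∑ k ∈ S, (r k ⊗ₜ 1) * b k := by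
  induction S using Finset.induction_on generalizing l with
  | empty => exact ⟨fun _ => 0, fun _ => B.zero_mem, by simp⟩
  | insert j S hj ih =>
    replace ih := ih (fun a ha b hb => hpf a (Finset.mem_insert_of_mem ha) b
      (Finset.mem_insert_of_mem hb))
    have hconst : ∀ l : List (Fin N), (l.map (yv (Xm D r e K ∅))).prod ∈ B := by
      intro l
      apply B.list_prod_mem
      intro x hx
      rw [List.mem_map] at hx
      obtain ⟨a, _, rfl⟩ := hx
      exact hD a
    have h1 : ∀ l : List (Fin N), PFMod B (fun k => r k ⊗ₜ[ℂ] (1 : Ext N)) S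
        (l.map (yv (Xm D r e K S))).prod := by
      intro l
      obtain ⟨b, hb, hb2⟩ := ih l
      exact ⟨_, hconst l, b, hb, hb2⟩
    have h2 := PFMod.insSum (yv (Xm D r e K S)) (ηv (e j)) (fun a c => h.η_anti K S j hj a c)
      (hη j) (fun a k => by
        rw [yv_mul_tmul_one, tmul_one_mul_yv]
        congr 1
        funext a b
        exact (h.re _ _ _ _).symm) h1 l
    obtain ⟨b, hb, hb2⟩ := PFMod.pole (s := fun k => r k ⊗ₜ[ℂ] (1 : Ext N)) ρ j (fun k hk => by
      have hjk : j ≠ k := fun h => hj (h ▸ hk)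
      simp only [Algebra.TensorProduct.tmul_mul_tmul, mul_one, hpf j (Finset.mem_insert_self _ _)
        k (Finset.mem_insert_of_mem hk) hjk]
      rw [← TensorProduct.sub_tmul, TensorProduct.smul_tmul']) hj h2
    obtain ⟨b', hb', hb2'⟩ := ih l
    rw [h.prod_insert K S j hj (hbox j), hb2, hb2']
    refine ⟨fun k => (if k = j then 0 else b' k) - b k, fun k => ?_, ?_⟩
    · apply B.sub_mem _ (hb k)
      split_ifs
      · exact B.zero_mem
      · exact hb' k
    · simp only [mul_sub, Finset.sum_sub_distrib]
      rw [add_sub_assoc]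
      congr 2
      rw [Finset.sum_insert hj]
      simp only [if_true, mul_zero, zero_add]
      refine Finset.sum_congr rfl fun k hk => ?_
      have : k ≠ j := fun h => hj (h ▸ hk)
      rw [if_neg this]

theorem GSys.pfIns {D : R} {r : J → R} {e : J → Fin N → Fin N → R} (h : GSys D r e)
    (K : Fin N → ℂ) (B : Subalgebra ℂ (R ⊗[ℂ] Ext N))
    (ρ : J → J → ℂ) (S : Finset J)
    (hpf : ∀ j ∈ S, ∀ k ∈ S, j ≠ k → r j * r k = ρ j k • (r j - r k))
    (hbox : ∀ j, IsBox (e j)) (hη : ∀ j a, ηv (e j) a ∈ B)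
    (hD : ∀ a, yv (Xm D r e K ∅) a ∈ B) (j : J) (hj : j ∉ S) (l : List (Fin N)) :
    PFMod B (fun k => r k ⊗ₜ[ℂ] (1 : Ext N)) S (insSum (yv (Xm D r e K S)) (ηv (e j)) l) := by
  refine PFMod.insSum (yv (Xm D r e K S)) (ηv (e j)) (fun a c => h.η_anti K S j hj a c)
      (hη j) (fun a k => by
        rw [yv_mul_tmul_one, tmul_one_mul_yv]
        congr 1
        funext a b
        exact (h.re _ _ _ _).symm) ?_ l
  intro l
  obtain ⟨b, hb, hb2⟩ := h.pf K B ρ S hpf hbox hη hD l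
  refine ⟨_, ?_, b, hb, hb2⟩
  apply B.list_prod_mem
  intro x hx
  rw [List.mem_map] at hx
  obtain ⟨a, _, rfl⟩ := hx
  exact hD a

end PF
end GaudinModel
end PartA4

section PartB1
open scoped TensorProduct
set_option linter.unusedSectionVars false
namespace GaudinModel

section Formal
variable {M : Type*} [AddCommGroup M] [Module ℂ M]

/-- formal derivative on Taylor coefficient sequences -/
def dF (M : Type*) [AddCommGroup M] [Module ℂ M] : Module.End ℂ (ℕ → M) where
  toFun f s := ((s : ℂ) + 1) • f (s + 1)
  map_add' f g := by funext s; simp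
  map_smul' c f := by funext s; simp [smul_comm c]

/-- shift: `(xF f) s = f (s-1)` -/
def xF (f : ℕ → M) : ℕ → M
  | 0 => 0
  | s + 1 => f s

/-- multiplication by `x + a` -/
def tF (M : Type*) [AddCommGroup M] [Module ℂ M] (a : ℂ) : Module.End ℂ (ℕ → M) where
  toFun f s := a • f s + xF f s
  map_add' f g := by funext s; cases s <;> simp [xF]; abel
  map_smul' c f := by funext s; cases s <;> simp [xF, smul_comm c]

/-- division by `x + a` -/
def rFun (a : ℂ) (f : ℕ → M) : ℕ → M
  | 0 => a⁻¹ • f 0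
  | s + 1 => a⁻¹ • (f (s + 1) - rFun a f s)

def rF (M : Type*) [AddCommGroup M] [Module ℂ M] (a : ℂ) : Module.End ℂ (ℕ → M) where
  toFun f := rFun a f
  map_add' f g := by
    funext s
    induction s with
    | zero => simp [rFun]
    | succ s ih => simp only [rFun, Pi.add_apply] at *; rw [ih, ← smul_add]; congr 1; abel
  map_smul' c f := by
    funext s
    induction s with
    | zero => simp [rFun, smul_comm c]
    | succ s ih => simp only [rFun, Pi.smul_apply, RingHom.id_apply] at *; rw [ih, ← smul_sub, smul_comm]

/-- coefficientwise action -/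
def cF (M : Type*) [AddCommGroup M] [Module ℂ M] : Module.End ℂ M →ₐ[ℂ] Module.End ℂ (ℕ → M) where
  toFun A := { toFun := fun f s => A (f s)
               map_add' := fun f g => by funext s; simp
               map_smul' := fun c f => by funext s; simp }
  map_one' := rfl
  map_mul' _ _ := rfl
  map_zero' := rfl
  map_add' _ _ := rfl
  commutes' _ := rfl

@[simp] theorem dF_apply (f : ℕ → M) (s : ℕ) : dF M f s = ((s : ℂ) + 1) • f (s + 1) := rfl
@[simp] theorem cF_apply (A : Module.End ℂ M) (f : ℕ → M) (s : ℕ) : cF M A f s = A (f s) := rfl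
theorem tF_apply (a : ℂ) (f : ℕ → M) (s : ℕ) : tF M a f s = a • f s + xF f s := rfl
theorem rF_zero (a : ℂ) (f : ℕ → M) : rF M a f 0 = a⁻¹ • f 0 := rfl
theorem rF_succ (a : ℂ) (f : ℕ → M) (s : ℕ) :
    rF M a f (s + 1) = a⁻¹ • (f (s + 1) - rF M a f s) := rfl

theorem tr_one {a : ℂ} (ha : a ≠ 0) : tF M a * rF M a = 1 := by
  ext1 f; funext s
  rw [Module.End.mul_apply, tF_apply, Module.End.one_apply]
  cases s with
  | zero => rw [rF_zero, smul_smul, mul_inv_cancel₀ ha]; simp [xF]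
  | succ s => rw [rF_succ, smul_smul, mul_inv_cancel₀ ha]; simp [xF]

theorem rt_one {a : ℂ} (ha : a ≠ 0) : rF M a * tF M a = 1 := by
  ext1 f; funext s
  rw [Module.End.mul_apply, Module.End.one_apply]
  induction s with
  | zero => rw [rF_zero, tF_apply]; simp [xF, smul_smul, inv_mul_cancel₀ ha]
  | succ s ih => rw [rF_succ, ih, tF_apply]; simp [xF, smul_smul, inv_mul_cancel₀ ha]

theorem dt (a : ℂ) : dF M * tF M a = tF M a * dF M + 1 := by
  ext1 f; funext s
  simp only [Module.End.mul_apply, LinearMap.add_apply, Pi.add_apply, dF_apply, tF_apply,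
    Module.End.one_apply]
  cases s with
  | zero => simp [xF]
  | succ s => simp only [xF, dF_apply]; push_cast; module

theorem tt (a b : ℂ) : tF M a * tF M b = tF M b * tF M a := by
  ext1 f; funext s
  simp only [Module.End.mul_apply, tF_apply]
  cases s with
  | zero => simp [xF, smul_smul, mul_comm]
  | succ s => simp [xF, tF_apply, smul_smul, mul_comm]; abel

theorem tc (a : ℂ) (A : Module.End ℂ M) : tF M a * cF M A = cF M A * tF M a := by
  ext1 f; funext s
  simp only [Module.End.mul_apply, tF_apply, cF_apply]
  cases s <;> simp [xF]

theorem dc (A : Module.End ℂ M) : dF M * cF M A = cF M A * dF M := by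
  ext1 f; funext s
  simp

theorem t_sub (a b : ℂ) : tF M b - tF M a = (b - a) • 1 := by
  ext1 f; funext s
  simp [tF_apply, sub_smul]

theorem r_comm_of_t {a : ℂ} (ha : a ≠ 0) (X : Module.End ℂ (ℕ → M))
    (h : tF M a * X = X * tF M a) : rF M a * X = X * rF M a := by
  calc rF M a * X = rF M a * X * (tF M a * rF M a) := by rw [tr_one ha, mul_one]
    _ = rF M a * (X * tF M a) * rF M a := by noncomm_ring
    _ = (rF M a * tF M a) * X * rF M a := by rw [← h]; noncomm_ring
    _ = X * rF M a := by rw [rt_one ha, one_mul]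

theorem rc {a : ℂ} (ha : a ≠ 0) (A : Module.End ℂ M) : rF M a * cF M A = cF M A * rF M a :=
  r_comm_of_t ha _ (tc a A)

theorem rr' {a b : ℂ} (ha : a ≠ 0) (hb : b ≠ 0) : rF M a * rF M b = rF M b * rF M a :=
  r_comm_of_t ha _ (r_comm_of_t hb _ (tt b a)).symm

theorem dr {a : ℂ} (ha : a ≠ 0) : dF M * rF M a = rF M a * dF M - rF M a * rF M a := by
  have h := congrArg (fun X => rF M a * X * rF M a) (dt (M := M) a)
  simp only [mul_add, add_mul, mul_one] at h
  rw [← mul_assoc (rF M a) (tF M a), rt_one ha, one_mul, mul_assoc, mul_assoc, tr_one ha,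
    mul_one] at h
  rw [h]; abel

theorem r_pf {a b : ℂ} (ha : a ≠ 0) (hb : b ≠ 0) (hab : a ≠ b) :
    rF M a * rF M b = (b - a)⁻¹ • (rF M a - rF M b) := by
  have h : rF M a * (tF M b - tF M a) * rF M b = rF M a - rF M b := by
    rw [mul_sub, sub_mul, mul_assoc, tr_one hb, rt_one ha, mul_one, one_mul]
  rw [← h, t_sub]
  simp [smul_smul, inv_mul_cancel₀ (sub_ne_zero.2 hab.symm)]

/-- data of commuting `gl_N` actions on a module -/
structure GlSys {N : ℕ} {J : Type*} (e : J → Fin N → Fin N → Module.End ℂ M) : Prop where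
  gl : ∀ j a b c d, e j a b * e j c d - e j c d * e j a b =
    (if b = c then e j a d else 0) - (if d = a then e j c b else 0)
  ee : ∀ j k, j ≠ k → ∀ a b c d, e j a b * e k c d = e k c d * e j a b

/-- formal universal operator, `c j = u0 - w j`. -/
def Df {N : ℕ} {J : Type*} [Fintype J] (e : J → Fin N → Fin N → Module.End ℂ M) (K : Fin N → ℂ)
    (c : J → ℂ) : Module.End ℂ (ℕ → M) :=
  rdet (Xm (dF M) (fun j => rF M (c j)) (fun j a b => cF M (e j a b)) K Finset.univ)

theorem rF_zero_eq : rF M 0 = 0 := by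
  ext1 f; funext s
  induction s with
  | zero => simp [rF_zero]
  | succ s ih => simp [rF_succ]

theorem GlSys.gsys {N : ℕ} {J : Type*} {e : J → Fin N → Fin N → Module.End ℂ M} (h : GlSys e)
    (c : J → ℂ) :
    GSys (dF M) (fun j => rF M (c j)) (fun j a b => cF M (e j a b)) where
  Dr j := by
    by_cases hc : c j = 0
    · simp [hc, rF_zero_eq]
    · exact dr hc
  rr j k := by
    by_cases hc : c j = 0
    · simp [hc, rF_zero_eq]
    by_cases hk : c k = 0
    · simp [hk, rF_zero_eq]
    exact rr' hc hk
  re j k a b := by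
    by_cases hc : c j = 0
    · simp [hc, rF_zero_eq]
    exact rc hc _
  De k a b := dc _
  gl j a b c d := by
    rw [← map_mul, ← map_mul, ← map_sub, h.gl, map_sub]
    split_ifs <;> simp
  ee j k hjk a b c d := by rw [← map_mul, h.ee j k hjk, map_mul]

end Formal
end GaudinModel
end PartB1

section PartB2
open scoped TensorProduct Polynomial
set_option linter.unusedSectionVars false
namespace GaudinModel

section PolyEv
variable {M : Type*} [AddCommGroup M] [Module ℂ M]

/-- evaluation of a polynomial with operator coefficients at `∂` -/
def evP (M : Type*) [AddCommGroup M] [Module ℂ M] :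
    (Module.End ℂ M)[X] →ₐ[ℂ] Module.End ℂ (ℕ → M) :=
  Polynomial.eval₂AlgHom (cF M) (dF M) (fun a => (dc a).symm)

theorem evP_C (A : Module.End ℂ M) : evP M (Polynomial.C A) = cF M A :=
  Polynomial.eval₂_C _ _
theorem evP_X : evP M Polynomial.X = dF M :=
  Polynomial.eval₂_X _ _

theorem dF_pow_zero (k : ℕ) (f : ℕ → M) : ((dF M) ^ k) f 0 = (k.factorial : ℂ) • f k := by
  have : ∀ s, ((dF M) ^ k) f s = ((s + 1).ascFactorial k : ℂ) • f (s + k) := by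
    induction k with
    | zero => intro s; simp
    | succ k ih =>
      intro s
      rw [pow_succ', Module.End.mul_apply, dF_apply, ih, smul_smul]
      congr 1
      · rw [Nat.ascFactorial_succ, show s + 1 + 1 = s + 1 + 1 from rfl]
        have := Nat.succ_ascFactorial (s+1) k
        rw [← Nat.ascFactorial_succ, Nat.ascFactorial_succ]
        have h2 : (((s+1) * (s+1+1).ascFactorial k : ℕ) : ℂ) = (((s+1+k) * (s+1).ascFactorial k : ℕ) : ℂ) := by
          exact_mod_cast this
        push_cast at h2 ⊢
        linear_combination h2
      · congr 1; omega
  rw [this]; simp [Nat.one_ascFactorial]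

theorem evP_inj (A : (Module.End ℂ M)[X]) (h : ∀ f : ℕ → M, evP M A f 0 = 0) : A = 0 := by
  have h1 : ∀ f : ℕ → M, evP M A f 0 = A.sum fun k a => a ((k.factorial : ℂ) • f k) := by
    intro f
    have : evP M A = A.sum fun k a => cF M a * (dF M) ^ k :=
      Polynomial.eval₂_eq_sum
    rw [this, Polynomial.sum_def, Polynomial.sum_def, LinearMap.sum_apply, Finset.sum_apply]
    refine Finset.sum_congr rfl fun k _ => ?_
    rw [Module.End.mul_apply, cF_apply, dF_pow_zero]
  ext k x
  have h2 := h1 (Pi.single k ((k.factorial : ℂ)⁻¹ • x))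
  rw [h, Polynomial.sum_def, Finset.sum_eq_single k] at h2
  · rw [Pi.single_eq_same, smul_smul, mul_inv_cancel₀ (by exact_mod_cast k.factorial_ne_zero),
      one_smul] at h2
    simpa using h2.symm
  · intro b _ hb
    rw [Pi.single_eq_of_ne hb]; simp
  · intro hk
    rw [Polynomial.notMem_support_iff.1 hk]; simp

theorem rdet_map {N : ℕ} {R R' : Type*} [Ring R] [Algebra ℂ R] [Ring R'] [Algebra ℂ R']
    (φ : R →ₐ[ℂ] R') (X : Fin N → Fin N → R) :
    φ (rdet X) = rdet (fun a b => φ (X a b)) := by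
  simp [rdet, map_sum, map_list_prod, List.map_ofFn, Function.comp_def]

theorem rdet_diag {N : ℕ} {R : Type*} [Ring R] [Algebra ℂ R] (x : Fin N → R) :
    rdet (fun a b => if a = b then x a else 0) = (List.ofFn x).prod := by
  rw [rdet, Finset.sum_eq_single 1]
  · simp
  · intro σ _ hσ
    obtain ⟨a, ha⟩ : ∃ a, σ a ≠ a := by
      by_contra! hh; exact hσ (Equiv.ext hh)
    rw [List.prod_eq_zero, smul_zero]
    rw [List.mem_ofFn]
    exact ⟨a, by simp [ha.symm]⟩
  · simp

/-- scalar polynomial `∏ (X - K a)` -/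
def KP {N : ℕ} (K : Fin N → ℂ) : ℂ[X] := ∏ a, (Polynomial.X - Polynomial.C (K a))

theorem epsR_nat {N : ℕ} {R R' : Type*} [Ring R] [Algebra ℂ R] [Ring R'] [Algebra ℂ R']
    (φ : R →ₐ[ℂ] R') (x : R ⊗[ℂ] Ext N) :
    epsR N R' (Algebra.TensorProduct.map φ (AlgHom.id ℂ (Ext N)) x) = φ (epsR N R x) := by
  induction x using TensorProduct.induction_on with
  | zero => simp
  | tmul r y => simp [epsR_tmul]
  | add x y hx hy => rw [map_add, map_add, map_add, hx, hy, map_add]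

end PolyEv
end GaudinModel
end PartB2

section PartB3
open scoped TensorProduct Polynomial
set_option linter.unusedSectionVars false
namespace GaudinModel

section Distinct
variable {M : Type*} [AddCommGroup M] [Module ℂ M] {N : ℕ} {J : Type*} [Fintype J] [DecidableEq J]

/-- a family version of the system over all base points in a type `G` -/
theorem GlSys.gsysPi {e : J → Fin N → Fin N → Module.End ℂ M} (h : GlSys e)
    {G : Type*} (c : G → J → ℂ) :
    GSys (R := G → Module.End ℂ (ℕ → M)) (fun _ => dF M) (fun j g => rF M (c g j))
      (fun j a b _ => cF M (e j a b)) where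
  Dr j := funext fun g => (h.gsys (c g)).Dr j
  rr j k := funext fun g => (h.gsys (c g)).rr j k
  re j k a b := funext fun g => (h.gsys (c g)).re j k a b
  De k a b := funext fun g => (h.gsys (c g)).De k a b
  gl j a b c' d := funext fun g => by
    have := (h.gsys (c g)).gl j a b c' d
    simp only [Pi.sub_apply, Pi.mul_apply]
    rw [this]
    split_ifs <;> rfl
  ee j k hjk a b c' d := funext fun g => (h.gsys (c g)).ee j k hjk a b c' d

theorem Xm_pi {e : J → Fin N → Fin N → Module.End ℂ M} {G : Type*} (c : G → J → ℂ)
    (K : Fin N → ℂ) (S : Finset J) (a b : Fin N) (g : G) :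
    Xm (R := G → Module.End ℂ (ℕ → M)) (fun _ => dF M) (fun j g => rF M (c g j))
      (fun j a b _ => cF M (e j a b)) K S a b g =
    Xm (dF M) (fun j => rF M (c g j)) (fun j a b => cF M (e j a b)) K S a b := by
  simp only [Xm, Pi.sub_apply, Finset.sum_apply, Pi.mul_apply]
  split_ifs <;> rfl

theorem rdet_pi {e : J → Fin N → Fin N → Module.End ℂ M} {G : Type*} (c : G → J → ℂ)
    (K : Fin N → ℂ) (S : Finset J) (g : G) :
    rdet (Xm (R := G → Module.End ℂ (ℕ → M)) (fun _ => dF M) (fun j g => rF M (c g j))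
      (fun j a b _ => cF M (e j a b)) K S) g =
    rdet (Xm (dF M) (fun j => rF M (c g j)) (fun j a b => cF M (e j a b)) K S) := by
  have := rdet_map (Pi.evalAlgHom ℂ (fun _ : G => Module.End ℂ (ℕ → M)) g)
    (Xm (R := G → Module.End ℂ (ℕ → M)) (fun _ => dF M) (fun j g => rF M (c g j))
      (fun j a b _ => cF M (e j a b)) K S)
  rw [Pi.evalAlgHom_apply] at this
  rw [this]
  congr 1
  funext a b
  exact Xm_pi c K S a b g

/-- polynomial `H_j` -/
def Hj (e : J → Fin N → Fin N → Module.End ℂ M) (K : Fin N → ℂ) (w : J → ℂ) (j : J) :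
    Module.End ℂ M :=
  ∑ a, K a • e j a a +
    ∑ l ∈ Finset.univ.erase j, (w j - w l)⁻¹ • ∑ a, ∑ b, e j a b * e l b a

theorem Ym_eq {e : J → Fin N → Fin N → Module.End ℂ M} (K : Fin N → ℂ) (S : Finset J) (j : J)
    (hb : IsBox (e j)) (c : J → ℂ) (hc : ∀ l ∈ S, c l ≠ 0) :
    Ym (dF M) (fun j => rF M (c j)) (fun j a b => cF M (e j a b)) K S j =
      dF M - cF M (∑ a, K a • e j a a) - ∑ l ∈ S, rF M (c l) * cF M (∑ a, ∑ b, e j a b * e l b a) := by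
  have h1 : ∀ a, ∑ b, cF M (e j a b) * Xm (dF M) (fun j => rF M (c j)) (fun j a b => cF M (e j a b)) K S a b
      = (dF M * cF M (e j a a) - K a • cF M (e j a a)) -
        ∑ l ∈ S, rF M (c l) * cF M (∑ b, e j a b * e l b a) := by
    intro a
    simp only [Xm, mul_sub, Finset.sum_sub_distrib]
    congr 1
    · rw [Finset.sum_eq_single a]
      · rw [if_pos rfl, mul_sub, dc, ← Algebra.commutes, Algebra.smul_def]
      · intro b _ hb; simp [hb.symm]
      · simp
    · simp only [Finset.mul_sum]
      rw [Finset.sum_comm]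
      refine Finset.sum_congr rfl fun l hl => ?_
      rw [map_sum, Finset.mul_sum]
      refine Finset.sum_congr rfl fun b _ => ?_
      rw [← mul_assoc, ← rc (hc l hl), map_mul, mul_assoc]
  rw [Ym]
  simp only [h1, Finset.sum_sub_distrib]
  congr 1
  · congr 1
    · rw [← Finset.mul_sum, ← map_sum, hb.2, map_one, mul_one]
    · simp
  · rw [Finset.sum_comm]
    refine Finset.sum_congr rfl fun l hl => ?_
    rw [← Finset.mul_sum, ← map_sum]

theorem evP_KP (K : Fin N → ℂ) (c : J → ℂ) (e : J → Fin N → Fin N → Module.End ℂ M) :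
    rdet (Xm (dF M) (fun j => rF M (c j)) (fun j a b => cF M (e j a b)) K ∅) =
      Polynomial.aeval (dF M) (KP K) := by
  have : (Xm (dF M) (fun j => rF M (c j)) (fun j a b => cF M (e j a b)) K ∅) =
    fun a b => if a = b then dF M - algebraMap ℂ _ (K a) else 0 := by
    funext a b; simp [Xm]
  rw [this, rdet_diag]
  have : KP K = (List.ofFn fun a => (Polynomial.X - Polynomial.C (K a))).prod := by
    rw [KP, List.prod_ofFn]
  rw [this, map_list_prod, List.map_ofFn]
  congr 2
  funext a
  simp

/-- partial fraction structure for a single site -/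
theorem single_site {e : J → Fin N → Fin N → Module.End ℂ M} (h : GlSys e)
    (hb : ∀ j, IsBox (e j)) (K : Fin N → ℂ) (w : J → ℂ) (hw : Function.Injective w) (j : J) :
    ∃ (P : J → (Module.End ℂ M)[X]) (Q : (Module.End ℂ M)[X]),
      (∀ u : ℂ, (∀ l, u ≠ w l) → Df e K (fun l => u - w l) =
        Polynomial.aeval (dF M) (KP K) + ∑ l ∈ Finset.univ.erase j, rF M (u - w l) * evP M (P l)
          - rF M (u - w j) * evP M Q) ∧
      (Polynomial.X - Polynomial.C (Hj e K w j)) * Q =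
        (KP K).map (algebraMap ℂ _) +
          ∑ l ∈ Finset.univ.erase j, (w j - w l)⁻¹ • P l := by
  classical
  let S : Finset J := Finset.univ.erase j
  have hjS : j ∉ S := by simp [S]
  have hS : insert j S = Finset.univ := by simp [S]
  let G := {u : ℂ // ∀ l ∈ S, u ≠ w l}
  let c : G → J → ℂ := fun g l => g.1 - w l
  have hc : ∀ g : G, ∀ l ∈ S, c g l ≠ 0 := fun g l hl => sub_ne_zero.2 (g.2 l hl)
  let D : (G → Module.End ℂ (ℕ → M)) := fun _ => dF M
  let r : J → (G → Module.End ℂ (ℕ → M)) := fun j g => rF M (c g j)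
  let E : J → Fin N → Fin N → (G → Module.End ℂ (ℕ → M)) := fun j a b _ => cF M (e j a b)
  have hs : GSys D r E := h.gsysPi c
  have hbox : ∀ j, IsBox (E j) := by
    intro j
    refine ⟨fun a b c d => funext fun g => ?_, funext fun g => ?_⟩
    · change cF M (e j a b) * cF M (e j c d) = _
      rw [← map_mul, (hb j).1]
      split_ifs
      · rfl
      · simp only [map_zero]; rfl
    · rw [Finset.sum_apply]
      change ∑ a, cF M (e j a a) = 1
      rw [← map_sum, (hb j).2, map_one]
  let evR : (Module.End ℂ M)[X] →ₐ[ℂ] (G → Module.End ℂ (ℕ → M)) := AlgHom.pi (fun _ => evP M)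
  let Φ := Algebra.TensorProduct.map evR (AlgHom.id ℂ (Ext N))
  have hpf : ∀ j ∈ S, ∀ k ∈ S, j ≠ k → r j * r k = (w j - w k)⁻¹ • (r j - r k) := by
    intro j hj k hk hjk
    funext g
    change rF M _ * rF M _ = (w j - w k)⁻¹ • (rF M _ - rF M _)
    rw [r_pf (hc g j hj) (hc g k hk) (by simpa [c] using fun h => hjk (hw h))]
    simp [c]
  have hη : ∀ j a, ηv (E j) a ∈ Φ.range := by
    intro j a
    refine Subalgebra.sum_mem _ fun b _ => ?_
    refine ⟨Polynomial.C (e j b a) ⊗ₜ ψg b, ?_⟩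
    simp only [Φ, RingHom.coe_coe, AlgHom.toRingHom_eq_coe, Algebra.TensorProduct.map_tmul]
    congr 1
    funext g
    exact evP_C _
  have hD : ∀ a, yv (Xm D r E K ∅) a ∈ Φ.range := by
    intro a
    refine Subalgebra.sum_mem _ fun b _ => ?_
    refine ⟨(if a = b then Polynomial.X - Polynomial.C (algebraMap ℂ _ (K a)) else 0) ⊗ₜ ψg b, ?_⟩
    simp only [Φ, RingHom.coe_coe, AlgHom.toRingHom_eq_coe, Algebra.TensorProduct.map_tmul]
    congr 1
    simp only [Xm, Finset.sum_empty, sub_zero]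
    split_ifs
    · funext g
      change evP M (Polynomial.X - Polynomial.C (algebraMap ℂ _ (K a))) = _
      rw [map_sub, evP_X, evP_C]
      rfl
    · simp
  obtain ⟨b, hb1, hb2⟩ := hs.pf K Φ.range (fun j k => (w j - w k)⁻¹) S hpf hbox hη hD (List.ofFn id)
  obtain ⟨t0, ht0, t, ht, ht2⟩ := hs.pfIns K Φ.range (fun j k => (w j - w k)⁻¹) S hpf hbox hη hD j hjS
    (List.ofFn id)
  choose b' hb' using hb1
  choose t' ht' using ht
  obtain ⟨t0', ht0'⟩ := ht0
  let A : J → (Module.End ℂ M)[X] := fun l => epsR N _ (b' l)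
  let B : J → (Module.End ℂ M)[X] := fun l => epsR N _ (t' l)
  let B0 : (Module.End ℂ M)[X] := epsR N _ t0'
  have eA : ∀ g : G, rdet (Xm (dF M) (fun j => rF M (c g j)) (fun j a b => cF M (e j a b)) K S) =
      Polynomial.aeval (dF M) (KP K) + ∑ l ∈ S, rF M (c g l) * evP M (A l) := by
    intro g
    have h1 := congrArg (fun x => epsR N (G → Module.End ℂ (ℕ → M)) x g) hb2
    simp only [map_add, map_sum, ← rdet_eq_eps', epsR_mul, Pi.add_apply, Finset.sum_apply] at h1
    rw [← rdet_pi]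
    refine h1.trans ?_
    congr 1
    · rw [rdet_pi, evP_KP]
    · refine Finset.sum_congr rfl fun l _ => ?_
      rw [← hb' l]
      have := epsR_nat evR (b' l)
      simp only [RingHom.coe_coe, AlgHom.toRingHom_eq_coe]
      rw [show Φ (b' l) = _ from rfl, this]; rfl
  have eT : ∀ g : G, Tm D r E K S j g = evP M B0 + ∑ l ∈ S, rF M (c g l) * evP M (B l) := by
    intro g
    have h1 := congrArg (fun x => epsR N (G → Module.End ℂ (ℕ → M)) x g) ht2
    simp only [map_add, map_sum, epsR_mul, Pi.add_apply, Finset.sum_apply] at h1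
    rw [Tm, h1]
    congr 1
    · rw [← ht0']
      have := epsR_nat evR t0'
      simp only [RingHom.coe_coe, AlgHom.toRingHom_eq_coe]
      rw [show Φ t0' = _ from rfl, this]; rfl
    · refine Finset.sum_congr rfl fun l _ => ?_
      rw [← ht' l]
      have := epsR_nat evR (t' l)
      simp only [RingHom.coe_coe, AlgHom.toRingHom_eq_coe]
      rw [show Φ (t' l) = _ from rfl, this]; rfl
  have eI : ∀ g : G, Df e K (c g) =
      rdet (Xm (dF M) (fun j => rF M (c g j)) (fun j a b => cF M (e j a b)) K S) -
       rF M (c g j) * Tm D r E K S j g := by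
    intro g
    have h1 := congrFun (hs.rdet_insert K S j hjS (hbox j)) g
    rw [hS, rdet_pi] at h1
    rw [Df, h1, Pi.sub_apply, rdet_pi]; rfl
  have eY : ∀ g : G, Ym (dF M) (fun j => rF M (c g j)) (fun j a b => cF M (e j a b)) K S j *
      Tm D r E K S j g =
      rdet (Xm (dF M) (fun j => rF M (c g j)) (fun j a b => cF M (e j a b)) K S) := by
    intro g
    have h1 := congrFun (hs.Y_T K S j hjS (hbox j)) g
    rw [rdet_pi] at h1
    rw [← h1, Pi.mul_apply]
    congr 1
    simp only [Ym, Finset.sum_apply, Pi.mul_apply, D, r, E, Xm_pi]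
  refine ⟨fun l => A l + (w j - w l)⁻¹ • B l, B0 + ∑ l ∈ S, (w j - w l)⁻¹ • B l, ?_, ?_⟩
  · intro u hu
    have h1 := eI ⟨u, fun l _ => hu l⟩
    rw [eA, eT] at h1
    change Df e K (fun l => u - w l) = _ at h1
    rw [h1]
    simp only [c]
    have h2 : rF M (u - w j) * ∑ l ∈ S, rF M (u - w l) * evP M (B l) =
        ∑ l ∈ S, (w j - w l)⁻¹ • (rF M (u - w j) * evP M (B l) - rF M (u - w l) * evP M (B l)) := by
      rw [Finset.mul_sum]
      refine Finset.sum_congr rfl fun l hl => ?_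
      have hlj : l ≠ j := Finset.ne_of_mem_erase hl
      rw [← mul_assoc, r_pf (sub_ne_zero.2 (hu j)) (sub_ne_zero.2 (hu l))
        (by simpa using fun h => hlj (hw h.symm)), ← sub_mul, smul_mul_assoc]
      congr 2
      ring
    rw [mul_add, h2]
    simp only [map_add, mul_add, Finset.sum_add_distrib, smul_sub, Finset.sum_sub_distrib, map_sum,
      map_smul, mul_smul_comm, Finset.mul_sum, S]
    abel
  · rw [← sub_eq_zero]
    apply evP_inj
    intro f
    let g0 : G := ⟨w j, fun l hl h => (Finset.ne_of_mem_erase hl) (hw h).symm⟩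
    have h1 := eY g0
    rw [eA, eT, Ym_eq K S j (hb j) _ (hc g0)] at h1
    have h2 := congrFun (LinearMap.congr_fun h1 f) 0
    have hdr : ∀ l ∈ S, ∀ F : ℕ → M, dF M (rF M (c g0 l) F) 0 =
        (w j - w l)⁻¹ • (dF M F 0) - (w j - w l)⁻¹ • (w j - w l)⁻¹ • F 0 := by
      intro l hl F
      have := LinearMap.congr_fun (dr (M := M) (hc g0 l hl)) F
      rw [Module.End.mul_apply] at this
      rw [this]
      simp only [LinearMap.sub_apply, Module.End.mul_apply, Pi.sub_apply, rF_zero]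
      rfl
    have hr0 : ∀ l, ∀ F : ℕ → M, rF M (c g0 l) F 0 = (w j - w l)⁻¹ • F 0 := fun _ _ => rfl
    set F : ℕ → M := (evP M B0 + ∑ l ∈ S, rF M (c g0 l) * evP M (B l)) f with hF
    have hF0 : F 0 = evP M B0 f 0 + ∑ l ∈ S, (w j - w l)⁻¹ • evP M (B l) f 0 := by
      simp only [hF, LinearMap.add_apply, Pi.add_apply, LinearMap.sum_apply, Finset.sum_apply,
        Module.End.mul_apply, hr0]
    have hF1 : dF M F 0 = dF M (evP M B0 f) 0 + ∑ l ∈ S, dF M (rF M (c g0 l) (evP M (B l) f)) 0 := by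
      simp only [hF, LinearMap.add_apply, Pi.add_apply, LinearMap.sum_apply, Finset.sum_apply,
        Module.End.mul_apply, map_add, map_sum]
    have h2' : dF M F 0 - Hj e K w j (F 0) = Polynomial.aeval (dF M) (KP K) f 0 +
        ∑ l ∈ S, (w j - w l)⁻¹ • evP M (A l) f 0 := by
      have h4 : Hj e K w j (F 0) = (∑ a, K a • e j a a) (F 0) +
         ∑ l ∈ S, (w j - w l)⁻¹ • (∑ a, ∑ b, e j a b * e l b a) (F 0) := by
        simp only [Hj, LinearMap.add_apply, LinearMap.sum_apply, LinearMap.smul_apply, S]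
      rw [h4]
      rw [Module.End.mul_apply, ← hF] at h2
      simp only [LinearMap.sub_apply, LinearMap.add_apply, Pi.sub_apply, LinearMap.sum_apply,
        Pi.add_apply, Module.End.mul_apply, Finset.sum_apply, hr0] at h2
      simp only [cF_apply, LinearMap.sum_apply] at h2 ⊢
      rw [← h2]
      abel
    have h3 : ∑ l ∈ S, dF M (rF M (c g0 l) (evP M (B l) f)) 0 =
       ∑ l ∈ S, ((w j - w l)⁻¹ • (dF M (evP M (B l) f) 0) - (w j - w l)⁻¹ • (w j - w l)⁻¹ • (evP M (B l) f) 0) :=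
      Finset.sum_congr rfl fun l hl => hdr l hl _
    have h5 : evP M ((KP K).map (algebraMap ℂ _)) = Polynomial.aeval (dF M) (KP K) := by
      rw [Polynomial.aeval_def]
      refine (Polynomial.eval₂_map _ _ _).trans ?_
      congr 1
    rw [hF1, h3, hF0] at h2'
    simp only [map_sub, map_mul, map_add, map_sum, map_smul, evP_X, evP_C, h5,
      LinearMap.sub_apply, LinearMap.add_apply, Pi.sub_apply, LinearMap.sum_apply,
        Pi.add_apply, Module.End.mul_apply, Finset.sum_apply, LinearMap.smul_apply, cF_apply,
        Pi.smul_apply, smul_add, smul_sub, Finset.sum_add_distrib, Finset.sum_sub_distrib] at h2' ⊢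
    rw [← sub_eq_zero] at h2'
    simp only [S] at h2' ⊢
    rw [← h2']
    abel

end Distinct
end GaudinModel
end PartB3

section PartB4
open scoped TensorProduct Polynomial
set_option linter.unusedSectionVars false
namespace GaudinModel

section Uniq
variable {M : Type*} [AddCommGroup M] [Module ℂ M] {N : ℕ} {J : Type*} [Fintype J] [DecidableEq J]

theorem pf_uniq (w : J → ℂ) (hw : Function.Injective w) (x : J → M)
    (h : ∀ u : ℂ, (∀ l, u ≠ w l) → ∑ l, (u - w l)⁻¹ • x l = 0) : x = 0 := by
  funext j
  rw [Pi.zero_apply, ← Module.forall_dual_apply_eq_zero_iff ℂ]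
  intro φ
  let p : ℂ[X] := ∑ l, Polynomial.C (φ (x l)) *
    ∏ m ∈ Finset.univ.erase l, (Polynomial.X - Polynomial.C (w m))
  have hp : p = 0 := by
    apply Polynomial.eq_zero_of_infinite_isRoot
    refine (Set.finite_range w).infinite_compl.mono ?_
    intro u hu
    have hu' : ∀ l, u ≠ w l := fun l hl => hu ⟨l, hl.symm⟩
    have h1 := congrArg φ (h u hu')
    simp only [map_sum, map_smul, map_zero, smul_eq_mul] at h1
    have h2 := congrArg (fun t => (∏ m, (u - w m)) * t) h1
    simp only [mul_zero, Finset.mul_sum] at h2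
    change Polynomial.eval u p = 0
    rw [← h2]
    simp only [p, Polynomial.eval_finsetSum, Polynomial.eval_mul, Polynomial.eval_C,
      Polynomial.eval_prod, Polynomial.eval_sub, Polynomial.eval_X]
    refine Finset.sum_congr rfl fun l _ => ?_
    rw [← Finset.mul_prod_erase _ _ (Finset.mem_univ l)]
    have := sub_ne_zero.2 (hu' l)
    field_simp
  have h3 : Polynomial.eval (w j) p = 0 := by rw [hp]; simp
  simp only [p, Polynomial.eval_finsetSum, Polynomial.eval_mul, Polynomial.eval_C,
      Polynomial.eval_prod, Polynomial.eval_sub, Polynomial.eval_X] at h3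
  rw [Finset.sum_eq_single j] at h3
  · rcases mul_eq_zero.1 h3 with h4 | h4
    · exact h4
    · exfalso
      rw [Finset.prod_eq_zero_iff] at h4
      obtain ⟨m, hm, hm2⟩ := h4
      exact Finset.ne_of_mem_erase hm (hw (sub_eq_zero.1 hm2)).symm
  · intro l _ hl
    rw [Finset.prod_eq_zero (i := j) (by simp [hl.symm]) (sub_self _), mul_zero]
  · simp

theorem pf_uniq_op (w : J → ℂ) (hw : Function.Injective w) (A : J → (Module.End ℂ M)[X])
    (h : ∀ u : ℂ, (∀ l, u ≠ w l) → ∑ l, rF M (u - w l) * evP M (A l) = 0) : A = 0 := by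
  funext j
  apply evP_inj
  intro f
  have := pf_uniq w hw (fun l => evP M (A l) f 0) (fun u hu => by
    have := congrFun (LinearMap.congr_fun (h u hu) f) 0
    simp only [LinearMap.sum_apply, Finset.sum_apply, Module.End.mul_apply, rF_zero] at this
    exact this)
  exact congrFun this j

theorem end_mul_neg (a b : Module.End ℂ (ℕ → M)) : a * -b = -(a * b) := by
  ext1 f; exact map_neg a _

/-- existence of all `Q_j` -/
theorem all_sites [Nonempty J] {e : J → Fin N → Fin N → Module.End ℂ M} (h : GlSys e)
    (hb : ∀ j, IsBox (e j)) (K : Fin N → ℂ) (w : J → ℂ) (hw : Function.Injective w) :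
    ∃ Q : J → (Module.End ℂ M)[X],
      (∀ u : ℂ, (∀ l, u ≠ w l) → Df e K (fun l => u - w l) =
        Polynomial.aeval (dF M) (KP K) - ∑ l, rF M (u - w l) * evP M (Q l)) ∧
      ∀ j, (Polynomial.X - Polynomial.C (Hj e K w j)) * Q j =
        (KP K).map (algebraMap ℂ _) -
          ∑ l ∈ Finset.univ.erase j, (w j - w l)⁻¹ • Q l := by
  choose P Q h1 h2 using single_site h hb K w hw
  have h3 : ∀ j, ∀ u : ℂ, (∀ l, u ≠ w l) → Df e K (fun l => u - w l) =
        Polynomial.aeval (dF M) (KP K) +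
        ∑ l, rF M (u - w l) * evP M (if l = j then - Q j else P j l) := by
    intro j u hu
    have h6 : ∑ l ∈ Finset.univ.erase j, rF M (u - w l) * evP M (if l = j then - Q j else P j l) =
        ∑ l ∈ Finset.univ.erase j, rF M (u - w l) * evP M (P j l) :=
      Finset.sum_congr rfl fun l hl => by rw [if_neg (Finset.ne_of_mem_erase hl)]
    rw [h1 j u hu, ← Finset.add_sum_erase _ _ (Finset.mem_univ j), if_pos rfl, map_neg, end_mul_neg, h6]
    abel
  have h4 : ∀ j l, l ≠ j → P j l = - Q l := by
    intro j l hl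
    have := pf_uniq_op w hw (fun m => (if m = j then - Q j else P j m) - (if m = l then - Q l else P l m))
      (fun u hu => by
        have e1 := h3 j u hu
        rw [h3 l u hu] at e1
        have e2 := add_left_cancel e1
        simp only [map_sub, mul_sub, Finset.sum_sub_distrib]
        rw [e2, sub_self])
    have := congrFun this l
    simp only [if_neg hl, if_pos rfl, Pi.zero_apply] at this
    exact sub_eq_zero.1 this
  have h5 : ∀ j l, (if l = j then - Q j else P j l) = - Q l := by
    intro j l
    split_ifs with hh
    · rw [hh]
    · exact h4 j l hh
  refine ⟨Q, ?_, ?_⟩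
  · intro u hu
    obtain ⟨j⟩ := ‹Nonempty J›
    rw [h3 j u hu]
    simp only [h5, map_neg, end_mul_neg, Finset.sum_neg_distrib]
    abel
  · intro j
    rw [h2 j, sub_eq_add_neg, ← Finset.sum_neg_distrib]
    congr 1
    refine Finset.sum_congr rfl fun l hl => ?_
    rw [h4 j l (Finset.ne_of_mem_erase hl), smul_neg]

theorem aeval_dF_pi (p : ℂ[X]) (k : ℕ → J → M) (s : ℕ) (j : J) :
    Polynomial.aeval (dF (J → M)) p k s j = Polynomial.aeval (dF M) p (fun t => k t j) s := by
  let ev : (ℕ → J → M) →ₗ[ℂ] (ℕ → M) :=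
    { toFun := fun k t => k t j, map_add' := fun _ _ => rfl, map_smul' := fun _ _ => rfl }
  have h : ∀ q : ℂ[X], ∀ k, ev (Polynomial.aeval (dF (J → M)) q k) = Polynomial.aeval (dF M) q (ev k) := by
    intro q
    induction q using Polynomial.induction_on' with
    | add p q hp hq => intro k; simp only [map_add, LinearMap.add_apply, hp, hq]
    | monomial n a =>
      intro k
      simp only [Polynomial.aeval_monomial, Module.End.mul_apply, Module.algebraMap_end_apply, map_smul]
      congr 1
      induction n generalizing k with
      | zero => simp
      | succ n ih => rw [pow_succ, Module.End.mul_apply, ih, pow_succ, Module.End.mul_apply]; rfl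
  exact congrFun (h p k) s

theorem aeval_dF_cF (L : Module.End ℂ M) (k : ℕ → M) (hk : dF M k = cF M L k) (p : ℂ[X]) :
    Polynomial.aeval (dF M) p k = cF M (Polynomial.aeval L p) k := by
  induction p using Polynomial.induction_on' with
  | add p q hp hq => simp only [map_add, LinearMap.add_apply, hp, hq]
  | monomial n a =>
    simp only [Polynomial.aeval_monomial, map_mul, Module.End.mul_apply, Module.algebraMap_end_apply,
      AlgHom.commutes]
    congr 1
    induction n with
    | zero => simp
    | succ n ih =>
      rw [pow_succ', Module.End.mul_apply, ih, ← Module.End.mul_apply, dc, Module.End.mul_apply, hk,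
        ← Module.End.mul_apply, ← map_mul, pow_succ]

/-- the case of distinct points -/
theorem distinct_case [FiniteDimensional ℂ M] [Nonempty J]
    {e : J → Fin N → Fin N → Module.End ℂ M} (h : GlSys e)
    (hb : ∀ j, IsBox (e j)) (K : Fin N → ℂ) (c : J → ℂ) (hc : ∀ j, c j ≠ 0)
    (hw : Function.Injective c) (f : ℕ → M) (hf : Df e K c f = 0) :
    ∃ C : ℂ[X], C.Monic ∧ C.natDegree = Fintype.card J * Module.finrank ℂ M + N ∧
      Polynomial.aeval (dF M) C f = 0 := by
  let w : J → ℂ := fun j => - c j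
  have hw' : Function.Injective w := fun a b hab => hw (neg_injective hab)
  obtain ⟨Q, h1, h2⟩ := all_sites h hb K w hw'
  have hu : ∀ l, (0:ℂ) ≠ w l := fun l => by simpa [w, eq_comm] using hc l
  have h3 := h1 0 hu
  have hcw : ∀ l, 0 - w l = c l := fun l => by simp [w]
  simp only [hcw] at h3
  let kk : J → ℕ → M := fun j => rF M (c j) (evP M (Q j) f)
  have hKP : Polynomial.aeval (dF M) (KP K) f = ∑ l, kk l := by
    rw [h3] at hf
    simp only [LinearMap.sub_apply, LinearMap.sum_apply, Module.End.mul_apply] at hf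
    exact sub_eq_zero.1 hf
  let L : Module.End ℂ (J → M) :=
    { toFun := fun x j => Hj e K w j (x j) - ∑ l ∈ Finset.univ.erase j, (w j - w l)⁻¹ • x l
      map_add' := fun x y => by
        funext j; simp only [Pi.add_apply, map_add, smul_add, Finset.sum_add_distrib]; abel
      map_smul' := fun t x => by
        funext j
        simp only [Pi.smul_apply, map_smul, RingHom.id_apply, smul_sub, Finset.smul_sum]
        congr 1
        exact Finset.sum_congr rfl fun l _ => smul_comm _ _ _ }
  have hk : ∀ j, dF M (kk j) = cF M (Hj e K w j) (kk j) -
      ∑ l ∈ Finset.univ.erase j, (w j - w l)⁻¹ • kk l := by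
    intro j
    have e1 := LinearMap.congr_fun (congrArg (evP M) (h2 j)) f
    have h5 : evP M ((KP K).map (algebraMap ℂ _)) = Polynomial.aeval (dF M) (KP K) := by
      rw [Polynomial.aeval_def]
      refine (Polynomial.eval₂_map _ _ _).trans ?_
      congr 1
    simp only [map_mul, map_sub, evP_X, evP_C, h5, map_sum, map_smul, LinearMap.sub_apply,
      Module.End.mul_apply, LinearMap.sum_apply, LinearMap.smul_apply] at e1
    rw [hKP, sub_eq_iff_eq_add] at e1
    have e2 : dF M (kk j) = rF M (c j) (dF M (evP M (Q j) f)) - rF M (c j) (kk j) :=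
      LinearMap.congr_fun (dr (M := M) (hc j)) (evP M (Q j) f)
    have e3 : rF M (c j) (cF M (Hj e K w j) (evP M (Q j) f)) = cF M (Hj e K w j) (kk j) :=
      LinearMap.congr_fun (rc (M := M) (hc j) (Hj e K w j)) (evP M (Q j) f)
    have e4 : ∀ l ∈ Finset.univ.erase j, rF M (c j) (kk l) =
      (w j - w l)⁻¹ • (rF M (c j) (evP M (Q l) f) - kk l) := by
      intro l hl
      have := LinearMap.congr_fun (r_pf (M := M) (hc j) (hc l)
        (fun h => Finset.ne_of_mem_erase hl (hw h).symm)) (evP M (Q l) f)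
      have h6 : w j - w l = c l - c j := by simp only [w]; ring
      rw [h6]; exact this
    rw [e2, e1, map_add, map_sub, map_sum, map_sum, e3, ← Finset.add_sum_erase _ _ (Finset.mem_univ j),
      Finset.sum_congr rfl e4]
    simp only [smul_sub, Finset.sum_sub_distrib, map_smul]
    abel
  let k : ℕ → J → M := fun s j => kk j s
  have hk2 : dF (J → M) k = cF (J → M) L k := by
    funext s j
    have := congrFun (hk j) s
    simp only [Pi.sub_apply, Finset.sum_apply, Pi.smul_apply] at this
    exact this
  have hk3 : ∀ j, Polynomial.aeval (dF M) L.charpoly (kk j) = 0 := by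
    intro j
    have := aeval_dF_cF L k hk2 L.charpoly
    rw [LinearMap.aeval_self_charpoly, map_zero] at this
    funext s
    rw [← aeval_dF_pi L.charpoly k s j, this]; rfl
  have hKm : (KP K).Monic := Polynomial.monic_prod_of_monic _ _ fun a _ => Polynomial.monic_X_sub_C _
  refine ⟨L.charpoly * KP K, L.charpoly_monic.mul hKm, ?_, ?_⟩
  · rw [Polynomial.Monic.natDegree_mul L.charpoly_monic hKm, LinearMap.charpoly_natDegree]
    congr 1
    · rw [Module.finrank_pi_fintype]; simp
    · rw [KP, Polynomial.natDegree_prod_of_monic _ _ fun a _ => Polynomial.monic_X_sub_C _]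
      simp
  · rw [map_mul, Module.End.mul_apply, hKP, map_sum]
    exact Finset.sum_eq_zero fun j _ => hk3 j

end Uniq
end GaudinModel
end PartB4

section PartB5
open scoped TensorProduct Polynomial Topology
open Filter
set_option linter.all false
namespace GaudinModel

section Ode
variable {M : Type*} [AddCommGroup M] [Module ℂ M] {N : ℕ} {J : Type*} [Fintype J] [DecidableEq J]

/-- strictly lower order than `k` -/
def SLow (k : ℕ) (A : Module.End ℂ (ℕ → M)) : Prop :=
  ∀ f s, (∀ t < s + k, f t = 0) → A f s = 0

theorem dF_pow_apply (k : ℕ) (f : ℕ → M) (s : ℕ) :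
    ((dF M) ^ k) f s = ((s + 1).ascFactorial k : ℂ) • f (s + k) := by
  induction k generalizing s with
  | zero => simp
  | succ k ih =>
    rw [pow_succ', Module.End.mul_apply, dF_apply, ih, smul_smul]
    congr 1
    · have := Nat.succ_ascFactorial (s+1) k
      rw [Nat.ascFactorial_succ]
      have h2 : (((s+1) * (s+1+1).ascFactorial k : ℕ) : ℂ) = (((s+1+k) * (s+1).ascFactorial k : ℕ) : ℂ) := by
        exact_mod_cast this
      push_cast at h2 ⊢
      linear_combination h2
    · congr 1; omega

theorem SLow.add {k : ℕ} {A B : Module.End ℂ (ℕ → M)} (hA : SLow k A) (hB : SLow k B) :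
    SLow k (A + B) := fun f s h => by
  rw [LinearMap.add_apply, Pi.add_apply, hA f s h, hB f s h, add_zero]

theorem SLow.smul {k : ℕ} {A : Module.End ℂ (ℕ → M)} (hA : SLow k A) (x : ℂ) :
    SLow k (x • A) := fun f s h => by
  rw [LinearMap.smul_apply, Pi.smul_apply, hA f s h, smul_zero]

theorem SLow.zero {k : ℕ} : SLow k (0 : Module.End ℂ (ℕ → M)) := fun f s _ => rfl

theorem SLow.sum {k : ℕ} {ι : Type*} (T : Finset ι) {A : ι → Module.End ℂ (ℕ → M)}
    (hA : ∀ i ∈ T, SLow k (A i)) : SLow k (∑ i ∈ T, A i) := fun f s h => by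
  rw [LinearMap.sum_apply, Finset.sum_apply]
  exact Finset.sum_eq_zero fun i hi => hA i hi f s h

/-- weakly bounded order: `A f s` depends on `f t`, `t ≤ s + k` -/
def WLow (k : ℕ) (A : Module.End ℂ (ℕ → M)) : Prop :=
  ∀ f s, (∀ t ≤ s + k, f t = 0) → A f s = 0

theorem SLow.wl {k : ℕ} {A B : Module.End ℂ (ℕ → M)} (hA : WLow k A) (hB : SLow 1 B) :
    SLow (k + 1) (A * B) := fun f s h =>
  hA _ _ fun t ht => hB _ _ fun t' ht' => h _ (by omega)

theorem SLow.lw {k : ℕ} {A B : Module.End ℂ (ℕ → M)} (hA : SLow k A) (hB : WLow 1 B) :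
    SLow (k + 1) (A * B) := fun f s h =>
  hA _ _ fun t ht => hB _ _ fun t' ht' => h _ (by omega)

theorem WLow.dpow (k : ℕ) : WLow k (dF M ^ k) := fun f s h => by
  rw [dF_pow_apply, h _ le_rfl, smul_zero]

theorem SLow.toW {k : ℕ} {A : Module.End ℂ (ℕ → M)} (hA : SLow k A) : WLow k A :=
  fun f s h => hA f s fun t ht => h t ht.le

/-- leading term `ε ∂^k` -/
def LeadD (k : ℕ) (ε : ℂ) (A : Module.End ℂ (ℕ → M)) : Prop := SLow k (A - ε • dF M ^ k)

theorem LeadD.mul {k : ℕ} {ε ε' : ℂ} {A B : Module.End ℂ (ℕ → M)} (hA : LeadD k ε A)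
    (hB : LeadD 1 ε' B) : LeadD (k + 1) (ε * ε') (A * B) := by
  have e : A * B - (ε * ε') • dF M ^ (k + 1) =
    ε • (dF M ^ k * (B - ε' • dF M ^ 1)) + (A - ε • dF M ^ k) * B := by
    rw [pow_one, mul_sub, sub_mul, smul_sub, pow_succ, mul_smul_comm, smul_smul, smul_mul_assoc]
    abel
  rw [LeadD, e]
  refine ((SLow.wl (WLow.dpow k) hB).smul _).add (SLow.lw hA ?_)
  have : B = (B - ε' • dF M ^ 1) + ε' • dF M ^ 1 := by abel
  rw [this]
  intro f s h
  rw [LinearMap.add_apply, Pi.add_apply, SLow.toW hB f s h, LinearMap.smul_apply, Pi.smul_apply,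
    WLow.dpow 1 f s h, smul_zero, add_zero]

theorem LeadD.add {k : ℕ} {ε ε' : ℂ} {A B : Module.End ℂ (ℕ → M)} (hA : LeadD k ε A)
    (hB : LeadD k ε' B) : LeadD k (ε + ε') (A + B) := by
  have e : A + B - (ε + ε') • dF M ^ k = (A - ε • dF M ^ k) + (B - ε' • dF M ^ k) := by
    rw [add_smul]; abel
  rw [LeadD, e]; exact SLow.add hA hB

theorem LeadD.smul {k : ℕ} {ε : ℂ} {A : Module.End ℂ (ℕ → M)} (hA : LeadD k ε A) (x : ℂ) :
    LeadD k (x * ε) (x • A) := by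
  have e : x • A - (x * ε) • dF M ^ k = x • (A - ε • dF M ^ k) := by rw [smul_sub, smul_smul]
  rw [LeadD, e]; exact SLow.smul hA x

theorem LeadD.sum {k : ℕ} {ι : Type*} (T : Finset ι) {ε : ι → ℂ} {A : ι → Module.End ℂ (ℕ → M)}
    (hA : ∀ i, LeadD k (ε i) (A i)) : LeadD k (∑ i ∈ T, ε i) (∑ i ∈ T, A i) := by
  rw [LeadD, Finset.sum_smul, ← Finset.sum_sub_distrib]
  exact SLow.sum T fun i _ => hA i

theorem LeadD.one : LeadD 0 1 (1 : Module.End ℂ (ℕ → M)) := by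
  rw [LeadD]; simp [SLow.zero]

theorem LeadD.prod {k : ℕ} {ε : Fin k → ℂ} {A : Fin k → Module.End ℂ (ℕ → M)}
    (hA : ∀ i, LeadD 1 (ε i) (A i)) : LeadD k (∏ i, ε i) (List.ofFn A).prod := by
  induction k with
  | zero => simpa using LeadD.one
  | succ k ih =>
    rw [List.ofFn_succ_last, List.prod_append, Fin.prod_univ_castSucc]
    simpa using (ih fun i => hA i.castSucc).mul (hA (Fin.last k))

theorem rF_W (a : ℂ) : WLow 0 (rF M a) := by
  intro f s h
  induction s with
  | zero => rw [rF_zero, h 0 (by omega), smul_zero]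
  | succ s ih => rw [rF_succ, h _ (by omega), ih fun t ht => h t (by omega)]; simp

theorem LeadD_rdet (X : Fin N → Fin N → Module.End ℂ (ℕ → M))
    (hX : ∀ a b, LeadD 1 (if a = b then 1 else 0) (X a b)) : LeadD N 1 (rdet X) := by
  have : (1 : ℂ) = ∑ σ : Equiv.Perm (Fin N), ((Equiv.Perm.sign σ : ℤˣ) : ℂ) *
      ∏ a, (if a = σ a then (1:ℂ) else 0) := by
    have := Matrix.det_one (n := Fin N) (R := ℂ)
    rw [← Matrix.det_transpose, Matrix.det_apply'] at this
    refine this.symm.trans ?_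
    simp [Matrix.one_apply]
  rw [LeadD, this, rdet]
  change LeadD _ _ _
  have e : ∀ σ : Equiv.Perm (Fin N), LeadD N (((Equiv.Perm.sign σ : ℤˣ) : ℂ) *
      ∏ a, (if a = σ a then (1:ℂ) else 0))
      (((Equiv.Perm.sign σ : ℤˣ) : ℤ) • (List.ofFn fun a => X a (σ a)).prod) := by
    intro σ
    have := (LeadD.prod (fun a => hX a (σ a))).smul ((Equiv.Perm.sign σ : ℤˣ) : ℂ)
    have e2 : (((Equiv.Perm.sign σ : ℤˣ) : ℤ) : ℂ) • (List.ofFn fun a => X a (σ a)).prod =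
      ((Equiv.Perm.sign σ : ℤˣ) : ℤ) • (List.ofFn fun a => X a (σ a)).prod := by
      ext1 f
      exact Int.cast_smul_eq_zsmul ℂ _ _
    rw [← e2]; exact this
  exact LeadD.sum _ e

theorem Df_lead (e : J → Fin N → Fin N → Module.End ℂ M) (K : Fin N → ℂ) (c : J → ℂ) :
    LeadD N 1 (Df e K c) := by
  apply LeadD_rdet
  intro a b
  have h1 : ∀ k : ℂ, SLow 1 (algebraMap ℂ (Module.End ℂ (ℕ → M)) k) := by
    intro k f s h
    rw [Module.algebraMap_end_apply, Pi.smul_apply, h s (by omega), smul_zero]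
  have h2 : SLow 1 (∑ j, rF M (c j) * cF M (e j b a)) := by
    refine SLow.sum _ fun j _ => ?_
    intro f s h
    rw [Module.End.mul_apply]
    apply rF_W
    intro t ht
    rw [cF_apply, h t (by omega), map_zero]
  intro f s h
  have h3 := h1 (K a) f s h
  have h4 := h2 f s h
  simp only [Xm, LinearMap.sub_apply, Pi.sub_apply, h4, sub_zero]
  split_ifs
  · rw [LinearMap.sub_apply, Pi.sub_apply, h3, one_smul, pow_one, sub_zero, sub_self]
  · rw [zero_smul]; simp

/-- truncation -/
def trunc (n : ℕ) (f : ℕ → M) : ℕ → M := fun t => if t < n then f t else 0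

theorem lead_eq {A : Module.End ℂ (ℕ → M)} (hA : LeadD N 1 A) (f : ℕ → M) (s : ℕ) :
    A f s = ((s + 1).ascFactorial N : ℂ) • f (s + N) + (A - dF M ^ N) (trunc (s + N) f) s := by
  have h1 : (A - dF M ^ N) (f - trunc (s + N) f) s = 0 := by
    rw [LeadD, one_smul] at hA
    apply hA
    intro t ht
    simp [trunc, ht]
  rw [map_sub, Pi.sub_apply, sub_eq_zero] at h1
  rw [← h1, LinearMap.sub_apply, Pi.sub_apply, dF_pow_apply]
  abel

theorem asc_ne (s : ℕ) : ((s + 1).ascFactorial N : ℂ) ≠ 0 := by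
  exact_mod_cast (Nat.ascFactorial_pos _ _).ne'

theorem sol_iff {A : Module.End ℂ (ℕ → M)} (hA : LeadD N 1 A) (f : ℕ → M) :
    A f = 0 ↔ ∀ s, f (s + N) = -(((s + 1).ascFactorial N : ℂ)⁻¹ • (A - dF M ^ N) (trunc (s + N) f) s) := by
  constructor
  · intro h s
    have h1 := lead_eq hA f s
    rw [h, Pi.zero_apply] at h1
    rw [← smul_neg, eq_inv_smul_iff₀ (asc_ne s)]
    exact eq_neg_of_add_eq_zero_left h1.symm
  · intro h
    funext s
    rw [lead_eq hA, h s, smul_neg, smul_smul, mul_inv_cancel₀ (asc_ne s), one_smul]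
    simp

/-- the solution with given jets -/
def solF (A : Module.End ℂ (ℕ → M)) (N : ℕ) (x : ℕ → M) (n : ℕ) : M :=
  if n < N then x n else
    -(((n - N + 1).ascFactorial N : ℂ)⁻¹ • (A - dF M ^ N)
      (fun t => if h : t < n then solF A N x t else 0) (n - N))
termination_by n

theorem solF_lt (A : Module.End ℂ (ℕ → M)) (x : ℕ → M) (n : ℕ) (hn : n < N) : solF A N x n = x n := by
  rw [solF, if_pos hn]

theorem solF_sol {A : Module.End ℂ (ℕ → M)} (hA : LeadD N 1 A) (x : ℕ → M) : A (solF A N x) = 0 := by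
  rw [sol_iff hA]
  intro s
  rw [solF, if_neg (by omega), Nat.add_sub_cancel]
  rfl

theorem sol_unique {A : Module.End ℂ (ℕ → M)} (hA : LeadD N 1 A) (f g : ℕ → M)
    (hf : A f = 0) (hg : A g = 0) (h : ∀ t < N, f t = g t) : f = g := by
  rw [sol_iff hA] at hf hg
  funext n
  induction n using Nat.strong_induction_on with
  | _ n ih =>
    by_cases hn : n < N
    · exact h n hn
    · obtain ⟨s, rfl⟩ : ∃ s, n = s + N := ⟨n - N, by omega⟩
      rw [hf, hg]
      have : trunc (s + N) f = trunc (s + N) g := ?_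
      · rw [this]
      funext t
      simp only [trunc]
      split_ifs with ht
      · exact ih t ht
      · rfl

end Ode

section Conv
variable {M : Type*} [NormedAddCommGroup M] [NormedSpace ℂ M] {N : ℕ} {J : Type*} [Fintype J]
  [DecidableEq J] {T : Type*}

/-- continuous convergence of operators -/
def PC (l : Filter T) (A : T → Module.End ℂ (ℕ → M)) (A0 : Module.End ℂ (ℕ → M)) : Prop :=
  ∀ f : T → ℕ → M, ∀ f0, Tendsto f l (𝓝 f0) → Tendsto (fun t => A t (f t)) l (𝓝 (A0 f0))

variable {l : Filter T}

theorem PC.mul {A B : T → Module.End ℂ (ℕ → M)} {A0 B0} (hA : PC l A A0) (hB : PC l B B0) :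
    PC l (fun t => A t * B t) (A0 * B0) := fun f f0 hf => hA _ _ (hB _ _ hf)

theorem PC.sub {A B : T → Module.End ℂ (ℕ → M)} {A0 B0} (hA : PC l A A0) (hB : PC l B B0) :
    PC l (fun t => A t - B t) (A0 - B0) := fun f f0 hf => (hA _ _ hf).sub (hB _ _ hf)

theorem PC.zsmul {A : T → Module.End ℂ (ℕ → M)} {A0} (hA : PC l A A0) (x : ℤ) :
    PC l (fun t => x • A t) (x • A0) := fun f f0 hf => (hA _ _ hf).const_smul x

theorem PC.sum {ι : Type*} (S : Finset ι) {A : ι → T → Module.End ℂ (ℕ → M)} {A0 : ι → Module.End ℂ (ℕ → M)}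
    (hA : ∀ i, PC l (A i) (A0 i)) : PC l (fun t => ∑ i ∈ S, A i t) (∑ i ∈ S, A0 i) := by
  intro f f0 hf
  simp only [LinearMap.sum_apply]
  exact tendsto_finsetSum _ fun i _ => hA i _ _ hf

theorem PC.prod {k : ℕ} {A : Fin k → T → Module.End ℂ (ℕ → M)} {A0 : Fin k → Module.End ℂ (ℕ → M)}
    (hA : ∀ i, PC l (A i) (A0 i)) : PC l (fun t => (List.ofFn fun i => A i t).prod) (List.ofFn A0).prod := by
  induction k with
  | zero => intro f f0 hf; simpa using hf
  | succ k ih =>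
    simp only [List.ofFn_succ, List.prod_cons]
    exact (hA 0).mul (ih fun i => hA i.succ)

theorem PC.dF : PC l (fun _ : T => dF M) (dF M) := by
  intro f f0 hf
  rw [tendsto_pi_nhds] at hf ⊢
  intro s
  exact (hf (s+1)).const_smul _

theorem PC.scal (x : ℂ) : PC l (fun _ : T => algebraMap ℂ (Module.End ℂ (ℕ → M)) x) (algebraMap ℂ _ x) := by
  intro f f0 hf
  exact hf.const_smul x

theorem PC.cF [FiniteDimensional ℂ M] (x : Module.End ℂ M) : PC l (fun _ : T => cF M x) (cF M x) := by
  intro f f0 hf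
  rw [tendsto_pi_nhds] at hf ⊢
  intro s
  exact (x.continuous_of_finiteDimensional.tendsto _).comp (hf s)

theorem PC.rF {c : T → ℂ} {c0 : ℂ} (hc : Tendsto c l (𝓝 c0)) (h0 : c0 ≠ 0) :
    PC l (fun t => rF M (c t)) (rF M c0) := by
  intro f f0 hf
  rw [tendsto_pi_nhds] at hf ⊢
  intro s
  induction s with
  | zero => exact (hc.inv₀ h0).smul (hf 0)
  | succ s ih => exact (hc.inv₀ h0).smul ((hf (s+1)).sub ih)

theorem Df_PC [FiniteDimensional ℂ M] (e : J → Fin N → Fin N → Module.End ℂ M) (K : Fin N → ℂ)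
    {c : T → J → ℂ} {c0 : J → ℂ} (hc : Tendsto c l (𝓝 c0)) (h0 : ∀ j, c0 j ≠ 0) :
    PC l (fun t => Df e K (c t)) (Df e K c0) := by
  rw [tendsto_pi_nhds] at hc
  refine PC.sum _ fun σ => PC.zsmul (PC.prod fun a => ?_) _
  refine PC.sub ?_ (PC.sum _ fun j => (PC.rF (hc j) (h0 j)).mul (PC.cF _))
  split_ifs
  · exact PC.dF.sub (PC.scal _)
  · exact fun f f0 hf => tendsto_const_nhds

theorem solF_tendsto {A : T → Module.End ℂ (ℕ → M)} {A0} (hA : PC l A A0) (x : ℕ → M) :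
    Tendsto (fun t => solF (A t) N x) l (𝓝 (solF A0 N x)) := by
  rw [tendsto_pi_nhds]
  intro n
  have hpow : ∀ k, PC l (fun _ : T => GaudinModel.dF M ^ k) (GaudinModel.dF M ^ k) := by
    intro k
    induction k with
    | zero => intro f f0 hf; simpa using hf
    | succ k ih => simp only [pow_succ]; exact ih.mul PC.dF
  induction n using Nat.strong_induction_on with
  | _ n ih =>
    by_cases hn : n < N
    · simp only [solF_lt _ _ _ hn]; exact tendsto_const_nhds
    · unfold solF
      simp only [if_neg hn]
      refine Tendsto.neg (Tendsto.const_smul ?_ _)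
      refine (tendsto_pi_nhds.1 ((hA.sub (hpow N)) _ _ ?_)) (n - N)
      rw [tendsto_pi_nhds]
      intro t
      split_ifs with ht
      · exact ih t ht
      · exact tendsto_const_nhds

end Conv
end GaudinModel
end PartB5

section PartB6
open scoped TensorProduct Polynomial Topology
open Filter
set_option linter.all false
namespace GaudinModel

/-- every formal solution is killed by a nonzero constant coefficient operator -/
def TT {M : Type*} [AddCommGroup M] [Module ℂ M] {N : ℕ} {J : Type*} [Fintype J]
    (e : J → Fin N → Fin N → Module.End ℂ M) (K : Fin N → ℂ) (c : J → ℂ) : Prop :=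
  ∀ f, Df e K c f = 0 → ∃ C : ℂ[X], C ≠ 0 ∧ Polynomial.aeval (dF M) C f = 0

section Perturb
variable {M : Type*} [NormedAddCommGroup M] [NormedSpace ℂ M] [FiniteDimensional ℂ M]
  {N : ℕ} {J : Type*} [Fintype J] [DecidableEq J]

theorem perturb (c : J → ℂ) (hc : ∀ j, c j ≠ 0) :
    ∃ cc : ℂ → J → ℂ, Tendsto cc (𝓝[≠] 0) (𝓝 c) ∧
      ∀ᶠ ε in 𝓝[≠] 0, (∀ j, cc ε j ≠ 0) ∧ Function.Injective (cc ε) := by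
  let b : J → ℂ := fun j => ((Fintype.equivFin J j : ℕ) : ℂ)
  have hb : Function.Injective b := fun i j h => by
    apply (Fintype.equivFin J).injective
    apply Fin.ext
    have h' : ((Fintype.equivFin J i : ℕ):ℂ) = ((Fintype.equivFin J j : ℕ):ℂ) := h
    exact_mod_cast h'
  refine ⟨fun ε j => c j + ε * b j, ?_, ?_⟩
  · rw [tendsto_pi_nhds]
    intro j
    have : Tendsto (fun ε : ℂ => c j + ε * b j) (𝓝 0) (𝓝 (c j + 0 * b j)) :=
      (Continuous.tendsto (by fun_prop) 0)
    simpa using this.mono_left nhdsWithin_le_nhds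
  · have h1 : ∀ j, ∀ᶠ ε in 𝓝[≠] (0:ℂ), c j + ε * b j ≠ 0 := by
      intro j
      have : Tendsto (fun ε : ℂ => c j + ε * b j) (𝓝 0) (𝓝 (c j + 0 * b j)) :=
        (Continuous.tendsto (by fun_prop) 0)
      rw [zero_mul, add_zero] at this
      exact (this.mono_left nhdsWithin_le_nhds).eventually_ne (hc j)
    have h2 : ∀ j l, j ≠ l → ∀ᶠ ε in 𝓝[≠] (0:ℂ), c j + ε * b j ≠ c l + ε * b l := by
      intro j l hjl
      have hbb : b j - b l ≠ 0 := sub_ne_zero.2 fun h => hjl (hb h)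
      have h3 : ∀ᶠ ε in 𝓝[≠] (0:ℂ), ε ≠ (c l - c j) / (b j - b l) := by
        by_cases h0 : (c l - c j) / (b j - b l) = 0
        · rw [h0]; exact eventually_mem_nhdsWithin
        · exact (eventually_ne_nhds (Ne.symm h0)).filter_mono nhdsWithin_le_nhds
      filter_upwards [h3] with ε hε heq
      apply hε
      rw [eq_div_iff hbb]
      linear_combination heq
    have h1' := eventually_all.2 h1
    have h2' := eventually_all.2 fun j => eventually_all.2 fun l => eventually_imp_distrib_left.2 (h2 j l)
    filter_upwards [h1', h2'] with ε e1 e2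
    exact ⟨e1, fun j l h => by_contra fun hjl => e2 j l hjl h⟩

theorem T_normed {e : J → Fin N → Fin N → Module.End ℂ M} (h : GlSys e)
    (hb : ∀ j, IsBox (e j)) (K : Fin N → ℂ) (c : J → ℂ) (hc : ∀ j, c j ≠ 0) : TT e K c := by
  intro f hf
  rcases isEmpty_or_nonempty J with hJ | hJ
  · refine ⟨KP K, (Polynomial.monic_prod_of_monic _ _ fun a _ => Polynomial.monic_X_sub_C _).ne_zero, ?_⟩
    rw [← evP_KP K c e]
    rw [Df, Finset.univ_eq_empty] at hf
    exact hf
  obtain ⟨cc, hcc, hev⟩ := perturb c hc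
  let d := Fintype.card J * Module.finrank ℂ M + N
  let F : ℂ → ℕ → M := fun ε => solF (Df e K (cc ε)) N f
  have hF0 : solF (Df e K c) N f = f :=
    sol_unique (Df_lead e K c) _ _ (solF_sol (Df_lead e K c) f) hf fun t ht => solF_lt _ _ _ ht
  have hF : Tendsto F (𝓝[≠] 0) (𝓝 f) := by
    have := solF_tendsto (N := N) (Df_PC e K hcc hc) f
    rwa [hF0] at this
  have hx : ∀ᶠ ε in 𝓝[≠] (0:ℂ), ∃ x : Fin (d+1) → ℂ, x ∈ Metric.sphere (0 : Fin (d+1) → ℂ) 1 ∧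
      ∑ i, x i • (dF M ^ (i:ℕ)) (F ε) = 0 := by
    filter_upwards [hev] with ε hε
    obtain ⟨C, hC1, hC2, hC3⟩ := distinct_case h hb K (cc ε) hε.1 hε.2 (F ε)
      (solF_sol (Df_lead e K (cc ε)) f)
    let y : Fin (d+1) → ℂ := fun i => C.coeff i
    have hy : y ≠ 0 := by
      intro hy
      have := congrFun hy (Fin.last d)
      simp only [y, Fin.val_last, Pi.zero_apply] at this
      have h9 : C.coeff C.natDegree = 0 := by rw [hC2]; exact this
      exact one_ne_zero (hC1.symm.trans h9)
    have hy2 : ∑ i, y i • (dF M ^ (i:ℕ)) (F ε) = 0 := by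
      rw [Polynomial.aeval_eq_sum_range, hC2, LinearMap.sum_apply] at hC3
      rw [Fin.sum_univ_eq_sum_range (fun i => C.coeff i • (dF M ^ i) (F ε)) (d+1)]
      exact hC3
    refine ⟨((‖y‖⁻¹ : ℝ) : ℂ) • y, ?_, ?_⟩
    · rw [mem_sphere_zero_iff_norm, norm_smul]
      simp [hy]
    · simp only [Pi.smul_apply, smul_assoc]
      rw [← Finset.smul_sum, hy2, smul_zero]
  obtain ⟨x, hxx⟩ := hx.choice
  let U : Ultrafilter ℂ := Ultrafilter.of (𝓝[≠] 0)
  have hU : (U : Filter ℂ) ≤ 𝓝[≠] 0 := Ultrafilter.of_le _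
  obtain ⟨x0, hx0, hle⟩ := (isCompact_sphere (0 : Fin (d+1) → ℂ) 1).ultrafilter_le_nhds'
    (U.map x) (by
      have := hU hxx
      rw [Ultrafilter.mem_map]
      exact mem_of_superset this fun ε hε => hε.1)
  have hxt : Tendsto x (U : Filter ℂ) (𝓝 x0) := hle
  have hpow : ∀ k, PC (U : Filter ℂ) (fun _ => dF M ^ k) (dF M ^ k) := by
    intro k
    induction k with
    | zero => intro f f0 hf; simpa using hf
    | succ k ih => simp only [pow_succ]; exact ih.mul PC.dF
  have hlim : Tendsto (fun ε => ∑ i, x ε i • (dF M ^ (i:ℕ)) (F ε)) (U : Filter ℂ)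
      (𝓝 (∑ i, x0 i • (dF M ^ (i:ℕ)) f)) :=
    tendsto_finsetSum _ fun i _ =>
      (tendsto_pi_nhds.1 hxt i).smul (hpow i _ _ (hF.mono_left hU))
  have hz : Tendsto (fun ε => ∑ i, x ε i • (dF M ^ (i:ℕ)) (F ε)) (U : Filter ℂ) (𝓝 0) := by
    refine tendsto_const_nhds.congr' ?_
    filter_upwards [hU hxx] with ε hε using hε.2.symm
  have hfin := tendsto_nhds_unique hlim hz
  refine ⟨∑ i : Fin (d+1), Polynomial.monomial (i:ℕ) (x0 i), ?_, ?_⟩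
  · intro h0
    have hx00 : x0 = 0 := by
      funext i
      have := congrArg (fun p => Polynomial.coeff p (i:ℕ)) h0
      simp only [Polynomial.finset_sum_coeff, Polynomial.coeff_monomial, Polynomial.coeff_zero] at this
      rw [Finset.sum_eq_single i] at this
      · simpa using this
      · intro j _ hj
        rw [if_neg]
        exact fun hh => hj (Fin.ext hh)
      · simp
    rw [hx00] at hx0
    simp at hx0
  · rw [map_sum, LinearMap.sum_apply, ← hfin]
    refine Finset.sum_congr rfl fun i _ => ?_
    rw [Polynomial.aeval_monomial]; rfl

end Perturb

section Transfer
variable {M₁ M₂ : Type*} [AddCommGroup M₁] [Module ℂ M₁] [AddCommGroup M₂] [Module ℂ M₂]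
  {N : ℕ} {J₁ J₂ : Type*} [Fintype J₁] [DecidableEq J₁] [Fintype J₂] [DecidableEq J₂]

/-- coefficientwise application -/
def mapF (g : M₁ →ₗ[ℂ] M₂) : (ℕ → M₁) →ₗ[ℂ] (ℕ → M₂) where
  toFun f s := g (f s)
  map_add' f f' := by funext s; simp
  map_smul' c f := by funext s; simp

theorem mapF_dF (g : M₁ →ₗ[ℂ] M₂) (f : ℕ → M₁) : mapF g (dF M₁ f) = dF M₂ (mapF g f) := by
  funext s; simp [mapF]

theorem mapF_rF (g : M₁ →ₗ[ℂ] M₂) (c : ℂ) (f : ℕ → M₁) :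
    mapF g (rF M₁ c f) = rF M₂ c (mapF g f) := by
  funext s
  induction s with
  | zero => simp [mapF, rF_zero]
  | succ s ih =>
    rw [rF_succ, ← ih]; simp only [mapF, LinearMap.coe_mk, AddHom.coe_mk, rF_succ]
    rw [map_smul, map_sub]

theorem mapF_rdet (g : (ℕ → M₁) →ₗ[ℂ] (ℕ → M₂)) (X : Fin N → Fin N → Module.End ℂ (ℕ → M₁))
    (Y : Fin N → Fin N → Module.End ℂ (ℕ → M₂)) (h : ∀ a b f, g (X a b f) = Y a b (g f)) (f) :
    g (rdet X f) = rdet Y (g f) := by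
  have hp : ∀ (k : ℕ) (A : Fin k → Module.End ℂ (ℕ → M₁)) (B : Fin k → Module.End ℂ (ℕ → M₂)),
      (∀ i f, g (A i f) = B i (g f)) → ∀ f, g ((List.ofFn A).prod f) = (List.ofFn B).prod (g f) := by
    intro k
    induction k with
    | zero => intro A B _ f; simp
    | succ k ih =>
      intro A B hAB f
      rw [List.ofFn_succ, List.prod_cons, List.ofFn_succ, List.prod_cons, Module.End.mul_apply,
        Module.End.mul_apply, hAB, ih _ _ fun i => hAB i.succ]
  simp only [rdet, LinearMap.sum_apply, map_sum, LinearMap.smul_apply]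
  refine Finset.sum_congr rfl fun σ _ => ?_
  rw [map_zsmul]
  congr 1
  exact hp _ _ _ (fun a => h a (σ a)) f

theorem Df_itw {e₁ : J₁ → Fin N → Fin N → Module.End ℂ M₁} {e₂ : J₂ → Fin N → Fin N → Module.End ℂ M₂}
    (π : J₂ → J₁) (g : M₁ →ₗ[ℂ] M₂)
    (hg : ∀ j a b x, g (e₁ j a b x) = ∑ k with π k = j, e₂ k a b (g x))
    (K : Fin N → ℂ) (c : J₁ → ℂ) (f : ℕ → M₁) :
    mapF g (Df e₁ K c f) = Df e₂ K (fun k => c (π k)) (mapF g f) := by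
  apply mapF_rdet
  intro a b f
  simp only [Xm, LinearMap.sub_apply, map_sub, LinearMap.sum_apply, map_sum]
  congr 1
  · split_ifs
    · simp only [LinearMap.sub_apply, map_sub, mapF_dF, Module.algebraMap_end_apply, map_smul]
    · simp
  · rw [← Finset.sum_fiberwise Finset.univ π]
    refine Finset.sum_congr rfl fun j _ => ?_
    rw [Module.End.mul_apply, mapF_rF]
    have : mapF g (cF M₁ (e₁ j b a) f) = ∑ k with π k = j, cF M₂ (e₂ k b a) (mapF g f) := by
      funext s
      rw [Finset.sum_apply]
      exact hg j b a (f s)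
    rw [this, map_sum]
    refine Finset.sum_congr rfl fun k hk => ?_
    rw [Finset.mem_filter] at hk
    rw [hk.2]; rfl

theorem mapF_aeval (g : M₁ →ₗ[ℂ] M₂) (C : ℂ[X]) (f : ℕ → M₁) :
    mapF g (Polynomial.aeval (dF M₁) C f) = Polynomial.aeval (dF M₂) C (mapF g f) := by
  induction C using Polynomial.induction_on' with
  | add p q hp hq => simp only [map_add, LinearMap.add_apply, hp, hq]
  | monomial n a =>
    simp only [Polynomial.aeval_monomial, Module.End.mul_apply, Module.algebraMap_end_apply, map_smul]
    congr 1
    induction n generalizing f with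
    | zero => simp
    | succ n ih => rw [pow_succ, Module.End.mul_apply, ih, pow_succ, Module.End.mul_apply, mapF_dF]

theorem TT_inj {e₁ : J₁ → Fin N → Fin N → Module.End ℂ M₁} {e₂ : J₂ → Fin N → Fin N → Module.End ℂ M₂}
    (π : J₂ → J₁) (g : M₁ →ₗ[ℂ] M₂) (hinj : Function.Injective g)
    (hg : ∀ j a b x, g (e₁ j a b x) = ∑ k with π k = j, e₂ k a b (g x))
    (K : Fin N → ℂ) (c : J₁ → ℂ) (hT : TT e₂ K (fun k => c (π k))) : TT e₁ K c := by
  intro f hf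
  obtain ⟨C, hC, h0⟩ := hT (mapF g f) (by rw [← Df_itw π g hg, hf, map_zero])
  refine ⟨C, hC, ?_⟩
  rw [← mapF_aeval] at h0
  funext s
  exact hinj ((congrFun h0 s).trans (map_zero g).symm)

theorem TT_surj {e₁ : J₁ → Fin N → Fin N → Module.End ℂ M₁} {e₂ : J₁ → Fin N → Fin N → Module.End ℂ M₂}
    (g : M₁ →ₗ[ℂ] M₂) (hsurj : Function.Surjective g)
    (hg : ∀ j a b x, g (e₁ j a b x) = e₂ j a b (g x))
    (K : Fin N → ℂ) (c : J₁ → ℂ) (hT : TT e₁ K c) : TT e₂ K c := by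
  intro f hf
  have hg' : ∀ j a b x, g (e₁ j a b x) = ∑ k with k = j, e₂ k a b (g x) := by
    intro j a b x
    rw [hg, Finset.sum_filter, Finset.sum_ite_eq' Finset.univ j, if_pos (Finset.mem_univ _)]
  choose y hy using fun s => hsurj (f s)
  let F := solF (Df e₁ K c) N y
  have hF : Df e₁ K c F = 0 := solF_sol (Df_lead e₁ K c) y
  have h1 : mapF g F = f := by
    apply sol_unique (Df_lead e₂ K c) _ _ _ hf
    · intro t ht
      exact (congrArg g (solF_lt _ _ _ ht)).trans (hy t)
    · have := Df_itw id g hg' K c F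
      rw [hF, map_zero] at this
      exact this.symm
  obtain ⟨C, hC, h0⟩ := hT F hF
  refine ⟨C, hC, ?_⟩
  rw [← h1, ← mapF_aeval, h0, map_zero]

theorem T_box [FiniteDimensional ℂ M₁] {e : J₁ → Fin N → Fin N → Module.End ℂ M₁} (h : GlSys e)
    (hb : ∀ j, IsBox (e j)) (K : Fin N → ℂ) (c : J₁ → ℂ) (hc : ∀ j, c j ≠ 0) : TT e K c := by
  let g : M₁ ≃ₗ[ℂ] (Fin (Module.finrank ℂ M₁) → ℂ) := (Module.finBasis ℂ M₁).equivFun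
  let e₂ : J₁ → Fin N → Fin N → Module.End ℂ (Fin (Module.finrank ℂ M₁) → ℂ) :=
    fun j a b => g.conjAlgEquiv ℂ (e j a b)
  refine TT_inj (e₂ := e₂) id g.toLinearMap g.injective ?_ K c ?_
  · intro j a b x
    simp only [id]
    rw [Finset.sum_filter, Finset.sum_ite_eq' Finset.univ j, if_pos (Finset.mem_univ _)]
    simp [e₂, LinearEquiv.conjAlgEquiv]
  · refine T_normed ⟨?_, ?_⟩ ?_ K _ hc
    · intro j a b c d
      simp only [e₂]
      rw [← map_mul, ← map_mul, ← map_sub, h.gl, map_sub]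
      split_ifs <;> simp
    · intro j k hjk a b c d
      simp only [e₂]
      rw [← map_mul, h.ee j k hjk, map_mul]
    · intro j
      refine ⟨fun a b c d => ?_, ?_⟩
      · simp only [e₂]
        rw [← map_mul, (hb j).1]
        split_ifs <;> simp
      · simp only [e₂]
        rw [← map_sum, (hb j).2, map_one]

end Transfer
end GaudinModel
end PartB6

section PartC1
open scoped TensorProduct Polynomial Topology
set_option linter.all false
namespace GaudinModel

section Cas
variable {V : Type*} [AddCommGroup V] [Module ℂ V] {N : ℕ}

/-- shift operator on `ℂ → V` -/
def rS (V : Type*) [AddCommGroup V] [Module ℂ V] : Module.End ℂ (ℂ → V) where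
  toFun f s := f (s + 1)
  map_add' _ _ := rfl
  map_smul' _ _ := rfl

/-- derivative operator on `ℂ → V` -/
def dS (V : Type*) [AddCommGroup V] [Module ℂ V] : Module.End ℂ (ℂ → V) where
  toFun f s := (s + 1) • f (s + 1)
  map_add' _ _ := by funext s; simp
  map_smul' c f := by funext s; simp [smul_comm c]

def cS (V : Type*) [AddCommGroup V] [Module ℂ V] : Module.End ℂ V →ₐ[ℂ] Module.End ℂ (ℂ → V) where
  toFun A := { toFun := fun f s => A (f s)
               map_add' := fun f g => by funext s; simp
               map_smul' := fun c f => by funext s; simp }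
  map_one' := rfl
  map_mul' _ _ := rfl
  map_zero' := rfl
  map_add' _ _ := rfl
  commutes' _ := rfl

/-- a single `gl_N` action -/
def Gl1 (e : Fin N → Fin N → Module.End ℂ V) : Prop :=
  ∀ a b c d, e a b * e c d - e c d * e a b =
    (if b = c then e a d else 0) - (if d = a then e c b else 0)

/-- entries of the Capelli matrix -/
def Qe (e : Fin N → Fin N → Module.End ℂ V) (s : ℂ) (a b : Fin N) : Module.End ℂ V :=
  (if a = b then (s + 1 + (a : ℕ)) • (1 : Module.End ℂ V) else 0) - e b a

/-- the Capelli determinant -/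
def Qd (e : Fin N → Fin N → Module.End ℂ V) (s : ℂ) : Module.End ℂ V := rdet (Qe e s)

theorem Gl1.gsysS {e : Fin N → Fin N → Module.End ℂ V} (h : Gl1 e) :
    GSys (dS V) (fun _ : Unit => rS V) (fun _ a b => cS V (e a b)) where
  Dr j := by
    ext1 f; funext s
    simp only [Module.End.mul_apply, LinearMap.sub_apply, Pi.sub_apply, dS, rS, LinearMap.coe_mk,
      AddHom.coe_mk]
    module
  rr _ _ := rfl
  re _ _ _ _ := rfl
  De _ a b := by
    ext1 f; funext s
    simp [Module.End.mul_apply, dS, cS]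
  gl _ a b c d := by
    have := congrArg (cS V) (h a b c d)
    rw [map_sub, map_mul, map_mul, map_sub] at this
    rw [this]
    congr 1 <;> split_ifs <;> simp
  ee j k hjk := absurd rfl hjk

theorem ofFn_shift (k : ℕ) (Y : Fin k → Module.End ℂ (ℂ → V)) (A : Fin k → ℂ → Module.End ℂ V)
    (hY : ∀ a f s, Y a f s = A a s (f (s + 1))) (f : ℂ → V) (s : ℂ) :
    (List.ofFn Y).prod f s = (List.ofFn fun a => A a (s + (a : ℕ))).prod (f (s + k)) := by
  induction k generalizing s with
  | zero => simp
  | succ k ih =>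
    rw [List.ofFn_succ, List.ofFn_succ, List.prod_cons, List.prod_cons, Module.End.mul_apply, hY,
      ih _ (fun a => A a.succ) (fun a => hY a.succ), Module.End.mul_apply]
    simp only [Fin.val_zero, Nat.cast_zero, add_zero, Fin.val_succ, Nat.cast_add, Nat.cast_one]
    have e1 : s + 1 + (k : ℂ) = s + (k + 1) := by ring
    have e2 : ∀ a : Fin k, s + 1 + ((a : ℕ) : ℂ) = s + ((a : ℕ) + 1) := fun a => by ring
    simp only [e1, e2]

theorem Gl1.Qd_comm {e : Fin N → Fin N → Module.End ℂ V} (h : Gl1 e) (s : ℂ) (c d : Fin N) (x : V) :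
    e c d (Qd e s x) = Qd e s (e c d x) := by
  have key : ∀ (f : ℂ → V) (s : ℂ), rdet (Xm (dS V) (fun _ : Unit => rS V) (fun _ a b => cS V (e a b)) 0
      Finset.univ) f s = Qd e s (f (s + N)) := by
    intro f s
    rw [rdet, Qd, rdet, LinearMap.sum_apply, Finset.sum_apply, LinearMap.sum_apply]
    refine Finset.sum_congr rfl fun σ _ => ?_
    rw [LinearMap.smul_apply, LinearMap.smul_apply, Pi.smul_apply]
    congr 1
    rw [ofFn_shift N _ (fun a s => (if a = σ a then (s + 1) • (1 : Module.End ℂ V) else 0) - e (σ a) a)]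
    · congr 4
      funext a
      rw [Qe]
      congr 1
      split_ifs
      · congr 1; ring
      · rfl
    · intro a f s
      simp only [Xm, Finset.univ_unique, Finset.sum_singleton, Pi.zero_apply, map_zero, sub_zero,
        LinearMap.sub_apply, Pi.sub_apply]
      congr 1
      split_ifs <;> simp [dS]
  have h2 := h.gsysS.rdet_total_comm 0 Finset.univ c d rfl
  have h3 := congrFun (LinearMap.congr_fun h2 (fun _ => x)) s
  simp only [Finset.univ_unique, Finset.sum_singleton, Module.End.mul_apply] at h3 key
  rw [key] at h3
  refine Eq.trans ?_ h3
  exact congrArg (e c d) (key (fun _ => x) s).symm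

theorem list_kill (l : List (Fin N)) (hl : l.Pairwise (· < ·)) (Y : Fin N → Module.End ℂ V) (y : V)
    (a : Fin N) (ha : a ∈ l) (h0 : Y a y = 0) (h1 : ∀ b, a < b → ∃ c : ℂ, Y b y = c • y) :
    (l.map Y).prod y = 0 := by
  obtain ⟨l1, l2, rfl⟩ := List.append_of_mem ha
  rw [List.pairwise_append] at hl
  have h3 := (List.pairwise_cons.1 hl.2.1).1
  have h4 : ∀ l2 : List (Fin N), (∀ b ∈ l2, a < b) → ∃ c : ℂ, (l2.map Y).prod y = c • y := by
    intro l2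
    induction l2 with
    | nil => exact fun _ => ⟨1, by simp⟩
    | cons b l2 ih =>
      intro hb
      obtain ⟨c, hc⟩ := ih (fun b' h' => hb b' (List.mem_cons_of_mem _ h'))
      obtain ⟨c', hc'⟩ := h1 b (hb b List.mem_cons_self)
      exact ⟨c * c', by rw [List.map_cons, List.prod_cons, Module.End.mul_apply, hc, map_smul, hc', smul_smul]⟩
  obtain ⟨c, hc⟩ := h4 l2 h3
  rw [List.map_append, List.prod_append, Module.End.mul_apply, List.map_cons, List.prod_cons,
    Module.End.mul_apply, hc, map_smul, h0, smul_zero, map_zero]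

theorem Qd_hw (e : Fin N → Fin N → Module.End ℂ V) (μ : Fin N → ℂ) (x : V)
    (hp : ∀ a b, a < b → e a b x = 0) (hw : ∀ a, e a a x = μ a • x) (s : ℂ) :
    Qd e s x = (∏ a : Fin N, (s + 1 + (a : ℕ) - μ a)) • x := by
  have hd : ∀ b, Qe e s b b x = (s + 1 + (b : ℕ) - μ b) • x := by
    intro b
    rw [Qe, if_pos rfl, LinearMap.sub_apply, hw, LinearMap.smul_apply, Module.End.one_apply, sub_smul]
  rw [Qd, rdet, LinearMap.sum_apply, Finset.sum_eq_single 1]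
  · rw [LinearMap.smul_apply]
    simp only [Equiv.Perm.sign_one, Units.val_one, one_smul, Equiv.Perm.coe_one, id]
    rw [← List.prod_ofFn, List.ofFn_eq_map, List.ofFn_eq_map]
    induction (List.finRange N) with
    | nil => simp
    | cons b l ih =>
      rw [List.map_cons, List.prod_cons, Module.End.mul_apply, ih, map_smul, hd, List.map_cons,
        List.prod_cons, smul_smul, mul_comm]
  · intro σ _ hσ
    rw [LinearMap.smul_apply, List.ofFn_eq_map]
    have hne : (Finset.univ.filter fun a => σ a ≠ a).Nonempty := by
      by_contra hcon
      apply hσ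
      ext1 a
      by_contra h'
      exact hcon ⟨a, by simpa using h'⟩
    set a := Finset.max' _ hne with hadef
    have ha : σ a ≠ a := by
      have := Finset.max'_mem _ hne
      simpa using this
    have hb : ∀ b, a < b → σ b = b := by
      intro b hb
      by_contra h'
      exact absurd (Finset.le_max' _ b (by simpa using h')) (not_le.2 hb)
    have hlt : σ a < a := by
      rcases lt_trichotomy (σ a) a with h | h | h
      · exact h
      · exact absurd h ha
      · exact absurd (σ.injective (hb _ h)) ha
    rw [list_kill (List.finRange N) _ _ x a (List.mem_finRange a), smul_zero]
    · rw [Qe, if_neg (Ne.symm ha), zero_sub, LinearMap.neg_apply, hp _ _ hlt, neg_zero]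
    · intro b hb'
      rw [hb b hb']
      exact ⟨_, hd b⟩
    · exact List.pairwise_lt_finRange N
  · simp

/-- cyclic generation -/
def Gen (e : Fin N → Fin N → Module.End ℂ V) (w : V) : Prop :=
  ∀ W : Submodule ℂ V, (∀ a b : Fin N, ∀ x ∈ W, e a b x ∈ W) → w ∈ W → ∀ x : V, x ∈ W

theorem Qd_scalar {e : Fin N → Fin N → Module.End ℂ V} (h : Gl1 e) (μ : Fin N → ℂ) (w : V)
    (hp : ∀ a b, a < b → e a b w = 0) (hw : ∀ a, e a a w = μ a • w) (hg : Gen e w) (s : ℂ) (x : V) :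
    Qd e s x = (∏ a : Fin N, (s + 1 + (a : ℕ) - μ a)) • x := by
  let W : Submodule ℂ V := LinearMap.ker (Qd e s - (∏ a : Fin N, (s + 1 + (a : ℕ) - μ a)) • 1)
  have hm : ∀ x, x ∈ W ↔ Qd e s x = (∏ a : Fin N, (s + 1 + (a : ℕ) - μ a)) • x := by
    intro x
    rw [LinearMap.mem_ker, LinearMap.sub_apply, sub_eq_zero]; rfl
  rw [← hm]
  apply hg W
  · intro a b x hx
    rw [hm] at hx ⊢
    rw [← h.Qd_comm, hx, map_smul]
  · rw [hm]; exact Qd_hw e μ w hp hw s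

end Cas
end GaudinModel
end PartC1

section PartC2
open scoped TensorProduct Polynomial Topology
set_option linter.all false
namespace GaudinModel

section HW
variable {V : Type*} [AddCommGroup V] [Module ℂ V] {N : ℕ}

/-- simultaneous eigenvectors of commuting operators on a stable nonzero subspace -/
theorem joint_eig [FiniteDimensional ℂ V] {I : Type*} (f : I → Module.End ℂ V)
    (hc : ∀ i j, f i * f j = f j * f i) (U : Submodule ℂ V) (hU : U ≠ ⊥)
    (hs : ∀ i, ∀ x ∈ U, f i x ∈ U) : ∃ x ∈ U, x ≠ 0 ∧ ∃ μ : I → ℂ, ∀ i, f i x = μ i • x := by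
  let S : Set (Submodule ℂ V) := {E | E ≤ U ∧ E ≠ ⊥ ∧ ∀ i, ∀ x ∈ E, f i x ∈ E}
  obtain ⟨E, hE, hmin⟩ := WellFounded.has_min (wellFounded_lt (α := Submodule ℂ V)) S ⟨U, le_rfl, hU, hs⟩
  obtain ⟨hE1, hE2, hE3⟩ := hE
  have key : ∀ i, ∃ μ : ℂ, ∀ x ∈ E, f i x = μ • x := by
    intro i
    have : Nontrivial E := (Submodule.nontrivial_iff_ne_bot).2 hE2
    obtain ⟨μ, hμ⟩ := Module.End.exists_eigenvalue ((f i).restrict (hE3 i))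
    obtain ⟨y, hy⟩ := hμ.exists_hasEigenvector
    refine ⟨μ, fun x hx => ?_⟩
    by_contra hne
    refine hmin (E ⊓ LinearMap.ker (f i - μ • 1)) ⟨inf_le_left.trans hE1, ?_, ?_⟩ ?_
    · rw [Submodule.ne_bot_iff]
      refine ⟨y, ⟨y.2, ?_⟩, fun h => hy.2 (Subtype.ext h)⟩
      have := hy.apply_eq_smul
      have := congrArg Subtype.val this
      rw [SetLike.mem_coe, LinearMap.mem_ker, LinearMap.sub_apply, sub_eq_zero]
      exact this
    · rintro j x ⟨h1, h2⟩
      refine ⟨hE3 j x h1, ?_⟩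
      rw [SetLike.mem_coe, LinearMap.mem_ker, LinearMap.sub_apply, sub_eq_zero] at h2 ⊢
      rw [← Module.End.mul_apply, hc, Module.End.mul_apply, h2]
      simp
    · refine lt_of_le_of_ne inf_le_left fun heq => hne ?_
      have : x ∈ E ⊓ LinearMap.ker (f i - μ • 1) := by rw [heq]; exact hx
      have := this.2
      rw [SetLike.mem_coe, LinearMap.mem_ker, LinearMap.sub_apply, sub_eq_zero] at this
      exact this
  choose μ hμ using key
  obtain ⟨x, hx, hx0⟩ := (Submodule.ne_bot_iff _).1 hE2
  exact ⟨x, hE1 hx, hx0, μ, fun i => hμ i x hx⟩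

/-- grading element -/
def Hg (e : Fin N → Fin N → Module.End ℂ V) : Module.End ℂ V := ∑ a : Fin N, (-(a : ℕ) : ℂ) • e a a

theorem Gl1.diag_comm {e : Fin N → Fin N → Module.End ℂ V} (h : Gl1 e) (a b : Fin N) :
    e a a * e b b = e b b * e a a := by
  have := h a a b b
  rw [← sub_eq_zero, this]
  by_cases hab : a = b
  · subst hab; simp
  · simp [hab, Ne.symm hab]

theorem Gl1.Hg_comm {e : Fin N → Fin N → Module.End ℂ V} (h : Gl1 e) (a b : Fin N) (x : V) :
    Hg e (e a b x) = e a b (Hg e x) + ((b : ℕ) - (a : ℕ) : ℂ) • e a b x := by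
  have key : ∀ c, e c c (e a b x) = e a b (e c c x) +
      ((if c = a then e c b x else 0) - (if b = c then e a c x else 0)) := by
    intro c
    have := LinearMap.congr_fun (h c c a b) x
    simp only [LinearMap.sub_apply, Module.End.mul_apply] at this
    rw [sub_eq_iff_eq_add'] at this
    rw [this]
    congr 1
    congr 1 <;> split_ifs <;> simp
  simp only [Hg, LinearMap.sum_apply, LinearMap.smul_apply, key, smul_add, smul_sub, map_sum, map_smul,
    Finset.sum_add_distrib, Finset.sum_sub_distrib, smul_ite, smul_zero, Finset.sum_ite_eq, Finset.sum_ite_eq',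
    Finset.mem_univ, if_true]
  rw [sub_smul]
  congr 1
  module

theorem exists_hw [FiniteDimensional ℂ V] {e : Fin N → Fin N → Module.End ℂ V} (h : Gl1 e)
    (U : Submodule ℂ V) (hU : U ≠ ⊥) (hs : ∀ a b, ∀ x ∈ U, e a b x ∈ U) :
    ∃ x ∈ U, x ≠ 0 ∧ (∀ a b, a < b → e a b x = 0) ∧ ∃ μ : Fin N → ℂ, ∀ a, e a a x = μ a • x := by
  have hH : ∀ x ∈ U, Hg e x ∈ U := by
    intro x hx
    rw [Hg, LinearMap.sum_apply]
    exact U.sum_mem fun a _ => U.smul_mem _ (hs a a x hx)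
  have : Nontrivial U := (Submodule.nontrivial_iff_ne_bot).2 hU
  let HU : Module.End ℂ U := (Hg e).restrict hH
  obtain ⟨μ0, hμ0⟩ := Module.End.exists_eigenvalue HU
  have hfin : Set.Finite {μ | HU.HasEigenvalue μ} := Module.End.finite_hasEigenvalue HU
  obtain ⟨lam, hlam, hmax⟩ := Set.exists_max_image _ Complex.re hfin ⟨μ0, hμ0⟩
  have noeig : ∀ x ∈ U, ∀ μ : ℂ, lam.re < μ.re → Hg e x = μ • x → x = 0 := by
    intro x hx μ hμ hxe
    by_contra h0
    have : HU.HasEigenvalue μ := by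
      refine Module.End.hasEigenvalue_of_hasEigenvector (x := (⟨x, hx⟩ : U)) ⟨?_, fun h => h0 (congrArg Subtype.val h)⟩
      rw [Module.End.mem_eigenspace_iff]
      exact Subtype.ext hxe
    exact absurd (hmax μ this) (not_le.2 hμ)
  obtain ⟨y, hy⟩ := hlam.exists_hasEigenvector
  have hye : Hg e y.1 = lam • y.1 := congrArg Subtype.val hy.apply_eq_smul
  obtain ⟨x, hx, hx0, μ, hμ⟩ := joint_eig (fun a => e a a) (h.diag_comm) (U ⊓ LinearMap.ker (Hg e - lam • 1))
    (by
      rw [Submodule.ne_bot_iff]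
      refine ⟨y, ⟨y.2, ?_⟩, fun h => hy.2 (Subtype.ext h)⟩
      rw [SetLike.mem_coe, LinearMap.mem_ker, LinearMap.sub_apply, sub_eq_zero]
      exact hye)
    (by
      rintro a x ⟨h1, h2⟩
      refine ⟨hs a a x h1, ?_⟩
      rw [SetLike.mem_coe, LinearMap.mem_ker, LinearMap.sub_apply, sub_eq_zero] at h2 ⊢
      rw [h.Hg_comm, h2]
      simp)
  refine ⟨x, hx.1, hx0, fun a b hab => ?_, μ, hμ⟩
  have h2 := hx.2
  rw [SetLike.mem_coe, LinearMap.mem_ker, LinearMap.sub_apply, sub_eq_zero] at h2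
  refine noeig _ (hs a b x hx.1) (lam + ((b : ℕ) - (a : ℕ) : ℂ)) ?_ ?_
  · have : (a : ℕ) < (b : ℕ) := hab
    simp
    exact this
  · rw [h.Hg_comm, h2, add_smul]
    simp

theorem hw_nat [FiniteDimensional ℂ V] {e : Fin N → Fin N → Module.End ℂ V} (h : Gl1 e)
    (x : V) (hx : x ≠ 0) (a b : Fin N) (hab : a < b) (h0 : e a b x = 0) (μ : Fin N → ℂ)
    (hμ : ∀ a, e a a x = μ a • x) : ∃ k : ℕ, μ a - μ b = k := by
  have hne : a ≠ b := hab.ne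
  letI : LieRing (Module.End ℂ V) := LieRing.ofAssociativeRing
  have hx' : e a b ≠ 0 → ∃ k : ℕ, μ a - μ b = k := by
    intro hne0
    have t : IsSl2Triple (e a a - e b b) (e a b) (e b a) := by
      refine ⟨?_, ?_, ?_, ?_⟩
      · intro h00
        apply hne0
        have h1 := h a a a b
        have h2 := h b b a b
        simp only [hne, hne.symm, if_true, if_false] at h1 h2
        have h3 : (2 : ℂ) • e a b = 0 := by
          have : (e a a - e b b) * e a b - e a b * (e a a - e b b) = (2:ℂ) • e a b := by
            have : (e a a - e b b) * e a b - e a b * (e a a - e b b) =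
              (e a a * e a b - e a b * e a a) - (e b b * e a b - e a b * e b b) := by noncomm_ring
            rw [this, h1, h2, two_smul]; simp
          rw [← this, h00]; simp
        exact (smul_eq_zero.1 h3).resolve_left two_ne_zero
      · rw [Ring.lie_def, h a b b a]; simp
      · rw [Ring.lie_def]
        have h1 := h a a a b
        have h2 := h b b a b
        simp only [hne, hne.symm, if_true, if_false] at h1 h2
        have : (e a a - e b b) * e a b - e a b * (e a a - e b b) =
              (e a a * e a b - e a b * e a a) - (e b b * e a b - e a b * e b b) := by noncomm_ring
        rw [this, h1, h2, two_smul]; simp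
      · rw [Ring.lie_def]
        have h1 := h a a b a
        have h2 := h b b b a
        simp only [hne, hne.symm, if_true, if_false] at h1 h2
        have : (e a a - e b b) * e b a - e b a * (e a a - e b b) =
              (e a a * e b a - e b a * e a a) - (e b b * e b a - e b a * e b b) := by noncomm_ring
        rw [this, h1, h2, two_smul]; simp; abel
    have P : t.HasPrimitiveVectorWith x (μ a - μ b) := by
      refine ⟨hx, ?_, ?_⟩
      · show (e a a - e b b) x = _
        rw [LinearMap.sub_apply, hμ, hμ, sub_smul]
      · exact h0
    exact P.exists_nat
  by_cases h00 : e a b = 0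
  · refine ⟨0, ?_⟩
    have := LinearMap.congr_fun (h a b b a) x
    simp [h00, hμ] at this
    rw [← sub_smul] at this
    have := (smul_eq_zero.1 this.symm).resolve_right hx
    simpa using this
  · exact hx' h00

theorem hw_weight_unique (Λ : Fin N → ℤ) (hΛ : ∀ a b, a ≤ b → Λ b ≤ Λ a) (μ : Fin N → ℂ)
    (hμ : ∀ a b, a < b → ∃ k : ℕ, μ a - μ b = k)
    (hp : ∀ s : ℂ, ∏ a : Fin N, (s + 1 + (a : ℕ) - μ a) = ∏ a : Fin N, (s + 1 + (a : ℕ) - (Λ a : ℂ))) :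
    ∀ a, μ a = Λ a := by
  have h1 : ∀ a, ∃ b, μ a - (a : ℕ) = (Λ b : ℂ) - (b : ℕ) := by
    intro a
    have := hp (μ a - 1 - (a : ℕ))
    rw [Finset.prod_eq_zero (Finset.mem_univ a) (by ring)] at this
    obtain ⟨b, _, hb⟩ := Finset.prod_eq_zero_iff.1 this.symm
    exact ⟨b, by linear_combination hb⟩
  choose π hπ using h1
  have hmono : ∀ a b, a < b → π a < π b := by
    intro a b hab
    obtain ⟨k, hk⟩ := hμ a b hab
    have h2 : ((Λ (π a) - (π a : ℕ) : ℤ) : ℂ) = ((Λ (π b) - (π b : ℕ) + (b : ℕ) - (a : ℕ) + k : ℤ) : ℂ) := by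
      push_cast
      rw [← hk]
      linear_combination hπ b - hπ a
    have h3 : (Λ (π a) - (π a : ℕ) : ℤ) = (Λ (π b) - (π b : ℕ) + (b : ℕ) - (a : ℕ) + k : ℤ) := by exact_mod_cast h2
    by_contra hle
    push Not at hle
    have h4 := hΛ _ _ hle
    have h5 : (π b : ℕ) ≤ (π a : ℕ) := hle
    have h6 : (a : ℕ) < (b : ℕ) := hab
    omega
  have hsm : StrictMono π := fun a b hab => hmono a b hab
  have hid : π = id := by
    have := Subsingleton.elim (hsm.orderIsoOfSurjective π (Finite.surjective_of_injective hsm.injective)) (OrderIso.refl _)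
    funext a
    exact congrArg (fun g : Fin N ≃o Fin N => g a) this
  intro a
  have := hπ a
  rw [hid] at this
  simpa using this

end HW
end GaudinModel
end PartC2

section PartC3
open scoped TensorProduct Polynomial Topology
set_option linter.all false
namespace GaudinModel

section HW
variable {V : Type*} [AddCommGroup V] [Module ℂ V] {N : ℕ}

theorem Gl1.comm_apply {e : Fin N → Fin N → Module.End ℂ V} (h : Gl1 e) (a b c d : Fin N) (x : V) :
    e a b (e c d x) = e c d (e a b x) +
      ((if b = c then e a d x else 0) - (if d = a then e c b x else 0)) := by
  have := LinearMap.congr_fun (h a b c d) x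
  simp only [LinearMap.sub_apply, Module.End.mul_apply] at this
  rw [sub_eq_iff_eq_add'] at this
  rw [this]
  congr 1
  congr 1 <;> split_ifs <;> simp

theorem gen_lower {e : Fin N → Fin N → Module.End ℂ V} (h : Gl1 e) (Λ : Fin N → ℂ) (w : V)
    (hp : ∀ a b, a < b → e a b w = 0) (hw : ∀ a, e a a w = Λ a • w) (hg : Gen e w)
    (S : Submodule ℂ V) (hS : ∀ a b, b < a → ∀ x ∈ S, e a b x ∈ S) (hwS : w ∈ S) (x : V) : x ∈ S := by
  let T : Submodule ℂ V := sInf {S | (∀ a b, b < a → ∀ x ∈ S, e a b x ∈ S) ∧ w ∈ S}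
  have hTS : T ≤ S := sInf_le ⟨hS, hwS⟩
  have hwT : w ∈ T := by
    rw [Submodule.mem_sInf]; exact fun S hS => hS.2
  have hTl : ∀ a b, b < a → ∀ x ∈ T, e a b x ∈ T := by
    intro a b hab x hx
    rw [Submodule.mem_sInf] at hx ⊢
    exact fun S hS => hS.1 a b hab x (hx S hS)
  let T' : Submodule ℂ V := T ⊓ ⨅ a, ⨅ b, T.comap (e a b)
  have hT' : ∀ x, x ∈ T' ↔ x ∈ T ∧ ∀ a b, e a b x ∈ T := by
    intro x; simp [T', Submodule.mem_iInf]
  have hle : T ≤ T' := by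
    apply sInf_le
    refine ⟨?_, ?_⟩
    · intro a b hab x hx
      rw [hT'] at hx ⊢
      refine ⟨hx.2 a b, fun c d => ?_⟩
      rw [h.comm_apply]
      refine T.add_mem (hTl a b hab _ (hx.2 c d)) (T.sub_mem ?_ ?_)
      · split_ifs
        · exact hx.2 _ _
        · exact T.zero_mem
      · split_ifs
        · exact hx.2 _ _
        · exact T.zero_mem
    · rw [hT']
      refine ⟨hwT, fun a b => ?_⟩
      rcases lt_trichotomy a b with hab | rfl | hab
      · rw [hp a b hab]; exact T.zero_mem
      · rw [hw]; exact T.smul_mem _ hwT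
      · exact hTl a b hab w hwT
  exact hTS (hg T (fun a b x hx => ((hT' x).1 (hle hx)).2 a b) hwT x)

theorem hw_space {e : Fin N → Fin N → Module.End ℂ V} (h : Gl1 e) (Λ : Fin N → ℂ) (w : V)
    (hp : ∀ a b, a < b → e a b w = 0) (hw : ∀ a, e a a w = Λ a • w) (hg : Gen e w)
    (x : V) (hx : ∀ a, e a a x = Λ a • x) : ∃ c : ℂ, x = c • w := by
  let lam : ℂ := ∑ a : Fin N, (-(a : ℕ) : ℂ) * Λ a
  have hH : ∀ x, (∀ a, e a a x = Λ a • x) → Hg e x = lam • x := by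
    intro x hx
    rw [Hg, LinearMap.sum_apply, Finset.sum_smul]
    refine Finset.sum_congr rfl fun a _ => ?_
    rw [LinearMap.smul_apply, hx, smul_smul]
  let G : Submodule ℂ V := ⨆ k : ℕ, Module.End.eigenspace (Hg e) (lam - (k + 1 : ℕ))
  have hlow : ∀ a b : Fin N, b < a → ∀ k : ℕ, ∀ x ∈ Module.End.eigenspace (Hg e) (lam - (k : ℕ)), e a b x ∈ G := by
    intro a b hab k x hx
    rw [Module.End.mem_eigenspace_iff] at hx
    have hab' : (b : ℕ) < (a : ℕ) := hab
    obtain ⟨d, hd⟩ : ∃ d : ℕ, (a : ℕ) = b + (d + 1) := ⟨a - b - 1, by omega⟩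
    have : e a b x ∈ Module.End.eigenspace (Hg e) (lam - ((k + d) + 1 : ℕ)) := by
      rw [Module.End.mem_eigenspace_iff, h.Hg_comm, hx, map_smul, ← add_smul, hd]
      congr 1
      push_cast; ring
    exact (le_iSup (fun k : ℕ => Module.End.eigenspace (Hg e) (lam - (k + 1 : ℕ))) (k + d)) this
  have hall : x ∈ Submodule.span ℂ {w} ⊔ G := by
    apply gen_lower h Λ w hp hw hg
    · intro a b hab x hx
      obtain ⟨y, hy, g, hgG, rfl⟩ := Submodule.mem_sup.1 hx
      obtain ⟨c, rfl⟩ := Submodule.mem_span_singleton.1 hy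
      apply Submodule.mem_sup_right
      rw [map_add, map_smul]
      refine G.add_mem (G.smul_mem _ ?_) ?_
      · apply hlow a b hab 0
        rw [Module.End.mem_eigenspace_iff, hH w hw]; simp
      · have : G ≤ G.comap (e a b) := by
          apply iSup_le
          intro k x hx
          exact hlow a b hab (k + 1) x hx
        exact this hgG
    · exact Submodule.mem_sup_left (Submodule.mem_span_singleton_self w)
  obtain ⟨y, hy, g, hgG, hxe⟩ := Submodule.mem_sup.1 hall
  obtain ⟨c, rfl⟩ := Submodule.mem_span_singleton.1 hy
  refine ⟨c, ?_⟩
  have hg1 : g ∈ Module.End.eigenspace (Hg e) lam := by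
    have : g = x - c • w := by rw [← hxe]; abel
    rw [this]
    refine Submodule.sub_mem _ ?_ (Submodule.smul_mem _ _ ?_) <;> rw [Module.End.mem_eigenspace_iff]
    · exact hH x hx
    · exact hH w hw
  have hg2 : g ∈ ⨆ μ, ⨆ (_ : μ ≠ lam), Module.End.eigenspace (Hg e) μ := by
    refine (iSup_le fun k => ?_ : G ≤ _) hgG
    refine le_iSup₂_of_le (lam - (k + 1 : ℕ)) ?_ le_rfl
    intro h'
    have h'' : ((k + 1 : ℕ) : ℂ) = 0 := by linear_combination -h'
    exact Nat.succ_ne_zero k (by exact_mod_cast h'')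
  have := (Submodule.disjoint_def.1 (Module.End.eigenspaces_iSupIndep (Hg e) lam)) g hg1 hg2
  rw [← hxe, this, add_zero]

theorem embed {U : Type*} [AddCommGroup U] [Module ℂ U] [FiniteDimensional ℂ V] [FiniteDimensional ℂ U]
    {e : Fin N → Fin N → Module.End ℂ V} (h : Gl1 e) {e' : Fin N → Fin N → Module.End ℂ U} (h' : Gl1 e')
    (Λ : Fin N → ℤ) (hΛ : ∀ a b, a ≤ b → Λ b ≤ Λ a) (v : V) (u : U) (hu : u ≠ 0)
    (hp : ∀ a b, a < b → e a b v = 0) (hw : ∀ a, e a a v = (Λ a : ℂ) • v) (hg : Gen e v)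
    (hp' : ∀ a b, a < b → e' a b u = 0) (hw' : ∀ a, e' a a u = (Λ a : ℂ) • u) :
    ∃ W : Submodule ℂ (V × U), (∀ a b, ∀ x ∈ W, (e a b x.1, e' a b x.2) ∈ W) ∧
      (∀ y : V, ∃ x ∈ W, x.1 = y) ∧ (∀ x ∈ W, x.2 = 0 → x = 0) := by
  let W : Submodule ℂ (V × U) := sInf {S | (∀ a b, ∀ x ∈ S, (e a b x.1, e' a b x.2) ∈ S) ∧ (v, u) ∈ S}
  have hW : ∀ a b, ∀ x ∈ W, (e a b x.1, e' a b x.2) ∈ W := by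
    intro a b x hx
    rw [Submodule.mem_sInf] at hx ⊢
    exact fun S hS => hS.1 a b x (hx S hS)
  have hvW : (v, u) ∈ W := by
    rw [Submodule.mem_sInf]; exact fun S hS => hS.2
  refine ⟨W, hW, ?_, ?_⟩
  · intro y
    have := hg (W.map (LinearMap.fst ℂ V U)) (by
      rintro a b _ ⟨x, hx, rfl⟩
      exact ⟨_, hW a b x hx, rfl⟩) ⟨_, hvW, rfl⟩ y
    obtain ⟨x, hx, hxy⟩ := this
    exact ⟨x, hx, hxy⟩
  let eW : Fin N → Fin N → Module.End ℂ W := fun a b => ((e a b).prodMap (e' a b)).restrict (fun x hx => hW a b x hx)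
  have heW1 : ∀ a b (x : W), (eW a b x).1.1 = e a b x.1.1 := fun _ _ _ => rfl
  have heW2 : ∀ a b (x : W), (eW a b x).1.2 = e' a b x.1.2 := fun _ _ _ => rfl
  have hglW : Gl1 eW := by
    intro a b c d
    ext1 x
    apply Subtype.ext
    apply Prod.ext
    · have := LinearMap.congr_fun (h a b c d) x.1.1
      have key : ∀ (A B : Module.End ℂ W) (A' B' : Module.End ℂ V), (∀ x, (A x).1.1 = A' x.1.1) → (∀ x, (B x).1.1 = B' x.1.1) →
        ((A - B) x).1.1 = (A' - B') x.1.1 := by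
        intro A B A' B' hA hB
        rw [LinearMap.sub_apply, LinearMap.sub_apply, ← hA, ← hB]; rfl
      rw [key _ _ (e a b * e c d) (e c d * e a b) (fun x => rfl) (fun x => rfl), key _ _ (if b = c then e a d else 0) (if d = a then e c b else 0)]
      · exact this
      · intro x; split_ifs <;> rfl
      · intro x; split_ifs <;> rfl
    · have := LinearMap.congr_fun (h' a b c d) x.1.2
      have key : ∀ (A B : Module.End ℂ W) (A' B' : Module.End ℂ U), (∀ x, (A x).1.2 = A' x.1.2) → (∀ x, (B x).1.2 = B' x.1.2) →
        ((A - B) x).1.2 = (A' - B') x.1.2 := by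
        intro A B A' B' hA hB
        rw [LinearMap.sub_apply, LinearMap.sub_apply, ← hA, ← hB]; rfl
      rw [key _ _ (e' a b * e' c d) (e' c d * e' a b) (fun x => rfl) (fun x => rfl), key _ _ (if b = c then e' a d else 0) (if d = a then e' c b else 0)]
      · exact this
      · intro x; split_ifs <;> rfl
      · intro x; split_ifs <;> rfl
  let w0 : W := ⟨(v, u), hvW⟩
  have hpW : ∀ a b, a < b → eW a b w0 = 0 := by
    intro a b hab
    exact Subtype.ext (Prod.ext (hp a b hab) (hp' a b hab))
  have hwW : ∀ a, eW a a w0 = (Λ a : ℂ) • w0 := by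
    intro a
    exact Subtype.ext (Prod.ext (hw a) (hw' a))
  have hgW : Gen eW w0 := by
    intro S hS hwS x
    have h1 : W ≤ S.map W.subtype := by
      apply sInf_le
      refine ⟨?_, ⟨w0, hwS, rfl⟩⟩
      rintro a b _ ⟨y, hy, rfl⟩
      exact ⟨_, hS a b y hy, rfl⟩
    obtain ⟨y, hy, hyx⟩ := h1 x.2
    have : y = x := Subtype.ext hyx
    rwa [← this]
  intro x hx hx2
  by_contra hx0
  let k : Submodule ℂ W := LinearMap.ker ((LinearMap.snd ℂ V U) ∘ₗ W.subtype)
  have hk : k ≠ ⊥ := by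
    rw [Submodule.ne_bot_iff]
    exact ⟨⟨x, hx⟩, hx2, fun h => hx0 (congrArg Subtype.val h)⟩
  obtain ⟨y, hy, hy0, hyp, μ, hyμ⟩ := exists_hw hglW k hk (by
    intro a b x hx
    have : x.1.2 = 0 := hx
    show e' a b x.1.2 = 0
    rw [this, map_zero])
  have hμ : ∀ a, μ a = Λ a := by
    apply hw_weight_unique Λ hΛ μ
    · intro a b hab
      exact hw_nat hglW y hy0 a b hab (hyp a b hab) μ hyμ
    · intro s
      have h1 := Qd_hw eW μ y hyp hyμ s
      have h2 := Qd_scalar hglW (fun a => (Λ a : ℂ)) w0 hpW hwW hgW s y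
      rw [h1] at h2
      exact smul_left_injective ℂ hy0 h2
  obtain ⟨c, hc⟩ := hw_space hglW (fun a => (Λ a : ℂ)) w0 hpW hwW hgW y (fun a => by rw [hyμ, hμ])
  have h1 : y.1.2 = 0 := hy
  rw [hc] at h1
  have h2 : c • u = 0 := h1
  have h3 := (smul_eq_zero.1 h2).resolve_right hu
  rw [h3, zero_smul] at hc
  exact hy0 hc

end HW
end GaudinModel
end PartC3

section PartC4
open scoped TensorProduct Polynomial Topology
set_option linter.all false
namespace GaudinModel

section Box
variable {N : ℕ} {B : Type*} [Fintype B] [DecidableEq B]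

/-- box operators -/
def bx (l : B) (a b : Fin N) : Module.End ℂ ((B → Fin N) → ℂ) where
  toFun F t := if t l = a then F (Function.update t l b) else 0
  map_add' F G := by funext t; simp only [Pi.add_apply]; split_ifs <;> simp
  map_smul' c F := by funext t; simp only [Pi.smul_apply, RingHom.id_apply]; split_ifs <;> simp

theorem bx_apply (l : B) (a b : Fin N) (F : (B → Fin N) → ℂ) (t) :
    bx l a b F t = if t l = a then F (Function.update t l b) else 0 := rfl

theorem bx_mul (l : B) (a b c d : Fin N) : bx l a b * bx l c d = if b = c then bx l a d else 0 := by
  refine LinearMap.ext fun F => ?_; funext t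
  rw [Module.End.mul_apply, bx_apply]
  by_cases h1 : t l = a <;> by_cases h2 : b = c <;> simp [h1, h2, bx_apply]

theorem bx_one (l : B) : ∑ a : Fin N, bx l a a = 1 := by
  refine LinearMap.ext fun F => ?_; funext t
  rw [LinearMap.sum_apply, Finset.sum_apply]
  simp only [bx_apply, Finset.sum_ite_eq, Finset.mem_univ, if_true]
  simp

theorem bx_comm (l k : B) (h : l ≠ k) (a b c d : Fin N) : bx l a b * bx k c d = bx k c d * bx l a b := by
  refine LinearMap.ext fun F => ?_; funext t
  simp only [Module.End.mul_apply, bx_apply, Function.update_of_ne h, Function.update_of_ne h.symm]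
  rw [Function.update_comm h]
  split_ifs <;> rfl

theorem bx_sys : GlSys (fun (l : B) (a b : Fin N) => bx l a b) where
  gl l a b c d := by rw [bx_mul, bx_mul]
  ee := bx_comm

theorem bx_box (l : B) : IsBox (fun (a b : Fin N) => bx l a b) := ⟨bx_mul l, bx_one l⟩

end Box

theorem GlSys.total {M : Type*} [AddCommGroup M] [Module ℂ M] {N : ℕ} {J : Type*} [DecidableEq J] 
    {e : J → Fin N → Fin N → Module.End ℂ M} (h : GlSys e) (S : Finset J) : Gl1 (fun a b => ∑ j ∈ S, e j a b) := by
  intro a b c d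
  have key : ∀ j ∈ S, e j a b * (∑ k ∈ S, e k c d) - (∑ k ∈ S, e k c d) * e j a b =
      (if b = c then e j a d else 0) - (if d = a then e j c b else 0) := by
    intro j hj
    rw [Finset.mul_sum, Finset.sum_mul, ← Finset.sum_sub_distrib, Finset.sum_eq_single j, h.gl]
    · intro k _ hk
      rw [h.ee j k hk.symm, sub_self]
    · exact fun h => absurd hj h
  show (∑ j ∈ S, e j a b) * _ - _ * (∑ j ∈ S, e j a b) = _
  rw [Finset.sum_mul, Finset.mul_sum, ← Finset.sum_sub_distrib, Finset.sum_congr rfl key, Finset.sum_sub_distrib]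
  split_ifs <;> simp

section HWV
variable {N L : ℕ} 

/-- one column of the highest weight vector -/
def colM (h : ℕ) (t : Fin h → Fin N) : Matrix (Fin h) (Fin h) ℂ :=
  Matrix.of fun p q => if (t p : ℕ) = q then 1 else 0

theorem colM_update (h : ℕ) (t : Fin h → Fin N) (p : Fin h) (b : Fin N) :
    colM h (Function.update t p b) = (colM h t).updateRow p (fun q => if (b : ℕ) = q then 1 else 0) := by
  ext p' q
  by_cases hp : p' = p
  · subst hp; simp [colM]
  · simp [colM, Matrix.updateRow_ne hp, Function.update_of_ne hp]

theorem col_sum (h : ℕ) (t : Fin h → Fin N) (a b : Fin N) (hab : a ≤ b) :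
    ∑ p : Fin h, (if t p = a then (colM h (Function.update t p b)).det else 0) =
      if a = b ∧ (a : ℕ) < h then (colM h t).det else 0 := by
  by_cases hb : (b : ℕ) < h
  · have ha : (a : ℕ) < h := lt_of_le_of_lt hab hb
    have h1 : ∀ p, (if t p = a then (colM h (Function.update t p b)).det else 0) =
        (colM h t).adjugate ⟨b, hb⟩ p * colM h t p ⟨a, ha⟩ := by
      intro p
      rw [Matrix.adjugate_apply, colM_update]
      have : (fun q : Fin h => if (b : ℕ) = q then (1 : ℂ) else 0) = Pi.single ⟨b, hb⟩ 1 := by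
        funext q
        rw [Pi.single_apply]
        simp only [Fin.ext_iff, eq_comm]
      rw [this]
      simp only [colM, Matrix.of_apply, Fin.ext_iff, mul_ite, mul_one, mul_zero]
    rw [Finset.sum_congr rfl fun p _ => h1 p, ← Matrix.mul_apply, Matrix.adjugate_mul]
    simp only [Matrix.smul_apply, Matrix.one_apply, Fin.mk.injEq, smul_eq_mul, mul_ite, mul_one, mul_zero,
      ha, and_true, Fin.ext_iff, eq_comm]
  · have h1 : ∀ p, (colM h (Function.update t p b)).det = 0 := by
      intro p
      apply Matrix.det_eq_zero_of_row_eq_zero p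
      intro q
      have : (b : ℕ) ≠ q := fun h' => hb (h' ▸ q.2)
      simp [colM, this]
    simp only [h1, ite_self, Finset.sum_const_zero]
    rw [if_neg]
    rintro ⟨rfl, h2⟩
    exact hb h2

/-- the highest weight vector -/
def vL (h : Fin L → ℕ) : (((c : Fin L) × Fin (h c)) → Fin N) → ℂ :=
  fun t => ∏ c, (colM (h c) (fun p => t ⟨c, p⟩)).det

theorem vL_ne (h : Fin L → ℕ) (hh : ∀ c, h c ≤ N) : (vL h : (((c : Fin L) × Fin (h c)) → Fin N) → ℂ) ≠ 0 := by
  intro h0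
  have := congrFun h0 (fun l => ⟨l.2, lt_of_lt_of_le l.2.2 (hh l.1)⟩)
  have h1 : ∀ c : Fin L, colM (N := N) (h c) (fun p => ⟨p, lt_of_lt_of_le p.2 (hh c)⟩) = 1 := by
    intro c
    ext p q
    simp [colM, Matrix.one_apply, Fin.ext_iff]
  simp [vL, h1] at this

theorem vL_act (h : Fin L → ℕ) (a b : Fin N) (hab : a ≤ b) :
    ∑ l : ((c : Fin L) × Fin (h c)), bx l a b (vL h) =
      (if a = b then ((Finset.univ.filter fun c : Fin L => (a : ℕ) < h c).card : ℂ) else 0) • vL h := by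
  funext t
  rw [Finset.sum_apply, Fintype.sum_sigma]
  have h1 : ∀ c : Fin L, ∑ p : Fin (h c), bx (⟨c, p⟩ : (c : Fin L) × Fin (h c)) a b (vL h) t =
      if a = b ∧ (a : ℕ) < h c then vL h t else 0 := by
    intro c
    have h2 : ∀ p, bx (⟨c, p⟩ : (c : Fin L) × Fin (h c)) a b (vL h) t =
        (∏ c' ∈ Finset.univ.erase c, (colM (h c') (fun p => t ⟨c', p⟩)).det) *
        (if t ⟨c, p⟩ = a then (colM (h c) (Function.update (fun p => t ⟨c, p⟩) p b)).det else 0) := by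
      intro p
      rw [bx_apply, mul_ite, mul_zero]
      congr 1
      rw [vL, ← Finset.prod_erase_mul _ _ (Finset.mem_univ c)]
      congr 1
      · refine Finset.prod_congr rfl fun c' hc' => ?_
        have hne := Finset.ne_of_mem_erase hc'
        congr 2
        funext p'
        apply Function.update_of_ne
        intro h'
        exact hne (congrArg Sigma.fst h')
      · congr 2
        funext p'
        by_cases hp : p' = p
        · subst hp; simp
        · rw [Function.update_of_ne hp, Function.update_of_ne]
          intro h'
          exact hp (by simpa using h')
    rw [Finset.sum_congr rfl fun p _ => h2 p, ← Finset.mul_sum, col_sum _ _ _ _ hab, mul_ite, mul_zero,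
      Finset.prod_erase_mul _ _ (Finset.mem_univ c)]
    rfl
  rw [Finset.sum_congr rfl fun c _ => h1 c]
  by_cases hab' : a = b
  · simp [hab', Finset.sum_ite]
  · simp [hab']

theorem exists_cols (Λ : Fin N → ℤ) (hΛ : ∀ a b, a ≤ b → Λ b ≤ Λ a) (h0 : ∀ a, 0 ≤ Λ a) (hN : 0 < N) :
    ∃ (L : ℕ) (h : Fin L → ℕ), (∀ c, h c ≤ N) ∧
      ∀ a : Fin N, ((Finset.univ.filter fun c : Fin L => (a : ℕ) < h c).card : ℤ) = Λ a := by
  let S : ℕ → Finset (Fin N) := fun c => Finset.univ.filter fun a => (c : ℤ) < Λ a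
  refine ⟨(Λ ⟨0, hN⟩).toNat, fun c => (S c).card, fun c => (Finset.card_le_univ _).trans (by simp), ?_⟩
  intro a
  have key : ∀ c : ℕ, (a : ℕ) < (S c).card ↔ c < (Λ a).toNat := by
    intro c
    constructor
    · intro hlt
      by_contra hcon
      have hsub : S c ⊆ Finset.Iio a := by
        intro b hb
        simp only [S, Finset.mem_filter, Finset.mem_univ, true_and, Finset.mem_Iio, Finset.mem_Iic] at hb ⊢
        by_contra hle
        push Not at hle
        have := hΛ a b hle
        have := h0 a
        omega
      have := Finset.card_le_card hsub
      rw [Fin.card_Iio] at this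
      omega
    · intro hlt
      have hsub : Finset.Iic a ⊆ S c := by
        intro b hb
        simp only [S, Finset.mem_filter, Finset.mem_univ, true_and, Finset.mem_Iio, Finset.mem_Iic] at hb ⊢
        have := hΛ b a hb
        have := h0 a
        omega
      have := Finset.card_le_card hsub
      rw [Fin.card_Iic] at this
      omega
  have h2 : (Finset.univ.filter fun c : Fin ((Λ ⟨0, hN⟩).toNat) => (a : ℕ) < (S c).card) =
      Finset.univ.filter fun c : Fin ((Λ ⟨0, hN⟩).toNat) => (c : ℕ) < (Λ a).toNat := by
    ext c; simp only [Finset.mem_filter, key]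
  rw [h2, Fin.card_filter_val_lt]
  have h3 := hΛ ⟨0, hN⟩ a (Fin.mk_le_of_le_val (Nat.zero_le _))
  have := h0 a
  omega

end HWV
end GaudinModel
end PartC4

section PartC5
open scoped TensorProduct Polynomial Topology
set_option linter.all false
namespace GaudinModel

section Tens
variable {n : ℕ} {V : Fin n → Type*} [∀ i, AddCommGroup (V i)] [∀ i, Module ℂ (V i)]

/-- action of an operator in the `j`-th tensor factor -/
def io (V : Fin n → Type*) [∀ i, AddCommGroup (V i)] [∀ i, Module ℂ (V i)] (j : Fin n) :
    Module.End ℂ (V j) →ₐ[ℂ] Module.End ℂ (PiTensorProduct ℂ V) :=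
  AlgHom.ofLinearMap
    { toFun := fun A => PiTensorProduct.map
        (Function.update (fun i : Fin n => (LinearMap.id : V i →ₗ[ℂ] V i)) j A)
      map_add' := fun A B => PiTensorProduct.map_update_add _ _ _ _
      map_smul' := fun c A => PiTensorProduct.map_update_smul _ _ _ _ }
    (by
      show PiTensorProduct.map (Function.update (fun i : Fin n => (LinearMap.id : V i →ₗ[ℂ] V i)) j LinearMap.id) = 1
      have : (Function.update (fun i : Fin n => (LinearMap.id : V i →ₗ[ℂ] V i)) j LinearMap.id) =
        (fun i : Fin n => (LinearMap.id : V i →ₗ[ℂ] V i)) := Function.update_eq_self j _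
      rw [this]
      exact PiTensorProduct.map_id)
    (by
      intro A B
      show PiTensorProduct.map _ = PiTensorProduct.map _ * PiTensorProduct.map _
      rw [← PiTensorProduct.map_mul]
      congr 1
      funext i
      by_cases h : i = j
      · subst h; simp
      · simp only [Function.update_of_ne h]; rfl)

theorem io_apply (j : Fin n) (A : Module.End ℂ (V j)) : io V j A = PiTensorProduct.map
        (Function.update (fun i : Fin n => (LinearMap.id : V i →ₗ[ℂ] V i)) j A) := rfl

theorem io_comm (j k : Fin n) (h : j ≠ k) (A : Module.End ℂ (V j)) (B : Module.End ℂ (V k)) :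
    io V j A * io V k B = io V k B * io V j A := by
  rw [io_apply, io_apply, ← PiTensorProduct.map_mul, ← PiTensorProduct.map_mul]
  congr 1
  funext i
  by_cases h1 : i = j
  · subst h1
    simp only [Function.update_self, Function.update_of_ne h]; rfl
  · by_cases h2 : i = k
    · subst h2
      simp only [Function.update_self, Function.update_of_ne h1]; rfl
    · simp only [Function.update_of_ne h1, Function.update_of_ne h2]

theorem io_itw {W : Fin n → Type*} [∀ i, AddCommGroup (W i)] [∀ i, Module ℂ (W i)]
    (g : ∀ i, V i →ₗ[ℂ] W i) (j : Fin n) (A : Module.End ℂ (V j)) (B : Module.End ℂ (W j))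
    (h : ∀ x, g j (A x) = B (g j x)) (x : PiTensorProduct ℂ V) :
    PiTensorProduct.map g (io V j A x) = io W j B (PiTensorProduct.map g x) := by
  rw [io_apply, io_apply, ← LinearMap.comp_apply, ← LinearMap.comp_apply, ← PiTensorProduct.map_comp,
    ← PiTensorProduct.map_comp]
  congr 2
  funext i
  by_cases h1 : i = j
  · subst h1
    simp only [Function.update_self]
    exact LinearMap.ext h
  · simp only [Function.update_of_ne h1]; rfl

theorem map_inj {W : Fin n → Type*} [∀ i, AddCommGroup (W i)] [∀ i, Module ℂ (W i)]
    (g : ∀ i, V i →ₗ[ℂ] W i) (hg : ∀ i, Function.Injective (g i)) :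
    Function.Injective (PiTensorProduct.map g) := by
  choose r hr using fun i => (g i).exists_leftInverse_of_injective (LinearMap.ker_eq_bot.2 (hg i))
  have : PiTensorProduct.map r ∘ₗ PiTensorProduct.map g = LinearMap.id := by
    rw [← PiTensorProduct.map_comp]
    simp only [hr]
    exact PiTensorProduct.map_id
  exact Function.LeftInverse.injective (g := PiTensorProduct.map r) (fun x => LinearMap.congr_fun this x)

theorem map_surj {W : Fin n → Type*} [∀ i, AddCommGroup (W i)] [∀ i, Module ℂ (W i)]
    (g : ∀ i, V i →ₗ[ℂ] W i) (hg : ∀ i, Function.Surjective (g i)) :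
    Function.Surjective (PiTensorProduct.map g) := by
  choose r hr using fun i => (g i).exists_rightInverse_of_surjective (LinearMap.range_eq_top.2 (hg i))
  have : PiTensorProduct.map g ∘ₗ PiTensorProduct.map r = LinearMap.id := by
    rw [← PiTensorProduct.map_comp]
    simp only [hr]
    exact PiTensorProduct.map_id
  exact Function.RightInverse.surjective (g := PiTensorProduct.map r) (fun x => LinearMap.congr_fun this x)

end Tens

section Main
variable {N n : ℕ} (V : Fin n → Type*) [∀ i, AddCommGroup (V i)] [∀ i, Module ℂ (V i)]
  (M : Type*) [NormedAddCommGroup M] [NormedSpace ℂ M]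
  (E : ∀ i : Fin n, Fin N → Fin N → (V i →ₗ[ℂ] V i))
  (φ : M ≃ₗ[ℂ] PiTensorProduct ℂ V)

/-- the embedding of one-site operators -/
def ioM (j : Fin n) : Module.End ℂ (V j) →ₐ[ℂ] Module.End ℂ M :=
  ((φ.symm.conjAlgEquiv ℂ : Module.End ℂ (PiTensorProduct ℂ V) ≃ₐ[ℂ] Module.End ℂ M) : _ →ₐ[ℂ] _).comp (io V j)

theorem EE_eq (j : Fin n) (a b : Fin N) : EE V M E φ j a b = ioM V M φ j (E j a b) := rfl

theorem GlRel.gl1 {V : Fin n → Type*} [∀ i, AddCommGroup (V i)] [∀ i, Module ℂ (V i)]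
    {E : ∀ i : Fin n, Fin N → Fin N → (V i →ₗ[ℂ] V i)} (hrel : GlRel V E) (i : Fin n) :
    Gl1 (V := V i) (E i) := by
  intro a b c d
  have := hrel i a b c d
  simp only [ite_smul, one_smul, zero_smul] at this
  exact this

theorem EE_sys (hrel : GlRel V E) : GlSys (EE V M E φ) where
  gl j a b c d := by
    simp only [EE_eq]
    rw [← map_mul, ← map_mul, ← map_sub, hrel.gl1 j a b c d, map_sub]
    congr 1 <;> split_ifs <;> simp
  ee j k h a b c d := by
    simp only [EE_eq, ioM]
    simp only [AlgHom.coe_comp, Function.comp_apply]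
    rw [← map_mul, io_comm j k h, map_mul]

theorem EE_Qd (Λ : Fin n → Fin N → ℤ) (hrel : GlRel V E) (hhw : IsHW V E Λ) (i : Fin n) (s : ℂ) (x : M) :
    Qd (EE V M E φ i) s x = (∏ a : Fin N, (s + 1 + (a : ℕ) - (Λ i a : ℂ))) • x := by
  obtain ⟨v, hv, hp, hw, hg⟩ := hhw i
  have h1 : Qd (V := V i) (E i) s = (∏ a : Fin N, (s + 1 + (a : ℕ) - (Λ i a : ℂ))) • 1 :=
    LinearMap.ext fun y => Qd_scalar (hrel.gl1 i) (fun a => (Λ i a : ℂ)) v hp hw hg s y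
  have h2 : Qd (EE V M E φ i) s = ioM V M φ i (Qd (V := V i) (E i) s) := by
    rw [Qd, Qd, rdet_map]
    congr 1
    funext a b
    rw [Qe, Qe, map_sub, EE_eq]
    congr 1
    split_ifs <;> simp
  rw [h2, h1, map_smul, map_one]
  rfl

theorem TT_chain {W U : Fin n → Type*} [∀ i, AddCommGroup (W i)] [∀ i, Module ℂ (W i)]
    [∀ i, AddCommGroup (U i)] [∀ i, Module ℂ (U i)] [∀ i, FiniteDimensional ℂ (U i)]
    {B : Fin n → Type} [∀ i, Fintype (B i)] [∀ i, DecidableEq (B i)]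
    (eB : ∀ i, B i → Fin N → Fin N → Module.End ℂ (U i)) (hs : ∀ i, GlSys (eB i))
    (hb : ∀ i l, IsBox (eB i l)) (eW : ∀ i, Fin N → Fin N → Module.End ℂ (W i))
    (gV : ∀ i, W i →ₗ[ℂ] V i) (gU : ∀ i, W i →ₗ[ℂ] U i)
    (hgV : ∀ i, Function.Surjective (gV i)) (hgU : ∀ i, Function.Injective (gU i))
    (hV : ∀ i a b x, gV i (eW i a b x) = E i a b (gV i x))
    (hU : ∀ i a b x, gU i (eW i a b x) = (∑ l, eB i l a b) (gU i x))
    (K : Fin N → ℂ) (c : Fin n → ℂ) (hc : ∀ j, c j ≠ 0) : TT (EE V M E φ) K c := by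
  let e1 : Fin n → Fin N → Fin N → Module.End ℂ (PiTensorProduct ℂ W) := fun j a b => io W j (eW j a b)
  let e2 : ((j : Fin n) × B j) → Fin N → Fin N → Module.End ℂ (PiTensorProduct ℂ U) :=
    fun k a b => io U k.1 (eB k.1 k.2 a b)
  have hs2 : GlSys (M := PiTensorProduct ℂ U) e2 := by
    refine ⟨?_, ?_⟩
    · rintro ⟨j, l⟩ a b c d
      have h3 := congrArg (io U j) ((hs j).gl l a b c d)
      have h4 : io U j (eB j l a b * eB j l c d - eB j l c d * eB j l a b) =
        e2 ⟨j, l⟩ a b * e2 ⟨j, l⟩ c d - e2 ⟨j, l⟩ c d * e2 ⟨j, l⟩ a b := by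
          rw [map_sub, map_mul, map_mul]
      refine h4.symm.trans (h3.trans ?_)
      rw [map_sub]
      congr 1 <;> split_ifs <;> first | rfl | exact map_zero _
    · rintro ⟨j, l⟩ ⟨k, l'⟩ hne a b c d
      by_cases hjk : j = k
      · subst hjk
        have h5 : l ≠ l' := fun h => hne (by rw [h])
        have h3 := congrArg (io U j) ((hs j).ee l l' h5 a b c d)
        rw [map_mul, map_mul] at h3
        exact h3
      · exact io_comm j k hjk _ _
  have hb2 : ∀ k, IsBox (R := Module.End ℂ (PiTensorProduct ℂ U)) (e2 k) := by
    rintro ⟨j, l⟩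
    refine ⟨?_, ?_⟩
    · intro a b c d
      have h3 := congrArg (io U j) ((hb j l).1 a b c d)
      rw [map_mul] at h3
      refine h3.trans ?_
      split_ifs <;> first | rfl | exact map_zero _
    · have h3 := congrArg (io U j) ((hb j l).2)
      rw [map_sum, map_one] at h3
      exact h3
  have hT2 : TT (M := PiTensorProduct ℂ U) e2 K (fun k => c k.1) := T_box hs2 hb2 K _ fun k => hc k.1
  have hT1 : TT (M := PiTensorProduct ℂ W) e1 K c := by
    refine TT_inj (M₁ := PiTensorProduct ℂ W) (M₂ := PiTensorProduct ℂ U) (e₂ := e2) Sigma.fst (PiTensorProduct.map gU) (map_inj gU hgU) ?_ K c hT2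
    intro j a b x
    have h3 : PiTensorProduct.map gU (e1 j a b x) = io U j (∑ l, eB j l a b) (PiTensorProduct.map gU x) :=
      io_itw gU j _ _ (hU j a b) x
    refine h3.trans ?_
    rw [Finset.sum_filter, Fintype.sum_sigma, Finset.sum_eq_single j]
    · simp only [if_true, map_sum, LinearMap.sum_apply]
      rfl
    · intro k _ hk
      simp [hk]
    · simp
  refine TT_surj (M₁ := PiTensorProduct ℂ W) (e₁ := e1) (φ.symm.toLinearMap ∘ₗ PiTensorProduct.map gV)
    (φ.symm.surjective.comp (map_surj gV hgV)) ?_ K c hT1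
  intro j a b x
  have h3 : PiTensorProduct.map gV (e1 j a b x) = io V j (E j a b) (PiTensorProduct.map gV x) :=
    io_itw gV j _ _ (hV j a b) x
  rw [LinearMap.comp_apply]
  refine (congrArg φ.symm h3).trans ?_
  show _ = φ.symm (io V j (E j a b) (φ (φ.symm _)))
  rw [LinearEquiv.apply_symm_apply]

theorem EE_TT [∀ i, FiniteDimensional ℂ (V i)] (Λ : Fin n → Fin N → ℤ) (hN : 0 < N)
    (hdom : ∀ i, ∀ a b : Fin N, a ≤ b → Λ i b ≤ Λ i a)
    (hpoly : ∀ i a, 0 ≤ Λ i a) (hrel : GlRel V E) (hhw : IsHW V E Λ) (K : Fin N → ℂ)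
    (c : Fin n → ℂ) (hc : ∀ j, c j ≠ 0) : TT (EE V M E φ) K c := by
  choose L h hh hcard using fun i => exists_cols (Λ i) (hdom i) (hpoly i) hN
  choose v hv hp hw hg using hhw
  let B : Fin n → Type := fun i => (c : Fin (L i)) × Fin (h i c)
  let U : Fin n → Type := fun i => (B i → Fin N) → ℂ
  let eU : ∀ i, Fin N → Fin N → Module.End ℂ (U i) := fun i a b => ∑ l : B i, bx l a b
  have heU : ∀ i, Gl1 (eU i) := fun i => (bx_sys (N := N) (B := B i)).total Finset.univ
  have hemb := fun i => embed (hrel.gl1 i) (heU i) (Λ i) (hdom i) (v i) (vL (h i) : U i)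
    (vL_ne (h i) (hh i)) (hp i) (hw i) (hg i)
    (by
      intro a b hab
      have := vL_act (N := N) (h i) a b hab.le
      rw [if_neg hab.ne, zero_smul] at this
      rw [← this]
      exact LinearMap.sum_apply _ _ _)
    (by
      intro a
      have := vL_act (N := N) (h i) a a le_rfl
      rw [if_pos rfl] at this
      have h2 : ((Λ i a : ℤ) : ℂ) = ((Finset.univ.filter fun c : Fin (L i) => (a : ℕ) < h i c).card : ℂ) := by
        rw [← hcard i a]; simp
      rw [h2, ← this]
      exact LinearMap.sum_apply _ _ _)
  choose W hW hsurj hinj using hemb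
  let WW : Fin n → Type _ := fun i => W i
  let eW : ∀ i, Fin N → Fin N → Module.End ℂ (WW i) := fun i a b =>
    ((E i a b).prodMap (eU i a b)).restrict (fun x hx => hW i a b x hx)
  let gV : ∀ i, WW i →ₗ[ℂ] V i := fun i => LinearMap.fst ℂ (V i) (U i) ∘ₗ (W i).subtype
  let gU : ∀ i, WW i →ₗ[ℂ] U i := fun i => LinearMap.snd ℂ (V i) (U i) ∘ₗ (W i).subtype
  have hgV : ∀ i, Function.Surjective (gV i) := by
    intro i y
    obtain ⟨x, hx, hxy⟩ := hsurj i y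
    exact ⟨⟨x, hx⟩, hxy⟩
  have hgU : ∀ i, Function.Injective (gU i) := by
    intro i
    rw [injective_iff_map_eq_zero]
    intro x hx
    exact Subtype.ext (hinj i x.1 x.2 hx)
  exact TT_chain (W := fun i => W i) (U := fun i => (B i → Fin N) → ℂ) V M E φ (fun i l a b => bx l a b)
    (fun i => bx_sys) (fun i l => bx_box l) eW gV gU hgV hgU
    (fun _ _ _ _ => rfl) (fun _ _ _ _ => rfl) K c hc

end Main
end GaudinModel
end PartC5

section PartD1
open scoped TensorProduct Polynomial Topology
open Filter
set_option linter.all false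
namespace GaudinModel

section Taylor
variable {M : Type*} [NormedAddCommGroup M] [NormedSpace ℂ M] [CompleteSpace M]

/-- Taylor coefficients of `f` at `u0` -/
def Ty (u0 : ℂ) (f : ℂ → M) : ℕ → M := fun s => ((s.factorial : ℂ))⁻¹ • iteratedDeriv s f u0

theorem Ty_congr {u0 : ℂ} {f g : ℂ → M} (h : f =ᶠ[𝓝 u0] g) : Ty u0 f = Ty u0 g := by
  funext s; simp only [Ty]; rw [h.iteratedDeriv_eq]

theorem Ty_zero (u0 : ℂ) (f : ℂ → M) : Ty u0 f 0 = f u0 := by simp [Ty]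

theorem Ty_deriv (u0 : ℂ) (f : ℂ → M) : Ty u0 (deriv f) = dF M (Ty u0 f) := by
  funext s
  simp only [Ty, dF_apply]
  rw [iteratedDeriv_succ', smul_smul]
  congr 1
  rw [Nat.factorial_succ]
  have h1 : ((s:ℂ) + 1) ≠ 0 := by exact_mod_cast Nat.succ_ne_zero s
  have h2 : (s.factorial : ℂ) ≠ 0 := by exact_mod_cast Nat.factorial_ne_zero s
  push_cast
  field_simp

theorem Ty_add {u0 : ℂ} {f g : ℂ → M} (hf : AnalyticAt ℂ f u0) (hg : AnalyticAt ℂ g u0) :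
    Ty u0 (f + g) = Ty u0 f + Ty u0 g := by
  funext s
  simp only [Ty, Pi.add_apply]
  rw [iteratedDeriv_add hf.contDiffAt hg.contDiffAt, smul_add]

theorem Ty_smul {u0 : ℂ} {f : ℂ → M} (c : ℂ) (hf : AnalyticAt ℂ f u0) :
    Ty u0 (c • f) = c • Ty u0 f := by
  funext s
  simp only [Ty, Pi.smul_apply]
  rw [iteratedDeriv_const_smul hf.contDiffAt, smul_comm]

theorem Ty_zero_fun (u0 : ℂ) : Ty u0 (0 : ℂ → M) = 0 := by
  have h := Ty_smul (u0 := u0) (f := (0 : ℂ → M)) 0 analyticAt_const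
  simpa using h

theorem Ty_sub {u0 : ℂ} {f g : ℂ → M} (hf : AnalyticAt ℂ f u0) (hg : AnalyticAt ℂ g u0) :
    Ty u0 (f - g) = Ty u0 f - Ty u0 g := by
  have h1 : f - g = f + (-1 : ℂ) • g := by simp [sub_eq_add_neg]
  rw [h1, Ty_add hf (hg.const_smul), Ty_smul _ hg]
  simp [sub_eq_add_neg]

theorem Ty_sum {ι : Type*} (S : Finset ι) {u0 : ℂ} {f : ι → ℂ → M} (hf : ∀ i ∈ S, AnalyticAt ℂ (f i) u0) :
    Ty u0 (∑ i ∈ S, f i) = ∑ i ∈ S, Ty u0 (f i) := by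
  classical
  induction S using Finset.induction_on with
  | empty => simp [Ty_zero_fun]
  | insert a S ha ih =>
    rw [Finset.sum_insert ha, Finset.sum_insert ha, Ty_add (hf a (by simp)) , ih]
    · intro i hi; exact hf i (by simp [hi])
    · exact Finset.analyticAt_sum _ fun i hi => hf i (by simp [hi])

theorem analyticAt_end [FiniteDimensional ℂ M] (A : Module.End ℂ M) {u0 : ℂ} {f : ℂ → M} (hf : AnalyticAt ℂ f u0) :
    AnalyticAt ℂ (fun u => A (f u)) u0 :=
  (LinearMap.toContinuousLinearMap (A : M →ₗ[ℂ] M)).analyticAt _ |>.comp hf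

theorem Ty_end [FiniteDimensional ℂ M] (A : Module.End ℂ M) {u0 : ℂ} {f : ℂ → M} (hf : AnalyticAt ℂ f u0) :
    Ty u0 (fun u => A (f u)) = cF M A (Ty u0 f) := by
  funext s
  simp only [Ty, cF_apply, map_smul]
  congr 1
  have := ContinuousLinearMap.iteratedFDeriv_comp_left (LinearMap.toContinuousLinearMap (A : M →ₗ[ℂ] M)) (hf.contDiffAt (n := s)) (le_refl _)
  simp only [iteratedDeriv_eq_iteratedFDeriv]
  have h2 : (fun u => A (f u)) = (LinearMap.toContinuousLinearMap (A : M →ₗ[ℂ] M)) ∘ f := rfl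
  rw [h2, this]
  rfl

theorem iter_mul (w : ℂ) (s : ℕ) : ∀ (u0 : ℂ) (g : ℂ → M), AnalyticAt ℂ g u0 →
    iteratedDeriv s (fun u => (u - w) • g u) u0 = (u0 - w) • iteratedDeriv s g u0 +
      (s : ℂ) • iteratedDeriv (s - 1) g u0 := by
  induction s with
  | zero => intro u0 g hg; simp
  | succ s ih =>
    intro u0 g hg
    rw [iteratedDeriv_succ']
    have h1 : deriv (fun u => (u - w) • g u) =ᶠ[𝓝 u0] (fun u => (u - w) • deriv g u) + g := by
      filter_upwards [hg.eventually_analyticAt] with u hu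
      have h2 : HasDerivAt (fun u : ℂ => u - w) 1 u := (hasDerivAt_id u).sub_const w
      have := h2.smul hu.differentiableAt.hasDerivAt
      rw [show (fun u => (u - w) • g u) = (fun u : ℂ => u - w) • g from rfl, this.deriv]
      simp
    rw [h1.iteratedDeriv_eq, iteratedDeriv_add _ hg.contDiffAt, ih u0 _ hg.deriv, ← iteratedDeriv_succ',
      Nat.add_sub_cancel]
    · cases s with
      | zero => simp
      | succ s => rw [Nat.add_sub_cancel, ← iteratedDeriv_succ']; push_cast; module
    · apply AnalyticAt.contDiffAt
      exact (analyticAt_id.sub analyticAt_const).smul hg.deriv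

theorem Ty_mul (w : ℂ) {u0 : ℂ} {g : ℂ → M} (hg : AnalyticAt ℂ g u0) :
    Ty u0 (fun u => (u - w) • g u) = tF M (u0 - w) (Ty u0 g) := by
  funext s
  rw [tF_apply]
  simp only [Ty]
  rw [iter_mul w s u0 g hg]
  cases s with
  | zero => simp [xF]
  | succ s =>
    simp only [xF, Nat.add_sub_cancel, smul_add, Ty]
    congr 1
    · rw [smul_comm]
    · rw [smul_smul]; congr 1
      rw [Nat.factorial_succ]
      have h1 : ((s:ℂ) + 1) ≠ 0 := by exact_mod_cast Nat.succ_ne_zero s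
      have h2 : (s.factorial : ℂ) ≠ 0 := by exact_mod_cast Nat.factorial_ne_zero s
      push_cast
      field_simp

theorem analyticAt_inv_smul {w u0 : ℂ} (h : u0 ≠ w) {f : ℂ → M} (hf : AnalyticAt ℂ f u0) :
    AnalyticAt ℂ (fun u => (u - w)⁻¹ • f u) u0 :=
  ((analyticAt_id.sub analyticAt_const).inv (sub_ne_zero.2 h)).smul hf

theorem Ty_inv {w u0 : ℂ} (h : u0 ≠ w) {f : ℂ → M} (hf : AnalyticAt ℂ f u0) :
    Ty u0 (fun u => (u - w)⁻¹ • f u) = rF M (u0 - w) (Ty u0 f) := by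
  have h1 : f =ᶠ[𝓝 u0] fun u => (u - w) • ((u - w)⁻¹ • f u) := by
    filter_upwards [isOpen_ne.mem_nhds h] with u hu
    rw [smul_smul, mul_inv_cancel₀ (sub_ne_zero.2 hu), one_smul]
  rw [Ty_congr h1, Ty_mul w (analyticAt_inv_smul h hf)]
  rw [← Module.End.mul_apply, rt_one (sub_ne_zero.2 h)]; rfl

theorem Ty_pow (k : ℕ) {u0 : ℂ} {g : ℂ → M} (hg : AnalyticAt ℂ g u0) (s : ℕ) :
    Ty u0 (fun u => (u - u0) ^ k • g u) s = if s < k then 0 else Ty u0 g (s - k) := by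
  induction k generalizing s with
  | zero => simp
  | succ k ih =>
    have h1 : (fun u => (u - u0) ^ (k + 1) • g u) = fun u => (u - u0) • ((u - u0) ^ k • g u) := by
      funext u; rw [smul_smul, pow_succ']
    rw [h1, Ty_mul u0 (g := fun u => (u - u0) ^ k • g u) (((analyticAt_id.sub analyticAt_const).pow k).smul hg), tF_apply]
    cases s with
    | zero => simp [xF]
    | succ s => simp [xF, ih]

theorem Ty_eq_zero {u0 : ℂ} {f : ℂ → M} (hf : AnalyticAt ℂ f u0) (h : Ty u0 f = 0) :
    f =ᶠ[𝓝 u0] 0 := by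
  obtain ⟨r, hr, hd⟩ := Metric.eventually_nhds_iff_ball.1 hf.eventually_analyticAt
  rw [EventuallyEq, Metric.eventually_nhds_iff_ball]
  refine ⟨r, hr, fun y hy => ?_⟩
  have h2 := Complex.hasSum_taylorSeries_on_ball (f := f) (c := u0) (r := r)
    (fun x hx => (hd x hx).differentiableAt.differentiableWithinAt) hy
  have h3 : (fun n : ℕ => ((n.factorial : ℂ))⁻¹ • (y - u0) ^ n • iteratedDeriv n f u0) = fun _ => 0 := by
    funext n
    have := congrFun h n
    simp only [Ty] at this
    rw [smul_comm, this]; simp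
  rw [h3] at h2
  exact h2.unique hasSum_zero

end Taylor
end GaudinModel
end PartD1

section PartD2
open scoped TensorProduct Polynomial Topology
open Filter
set_option linter.all false
namespace GaudinModel

section Growth
variable {M : Type*} [NormedAddCommGroup M] [NormedSpace ℂ M]

theorem dF_pow (k : ℕ) (a : ℕ → M) (s : ℕ) :
    (s.factorial : ℂ) • ((dF M ^ k) a) s = ((s + k).factorial : ℂ) • a (s + k) := by
  induction k generalizing s with
  | zero => simp
  | succ k ih =>
    rw [pow_succ', Module.End.mul_apply, dF_apply, smul_smul]
    have := ih (s + 1)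
    rw [show s + (k + 1) = s + 1 + k by ring, ← this, Nat.factorial_succ]
    push_cast
    rw [mul_comm]

theorem rec_of_ann (C : ℂ[X]) (a : ℕ → M) (h : Polynomial.aeval (dF M) C a = 0) (s : ℕ) :
    ∑ k ∈ Finset.range (C.natDegree + 1), C.coeff k • (((s + k).factorial : ℂ) • a (s + k)) = 0 := by
  have h1 := congrFun h s
  rw [Polynomial.aeval_eq_sum_range] at h1
  simp only [LinearMap.sum_apply, LinearMap.smul_apply, Finset.sum_apply, Pi.smul_apply,
    Pi.zero_apply] at h1
  have h2 := congrArg (fun x => (s.factorial : ℂ) • x) h1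
  simp only [Finset.smul_sum, smul_zero] at h2
  rw [← h2]
  refine Finset.sum_congr rfl fun k _ => ?_
  rw [← dF_pow, smul_comm]

theorem growth_aux (d : ℕ) (r : ℕ → ℝ) (hr : ∀ k, 0 ≤ r k) (b : ℕ → ℝ) (hb : ∀ k, 0 ≤ b k)
    (h : ∀ s, b (s + d) ≤ ∑ k ∈ Finset.range d, r k * b (s + k)) :
    ∃ A B : ℝ, 0 ≤ A ∧ 1 ≤ B ∧ ∀ s, b s ≤ A * B ^ s := by
  have hB0 : 0 ≤ ∑ k ∈ Finset.range d, r k := Finset.sum_nonneg fun k _ => hr k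
  have hA0 : 0 ≤ ∑ k ∈ Finset.range d, b k := Finset.sum_nonneg fun k _ => hb k
  set B := 1 + ∑ k ∈ Finset.range d, r k with hB
  set A := ∑ k ∈ Finset.range d, b k with hA
  have hB1 : 1 ≤ B := by linarith
  refine ⟨A, B, hA0, hB1, fun s => ?_⟩
  induction s using Nat.strong_induction_on with
  | _ s ih =>
    by_cases hs : s < d
    · calc b s ≤ A := Finset.single_le_sum (f := b) (fun k _ => hb k) (Finset.mem_range.2 hs)
        _ ≤ A * B ^ s := le_mul_of_one_le_right hA0 (one_le_pow₀ hB1)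
    · obtain ⟨t, rfl⟩ := Nat.exists_eq_add_of_le (not_lt.1 hs)
      rw [add_comm d t]
      cases d with
      | zero => 
        have := h t
        simp only [Finset.range_zero, Finset.sum_empty] at this
        exact this.trans (mul_nonneg hA0 (by positivity))
      | succ d =>
      calc b (t + (d + 1)) ≤ ∑ k ∈ Finset.range (d+1), r k * b (t + k) := h t
        _ ≤ ∑ k ∈ Finset.range (d+1), r k * (A * B ^ (t + d)) := by
          refine Finset.sum_le_sum fun k hk => mul_le_mul_of_nonneg_left ?_ (hr k)
          have hk' := Finset.mem_range.1 hk
          refine (ih (t + k) (by omega)).trans (mul_le_mul_of_nonneg_left ?_ hA0)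
          exact pow_le_pow_right₀ hB1 (by omega)
        _ = (∑ k ∈ Finset.range (d+1), r k) * (A * B ^ (t + d)) := (Finset.sum_mul _ _ _).symm
        _ ≤ B * (A * B ^ (t + d)) := by
          refine mul_le_mul_of_nonneg_right (by linarith) (mul_nonneg hA0 (by positivity))
        _ = A * B ^ (t + (d + 1)) := by rw [← add_assoc, pow_succ]; ring

theorem growth (C : ℂ[X]) (hC : C ≠ 0) (a : ℕ → M) (h : Polynomial.aeval (dF M) C a = 0) :
    ∃ A B : ℝ, 0 ≤ A ∧ 1 ≤ B ∧ ∀ s, ‖a s‖ ≤ A * B ^ s / (s.factorial : ℝ) := by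
  obtain ⟨A, B, hA, hB, hg⟩ := growth_aux C.natDegree (fun k => ‖C.leadingCoeff⁻¹ * C.coeff k‖)
    (fun k => norm_nonneg _) (fun s => ‖(s.factorial : ℂ) • a s‖) (fun s => norm_nonneg _) (by
      intro s
      have h1 := rec_of_ann C a h s
      rw [Finset.sum_range_succ] at h1
      have hl : C.leadingCoeff ≠ 0 := Polynomial.leadingCoeff_ne_zero.2 hC
      have h2 : ((s + C.natDegree).factorial : ℂ) • a (s + C.natDegree) =
          - ∑ k ∈ Finset.range C.natDegree, (C.leadingCoeff⁻¹ * C.coeff k) • (((s + k).factorial : ℂ) • a (s + k)) := by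
        have h3 := congrArg (fun x => C.leadingCoeff⁻¹ • x) h1
        simp only [smul_add, smul_zero, Polynomial.coeff_natDegree, Finset.smul_sum] at h3
        rw [smul_smul C.leadingCoeff⁻¹ C.leadingCoeff, inv_mul_cancel₀ hl, one_smul] at h3
        rw [eq_neg_of_add_eq_zero_right h3]
        simp only [smul_smul, mul_assoc]
      show ‖((s + C.natDegree).factorial : ℂ) • a (s + C.natDegree)‖ ≤ _
      rw [h2, norm_neg]
      refine (norm_sum_le _ _).trans (Finset.sum_le_sum fun k _ => ?_)
      rw [norm_smul])
  refine ⟨A, B, hA, hB, fun s => ?_⟩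
  have hp : (0:ℝ) < (s.factorial : ℝ) := by exact_mod_cast Nat.factorial_pos s
  rw [le_div_iff₀ hp]
  have := hg s
  rw [norm_smul, Complex.norm_natCast] at this
  linarith

theorem exists_entire [CompleteSpace M] (C : ℂ[X]) (hC : C ≠ 0) (a : ℕ → M)
    (h : Polynomial.aeval (dF M) C a = 0) (u0 : ℂ) :
    ∃ f : ℂ → M, Differentiable ℂ f ∧ Ty u0 f = a := by
  obtain ⟨A, B, hA, hB, hg⟩ := growth C hC a h
  let p : FormalMultilinearSeries ℂ ℂ M := fun s => ContinuousMultilinearMap.mkPiRing ℂ (Fin s) (a s)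
  have hp : ∀ s, ‖p s‖ = ‖a s‖ := fun s => ContinuousMultilinearMap.norm_mkPiRing _
  have hr : p.radius = ⊤ := by
    apply FormalMultilinearSeries.radius_eq_top_of_summable_norm
    intro r
    refine Summable.of_nonneg_of_le (fun s => by positivity) (fun s => ?_)
      ((Real.summable_pow_div_factorial (B * r)).mul_left A)
    rw [hp]
    calc ‖a s‖ * (r:ℝ) ^ s ≤ A * B ^ s / (s.factorial : ℝ) * (r:ℝ)^s :=
          mul_le_mul_of_nonneg_right (hg s) (by positivity)
      _ = _ := by rw [mul_pow]; ring
  have hs : HasFPowerSeriesOnBall p.sum p 0 ⊤ := by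
    have := p.hasFPowerSeriesOnBall (by rw [hr]; exact ENNReal.zero_lt_top)
    rwa [hr] at this
  have hs2 : HasFPowerSeriesOnBall (fun u => p.sum (u - u0)) p u0 ⊤ := by
    have := hs.comp_sub u0
    simpa using this
  refine ⟨fun u => p.sum (u - u0), ?_, ?_⟩
  · have := hs2.differentiableOn
    intro u
    have h3 := this u (by simp)
    refine h3.differentiableAt ?_
    simp
  · funext s
    have h4 := hs2.factorial_smul 1 s
    simp only [Ty, iteratedDeriv_eq_iteratedFDeriv]
    rw [← h4]
    have hf : (s.factorial : ℂ) ≠ 0 := by exact_mod_cast Nat.factorial_ne_zero s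
    rw [← Nat.cast_smul_eq_nsmul ℂ, smul_smul, inv_mul_cancel₀ hf, one_smul]
    simp [p]

end Growth
end GaudinModel
end PartD2

section PartD3
open scoped TensorProduct Polynomial Topology
open Filter
set_option linter.all false
namespace GaudinModel

section Ops
variable {N n : ℕ} {M : Type*} [NormedAddCommGroup M] [NormedSpace ℂ M]
  (e : Fin n → Fin N → Fin N → Module.End ℂ M) (z : Fin n → ℂ) (K : Fin N → ℂ)

/-- entries of the operator matrix on functions, for abstract actions `e` -/
def Xe (a b : Fin N) (f : ℂ → M) : ℂ → M :=
  fun u => (if a = b then deriv f u else 0) - (Matrix.diagonal K) a b • f u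
    - ∑ j : Fin n, (u - z j)⁻¹ • (e j b a) (f u)

/-- universal differential operator on functions, for abstract actions `e` -/
def De (f : ℂ → M) : ℂ → M :=
  fun u => ∑ σ : Equiv.Perm (Fin N),
    ((Equiv.Perm.sign σ : ℤˣ) : ℤ) •
      (((List.ofFn fun a : Fin N => Xe e z K a (σ a)).foldr (· ∘ ·) id) f u)

theorem fold_rel {F G : Type*} (R : F → G → Prop) {k : ℕ} (X : Fin k → F → F) (Y : Fin k → G → G)
    (h : ∀ a f g, R f g → R (X a f) (Y a g)) (f : F) (g : G) (hfg : R f g) :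
    R (((List.ofFn X).foldr (· ∘ ·) id) f) (((List.ofFn Y).foldr (· ∘ ·) id) g) := by
  induction k with
  | zero => simpa using hfg
  | succ k ih =>
    rw [List.ofFn_succ, List.ofFn_succ, List.foldr_cons, List.foldr_cons]
    exact h 0 _ _ (ih _ _ fun a f g => h a.succ f g)

theorem prod_fold {G : Type*} [AddCommGroup G] [Module ℂ G] {k : ℕ} (Y : Fin k → Module.End ℂ G) (g : G) :
    (List.ofFn Y).prod g = ((List.ofFn fun a => (Y a : G → G)).foldr (· ∘ ·) id) g := by
  induction k with
  | zero => simp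
  | succ k ih =>
    rw [List.ofFn_succ, List.ofFn_succ, List.foldr_cons, List.prod_cons, Module.End.mul_apply, ih]
    rfl

variable [FiniteDimensional ℂ M]

theorem Xe_analyticAt [CompleteSpace M] {u0 : ℂ} (hu : GoodG z u0) (a b : Fin N) {f : ℂ → M} (hf : AnalyticAt ℂ f u0) :
    AnalyticAt ℂ (Xe e z K a b f) u0 := by
  unfold Xe
  refine AnalyticAt.fun_sub (AnalyticAt.fun_sub ?_ ?_) ?_
  · split_ifs
    · exact hf.deriv
    · exact analyticAt_const
  · exact analyticAt_const.smul hf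
  · refine Finset.analyticAt_fun_sum _ fun j _ => ?_
    exact analyticAt_inv_smul (hu j) (analyticAt_end _ hf)

theorem Ty_Xe [CompleteSpace M] {u0 : ℂ} (hu : GoodG z u0) (a b : Fin N) {f : ℂ → M} (hf : AnalyticAt ℂ f u0) :
    Ty u0 (Xe e z K a b f) = Xm (dF M) (fun j => rF M (u0 - z j)) (fun j a b => cF M (e j a b)) K
      Finset.univ a b (Ty u0 f) := by
  have hd : ∀ j, AnalyticAt ℂ (fun u => (u - z j)⁻¹ • (e j b a) (f u)) u0 := fun j =>
    analyticAt_inv_smul (hu j) (analyticAt_end _ hf)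
  have hS : AnalyticAt ℂ (∑ j : Fin n, fun u => (u - z j)⁻¹ • (e j b a) (f u)) u0 :=
    Finset.analyticAt_sum _ fun j _ => hd j
  have hT : Ty u0 (∑ j : Fin n, fun u => (u - z j)⁻¹ • (e j b a) (f u)) =
      (∑ j : Fin n, rF M (u0 - z j) * cF M (e j b a)) (Ty u0 f) := by
    rw [Ty_sum _ fun j _ => hd j, LinearMap.sum_apply]
    refine Finset.sum_congr rfl fun j _ => ?_
    rw [Ty_inv (hu j) (analyticAt_end _ hf), Ty_end _ hf]; rfl
  unfold Xm
  rw [LinearMap.sub_apply, ← hT]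
  by_cases hab : a = b
  · subst hab
    have h1 : Xe e z K a a f = deriv f - K a • f - ∑ j : Fin n, fun u => (u - z j)⁻¹ • (e j a a) (f u) := by
      funext u; simp [Xe]
    rw [h1, Ty_sub (hf.deriv.sub hf.const_smul) hS, Ty_sub hf.deriv hf.const_smul, Ty_deriv,
      Ty_smul _ hf, if_pos rfl, LinearMap.sub_apply, Module.algebraMap_end_apply]
  · have h1 : Xe e z K a b f = 0 - ∑ j : Fin n, fun u => (u - z j)⁻¹ • (e j b a) (f u) := by
      funext u; simp [Xe, hab]
    rw [h1, Ty_sub (f := (0 : ℂ → M)) analyticAt_const hS, Ty_zero_fun, if_neg hab, LinearMap.zero_apply]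

theorem fold_Xe [CompleteSpace M] {u0 : ℂ} (hu : GoodG z u0) {f : ℂ → M} (hf : AnalyticAt ℂ f u0)
    (σ : Equiv.Perm (Fin N)) :
    AnalyticAt ℂ (((List.ofFn fun a : Fin N => Xe e z K a (σ a)).foldr (· ∘ ·) id) f) u0 ∧
    Ty u0 (((List.ofFn fun a : Fin N => Xe e z K a (σ a)).foldr (· ∘ ·) id) f) =
      (List.ofFn fun a => Xm (dF M) (fun j => rF M (u0 - z j)) (fun j a b => cF M (e j a b)) K
      Finset.univ a (σ a)).prod (Ty u0 f) := by
  rw [prod_fold]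
  exact fold_rel (fun (f : ℂ → M) g => AnalyticAt ℂ f u0 ∧ Ty u0 f = g) _ _ (by
    rintro a f g ⟨h1, rfl⟩
    exact ⟨Xe_analyticAt e z K hu a _ h1, Ty_Xe e z K hu a _ h1⟩) f _ ⟨hf, rfl⟩

theorem De_eq (f : ℂ → M) : De e z K f = ∑ σ : Equiv.Perm (Fin N),
    (((Equiv.Perm.sign σ : ℤˣ) : ℤ) : ℂ) •
      (((List.ofFn fun a : Fin N => Xe e z K a (σ a)).foldr (· ∘ ·) id) f) := by
  funext u
  simp only [De, Finset.sum_apply, Pi.smul_apply, Int.cast_smul_eq_zsmul]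

theorem De_analyticAt [CompleteSpace M] {u0 : ℂ} (hu : GoodG z u0) {f : ℂ → M} (hf : AnalyticAt ℂ f u0) :
    AnalyticAt ℂ (De e z K f) u0 := by
  rw [De_eq]
  exact Finset.analyticAt_sum _ fun σ _ => (fold_Xe e z K hu hf σ).1.const_smul

theorem Ty_De [CompleteSpace M] {u0 : ℂ} (hu : GoodG z u0) {f : ℂ → M} (hf : AnalyticAt ℂ f u0) :
    Ty u0 (De e z K f) = Df e K (fun j => u0 - z j) (Ty u0 f) := by
  rw [De_eq, Ty_sum _ fun σ _ => (fold_Xe e z K hu hf σ).1.const_smul]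
  unfold Df rdet
  rw [LinearMap.sum_apply]
  refine Finset.sum_congr rfl fun σ _ => ?_
  rw [Ty_smul _ (fold_Xe e z K hu hf σ).1, (fold_Xe e z K hu hf σ).2, LinearMap.smul_apply,
    Int.cast_smul_eq_zsmul]

end Ops
end GaudinModel
end PartD3

section PartD4
open scoped TensorProduct Polynomial Topology
open Filter
set_option linter.all false
namespace GaudinModel

section Sol
variable {N n : ℕ} {M : Type*} [NormedAddCommGroup M] [NormedSpace ℂ M] [FiniteDimensional ℂ M]
  [CompleteSpace M]
  (e : Fin n → Fin N → Fin N → Module.End ℂ M) (z : Fin n → ℂ) (K : Fin N → ℂ)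

theorem good_eq : {u | GoodG z u} = (Set.range z)ᶜ := by
  ext u
  simp only [GoodG, Set.mem_setOf_eq, Set.mem_compl_iff, Set.mem_range, not_exists]
  exact forall_congr' fun j => ne_comm

theorem good_conn : IsPathConnected {u | GoodG z u} := by
  rw [good_eq]
  exact (Set.finite_range z).countable.isPathConnected_compl_of_one_lt_rank (by simp)

/-- entire solutions -/
def Sol : Submodule ℂ (ℂ → M) where
  carrier := {f | Differentiable ℂ f ∧ ∀ u, GoodG z u → Df e K (fun j => u - z j) (Ty u f) = 0}
  add_mem' := by
    rintro f g ⟨hf, hf2⟩ ⟨hg, hg2⟩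
    refine ⟨hf.add hg, fun u hu => ?_⟩
    rw [Ty_add (hf.analyticAt u) (hg.analyticAt u), map_add, hf2 u hu, hg2 u hu, add_zero]
  zero_mem' := ⟨differentiable_const 0, fun u hu => by rw [Ty_zero_fun, map_zero]⟩
  smul_mem' := by
    rintro c f ⟨hf, hf2⟩
    refine ⟨hf.const_smul c, fun u hu => ?_⟩
    rw [Ty_smul _ (hf.analyticAt u), map_smul, hf2 u hu, smul_zero]

theorem Sol.de {f : ℂ → M} (hf : f ∈ Sol e z K) {u : ℂ} (hu : GoodG z u) : De e z K f u = 0 := by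
  rw [← Ty_zero u (De e z K f), Ty_De e z K hu (hf.1.analyticAt u), hf.2 u hu]; rfl

theorem mem_Sol {f : ℂ → M} (hf : Differentiable ℂ f) {u0 : ℂ} (hu0 : GoodG z u0)
    (h : Df e K (fun j => u0 - z j) (Ty u0 f) = 0) : f ∈ Sol e z K := by
  have hA : AnalyticOnNhd ℂ (De e z K f) {u | GoodG z u} := fun u hu =>
    De_analyticAt e z K hu (hf.analyticAt u)
  have h0 : De e z K f =ᶠ[𝓝 u0] 0 := by
    apply Ty_eq_zero (hA u0 hu0)
    rw [Ty_De e z K hu0 (hf.analyticAt u0), h]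
  have h1 := hA.eqOn_zero_of_preconnected_of_eventuallyEq_zero
    (good_conn z).isConnected.isPreconnected hu0 h0
  refine ⟨hf, fun u hu => ?_⟩
  rw [← Ty_De e z K hu (hf.analyticAt u)]
  have h2 : De e z K f =ᶠ[𝓝 u] 0 := by
    have : IsOpen {u | GoodG z u} := by
      rw [good_eq]; exact (Set.finite_range z).isClosed.isOpen_compl
    filter_upwards [this.mem_nhds hu] with w hw using h1 hw
  rw [Ty_congr h2, Ty_zero_fun]

/-- a finite set of Taylor coefficients, as a linear map on entire solutions -/
def jet (u0 : ℂ) (ix : Fin N → ℕ) : Sol e z K →ₗ[ℂ] (Fin N → M) where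
  toFun f a := Ty u0 f.1 (ix a)
  map_add' f g := by
    funext a
    show Ty u0 (f.1 + g.1) _ = _
    rw [Ty_add (f.2.1.analyticAt u0) (g.2.1.analyticAt u0)]; rfl
  map_smul' c f := by
    funext a
    show Ty u0 (c • f.1) _ = _
    rw [Ty_smul _ (f.2.1.analyticAt u0)]; rfl

theorem jet_surj {u0 : ℂ} (hu0 : GoodG z u0) (hT : TT e K (fun j => u0 - z j)) :
    Function.Surjective (jet e z K u0 (fun a => (a : ℕ))) := by
  intro x
  let y : ℕ → M := fun s => if h : s < N then x ⟨s, h⟩ else 0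
  have hs := solF_sol (Df_lead e K (fun j => u0 - z j)) y
  obtain ⟨C, hC, hC2⟩ := hT _ hs
  obtain ⟨f, hf, hf2⟩ := exists_entire C hC _ hC2 u0
  refine ⟨⟨f, mem_Sol e z K hf hu0 (by rw [hf2, hs])⟩, ?_⟩
  funext a
  show Ty u0 f a = x a
  rw [hf2, solF_lt _ _ _ a.2]
  simp [y]

theorem Sol_weight (h : GlSys e) (c : Fin N) (μ : ℂ) {f : ℂ → M} (hf : f ∈ Sol e z K) :
    (fun u => ((∑ j, e j c c) - μ • (1 : Module.End ℂ M)) (f u)) ∈ Sol e z K := by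
  obtain ⟨u0, hu0⟩ := (good_conn z).nonempty
  refine mem_Sol e z K ?_ hu0 ?_
  · intro u
    exact (analyticAt_end _ (hf.1.analyticAt u)).differentiableAt
  · rw [Ty_end _ (hf.1.analyticAt u0)]
    have h1 := (h.gsys (fun j => u0 - z j)).rdet_total_comm K Finset.univ c c rfl
    have h2 := LinearMap.congr_fun h1 (Ty u0 f)
    rw [Module.End.mul_apply, Module.End.mul_apply] at h2
    have h3 : Df e K (fun j => u0 - z j) (Ty u0 f) = 0 := hf.2 u0 hu0
    unfold Df at h3 ⊢
    rw [h3, map_zero] at h2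
    rw [map_sub, map_sum, map_smul, map_one, LinearMap.sub_apply, map_sub, ← h2, LinearMap.smul_apply,
      map_smul, Module.End.one_apply, h3]
    simp

end Sol
end GaudinModel
end PartD4

section PartE1
open scoped TensorProduct Polynomial Topology
open Filter
set_option linter.all false
namespace GaudinModel

section LeadSec
variable {N n : ℕ} {M : Type*} [NormedAddCommGroup M] [NormedSpace ℂ M] [FiniteDimensional ℂ M]
  [CompleteSpace M]
  (e : Fin n → Fin N → Fin N → Module.End ℂ M) (z : Fin n → ℂ) (K : Fin N → ℂ)

/-- `f = (u - w)^s (x + O(u-w))` near `w` -/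
def Lead (w : ℂ) (f : ℂ → M) (s : ℤ) (x : M) : Prop :=
  ∃ g : ℂ → M, AnalyticAt ℂ g w ∧ g w = x ∧ ∀ᶠ u in 𝓝[≠] w, f u = (u - w) ^ s • g u

theorem Lead.add {w : ℂ} {f g : ℂ → M} {s : ℤ} {x y : M} (hf : Lead w f s x) (hg : Lead w g s y) :
    Lead w (f + g) s (x + y) := by
  obtain ⟨F, h1, h2, h3⟩ := hf
  obtain ⟨G, h4, h5, h6⟩ := hg
  refine ⟨F + G, h1.add h4, by simp [h2, h5], ?_⟩
  filter_upwards [h3, h6] with u h7 h8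
  simp [h7, h8]

theorem Lead.smul {w : ℂ} {f : ℂ → M} {s : ℤ} {x : M} (hf : Lead w f s x) (c : ℂ) :
    Lead w (c • f) s (c • x) := by
  obtain ⟨F, h1, h2, h3⟩ := hf
  refine ⟨c • F, h1.const_smul, by simp [h2], ?_⟩
  filter_upwards [h3] with u h7
  simp [h7, smul_comm c]

theorem Lead.zero (w : ℂ) (s : ℤ) : Lead w (0 : ℂ → M) s 0 :=
  ⟨0, analyticAt_const, rfl, by simp⟩

theorem Lead.sum {ι : Type*} (S : Finset ι) {w : ℂ} {f : ι → ℂ → M} {s : ℤ} {x : ι → M}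
    (hf : ∀ i ∈ S, Lead w (f i) s (x i)) : Lead w (∑ i ∈ S, f i) s (∑ i ∈ S, x i) := by
  classical
  induction S using Finset.induction_on with
  | empty => simpa using Lead.zero w s
  | insert a S ha ih =>
    rw [Finset.sum_insert ha, Finset.sum_insert ha]
    exact (hf a (by simp)).add (ih fun i hi => hf i (by simp [hi]))

theorem Lead.unique {w : ℂ} {f : ℂ → M} {s : ℤ} {x : M} (hf : Lead w f s x)
    (h0 : ∀ᶠ u in 𝓝[≠] w, f u = 0) : x = 0 := by
  obtain ⟨g, h1, h2, h3⟩ := hf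
  have h4 : ∀ᶠ u in 𝓝[≠] w, g u = 0 := by
    filter_upwards [h0, h3, self_mem_nhdsWithin] with u h5 h6 h7
    rw [h5] at h6
    exact (smul_eq_zero.1 h6.symm).resolve_left (zpow_ne_zero _ (sub_ne_zero.2 h7))
  have h5 : Tendsto g (𝓝[≠] w) (𝓝 (g w)) := h1.continuousAt.tendsto.mono_left nhdsWithin_le_nhds
  have h6 : Tendsto g (𝓝[≠] w) (𝓝 0) := by
    refine Tendsto.congr' ?_ tendsto_const_nhds
    filter_upwards [h4] with u hu using hu.symm
  rw [← h2]
  exact tendsto_nhds_unique h5 h6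

theorem Lead.Xe (hz : Function.Injective z) (i : Fin n) (a b : Fin N) {f : ℂ → M} {s : ℤ} {x : M}
    (hf : Lead (z i) f s x) : Lead (z i) (Xe e z K a b f) (s - 1)
      ((if a = b then (s : ℂ) • x else 0) - e i b a x) := by
  classical
  obtain ⟨g, h1, h2, h3⟩ := hf
  refine ⟨fun u => (if a = b then (s : ℂ) • g u + (u - z i) • deriv g u else 0)
    - (u - z i) • (Matrix.diagonal K a b • g u)
    - (e i b a (g u) + ∑ j ∈ Finset.univ.erase i, ((u - z i) * (u - z j)⁻¹) • e j b a (g u)), ?_, ?_, ?_⟩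
  · have hid : AnalyticAt ℂ (fun u : ℂ => u - z i) (z i) := analyticAt_id.sub analyticAt_const
    refine AnalyticAt.fun_sub (AnalyticAt.fun_sub ?_ ?_) (AnalyticAt.fun_add (analyticAt_end _ h1) ?_)
    · split_ifs
      · exact (analyticAt_const.smul h1).add (hid.smul h1.deriv)
      · exact analyticAt_const
    · exact hid.smul (analyticAt_const.smul h1)
    · refine Finset.analyticAt_fun_sum _ fun j hj => ?_
      have hji : z i ≠ z j := fun h => (Finset.ne_of_mem_erase hj) (hz h).symm
      exact (hid.mul ((analyticAt_id.sub analyticAt_const).inv (sub_ne_zero.2 hji))).smul (analyticAt_end _ h1)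
  · simp [h2]
  · have h4 : ∀ᶠ u in 𝓝[≠] (z i), ∀ᶠ y in 𝓝 u, f y = (y - z i) ^ s • g y := by
      filter_upwards [eventually_eventually_nhdsWithin.2 h3, self_mem_nhdsWithin] with u hu hu2
      rwa [isOpen_compl_singleton.nhdsWithin_eq hu2] at hu
    have h5 : ∀ᶠ u in 𝓝[≠] (z i), AnalyticAt ℂ g u := h1.eventually_analyticAt.filter_mono nhdsWithin_le_nhds
    filter_upwards [h4, h5, h3, self_mem_nhdsWithin] with u h6 h7 h8 h9
    have hne : u - z i ≠ 0 := sub_ne_zero.2 h9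
    have hs : (u - z i) ^ s = (u - z i) ^ (s - 1) * (u - z i) := by
      rw [← zpow_add_one₀ hne]; congr 1; ring
    have hd : deriv f u = (u - z i) ^ (s - 1) • ((s : ℂ) • g u + (u - z i) • deriv g u) := by
      rw [EventuallyEq.deriv_eq (f := fun y => (y - z i) ^ s • g y) h6]
      have hp : HasDerivAt (fun y => (y - z i) ^ s) ((s : ℂ) * (u - z i) ^ (s - 1)) u := by
        have := (hasDerivAt_zpow s (u - z i) (Or.inl hne)).comp u ((hasDerivAt_id u).sub_const (z i))
        rw [mul_one] at this
        exact this
      have := (hp.smul h7.differentiableAt.hasDerivAt).deriv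
      rw [show (fun y => (y - z i) ^ s • g y) = (fun y => (y - z i) ^ s) • g from rfl, this, hs]
      module
    simp only [GaudinModel.Xe]
    rw [← Finset.add_sum_erase _ _ (Finset.mem_univ i), h8, hd, smul_sub, smul_sub,
      smul_add _ (e i b a (g u))]
    congr 1
    · congr 1
      · split_ifs <;> simp
      · rw [hs]; module
    · congr 1
      · rw [map_smul, smul_smul, hs]; congr 1; field_simp
      · rw [Finset.smul_sum]
        refine Finset.sum_congr rfl fun j _ => ?_
        rw [map_smul, smul_smul, smul_smul, hs]; congr 1; ring

theorem Lead.fold (hz : Function.Injective z) (i : Fin n) {k : ℕ} (X : Fin k → (ℂ → M) → (ℂ → M))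
    (Y : Fin k → ℤ → Module.End ℂ M)
    (h : ∀ a f s x, Lead (z i) f s x → Lead (z i) (X a f) (s - 1) (Y a s x))
    {f : ℂ → M} {s : ℤ} {x : M} (hf : Lead (z i) f s x) :
    Lead (z i) (((List.ofFn X).foldr (· ∘ ·) id) f) (s - k)
      ((List.ofFn fun a : Fin k => Y a (s - k + 1 + (a : ℕ))).prod x) := by
  induction k with
  | zero => simpa using hf
  | succ k ih =>
    rw [List.ofFn_succ, List.ofFn_succ, List.foldr_cons, List.prod_cons]
    have h1 := ih (fun a => X a.succ) (fun a => Y a.succ) (fun a => h a.succ)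
    have h2 := h 0 _ _ _ h1
    have e1 : s - ((k + 1 : ℕ) : ℤ) = s - k - 1 := by push_cast; ring
    have e2 : s - ((k + 1 : ℕ) : ℤ) + 1 + (((0 : Fin (k+1)) : ℕ) : ℤ) = s - k := by push_cast; simp; ring
    have e3 : ∀ a : Fin k, s - ((k + 1 : ℕ) : ℤ) + 1 + (((a.succ : Fin (k+1)) : ℕ) : ℤ) = s - k + 1 + (a : ℕ) := by
      intro a; push_cast; simp; ring
    rw [e2, e1]
    simp only [← e1, e3]
    rw [e1]
    exact h2

theorem Lead.De (hz : Function.Injective z) (i : Fin n) {f : ℂ → M} {s : ℤ} {x : M}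
    (hf : Lead (z i) f s x) : Lead (z i) (De e z K f) (s - N) (Qd (e i) (((s - N : ℤ)) : ℂ) x) := by
  rw [De_eq]
  unfold Qd rdet
  rw [LinearMap.sum_apply]
  refine Lead.sum _ fun σ _ => ?_
  rw [LinearMap.smul_apply, ← Int.cast_smul_eq_zsmul ℂ]
  refine Lead.smul ?_ _
  have := Lead.fold z hz i (fun a : Fin N => GaudinModel.Xe e z K a (σ a))
    (fun a t => (if a = σ a then (t : ℂ) • 1 else 0) - e i (σ a) a) (by
      intro a f s x h
      have h2 := Lead.Xe e z K hz i a (σ a) h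
      convert h2 using 1
      rw [LinearMap.sub_apply]
      split_ifs <;> simp) hf
  have hY : (fun a : Fin N => Qe (e i) (((s - N : ℤ)) : ℂ) a (σ a)) = fun a : Fin N =>
      (if a = σ a then (((s - N + 1 + ((a : ℕ) : ℤ)) : ℤ) : ℂ) • (1 : Module.End ℂ M) else 0) - e i (σ a) a := by
    funext a
    simp only [Qe]
    push_cast
    rfl
  rw [hY]
  exact this

end LeadSec
end GaudinModel
end PartE1

section PartE2
open scoped TensorProduct Polynomial Topology
open Filter
set_option linter.all false
namespace GaudinModel

section Fin
variable {N n : ℕ} {M : Type*} [NormedAddCommGroup M] [NormedSpace ℂ M] [FiniteDimensional ℂ M]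
  [CompleteSpace M]
  (e : Fin n → Fin N → Fin N → Module.End ℂ M) (z : Fin n → ℂ) (K : Fin N → ℂ)

theorem good_punct (i : Fin n) (hz : Function.Injective z) : ∃ r : ℝ, 0 < r ∧
    ∀ u ∈ Metric.ball (z i) r, u ≠ z i → GoodG z u := by
  have h : ∀ᶠ u in 𝓝 (z i), ∀ j, j ≠ i → u ≠ z j := by
    rw [eventually_all]
    intro j
    by_cases hj : j = i
    · exact Eventually.of_forall fun u h => absurd hj h
    · filter_upwards [isOpen_ne.mem_nhds (show z i ≠ z j from fun h => hj (hz h).symm)] with u hu _ using hu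
  obtain ⟨r, hr, h2⟩ := Metric.eventually_nhds_iff_ball.1 h
  refine ⟨r, hr, fun u hu hne j => ?_⟩
  by_cases hj : j = i
  · rw [hj]; exact hne
  · exact h2 u hu j hj

theorem Sol_order (hz : Function.Injective z) (i : Fin n) (ix : Fin N → ℕ)
    (hQ : ∀ (s : ℂ) (x : M), Qd (e i) s x = (∏ a : Fin N, (s + N - (ix a : ℂ))) • x)
    {f : ℂ → M} (hf : f ∈ Sol e z K) (hne : f ≠ 0) :
    ∃ (a : Fin N) (g : ℂ → M), AnalyticAt ℂ g (z i) ∧ g (z i) ≠ 0 ∧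
      (∀ᶠ u in 𝓝 (z i), f u = (u - z i) ^ (ix a) • g u) := by
  have hA : AnalyticAt ℂ f (z i) := hf.1.analyticAt _
  have h1 : ¬ ∀ᶠ u in 𝓝 (z i), f u = 0 := by
    intro h
    apply hne
    have h2 : AnalyticOnNhd ℂ f Set.univ := fun u _ => hf.1.analyticAt u
    funext u
    exact h2.eqOn_zero_of_preconnected_of_eventuallyEq_zero isPreconnected_univ (Set.mem_univ (z i)) h (Set.mem_univ u)
  obtain ⟨k, g, hg, hg0, hk⟩ := hA.exists_eventuallyEq_pow_smul_nonzero_iff.2 h1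
  have hL : Lead (z i) f (k : ℤ) (g (z i)) := ⟨g, hg, rfl, by
    filter_upwards [hk.filter_mono nhdsWithin_le_nhds] with u hu
    rw [hu, zpow_natCast]⟩
  have hD := (Lead.De e z K hz i hL).unique (by
    obtain ⟨r, hr, h⟩ := good_punct z i hz
    filter_upwards [self_mem_nhdsWithin, nhdsWithin_le_nhds (Metric.ball_mem_nhds (z i) hr)] with u hu hu2
    exact Sol.de e z K hf (h u hu2 hu))
  rw [hQ] at hD
  have h3 := (smul_eq_zero.1 hD).resolve_right hg0
  obtain ⟨a, _, ha⟩ := Finset.prod_eq_zero_iff.1 h3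
  have hka : k = ix a := by
    push_cast at ha
    have : (k : ℂ) = (ix a : ℂ) := by linear_combination ha
    exact_mod_cast this
  subst hka
  exact ⟨a, g, hg, hg0, hk⟩

theorem core (hz : Function.Injective z) (i : Fin n) (ix : Fin N → ℕ)
    (hQ : ∀ (s : ℂ) (x : M), Qd (e i) s x = (∏ a : Fin N, (s + N - (ix a : ℂ))) • x)
    (hT : ∀ c : Fin n → ℂ, (∀ j, c j ≠ 0) → TT e K c) (hE : GlSys e) (jj : Fin N) (v : M) (hv : v ≠ 0)
    (m : Fin N → ℂ) (hm : ∀ a, ((∑ j, e j a a) - m a • (1 : Module.End ℂ M)) v = 0) :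
    ∃ f ∈ Sol e z K, (∀ u a, ((∑ j, e j a a) - m a • (1 : Module.End ℂ M)) (f u) = 0) ∧
      ∃ g : ℂ → M, AnalyticAt ℂ g (z i) ∧ g (z i) = v ∧ ∀ᶠ u in 𝓝 (z i), f u = (u - z i) ^ (ix jj) • g u := by
  have hcoef : ∀ (f : ℂ → M) (a : Fin N) (g : ℂ → M), AnalyticAt ℂ g (z i) →
      (∀ᶠ u in 𝓝 (z i), f u = (u - z i) ^ (ix a) • g u) → Ty (z i) f (ix a) = g (z i) := by
    intro f a g hg h
    rw [Ty_congr (g := fun u => (u - z i) ^ (ix a) • g u) h, Ty_pow _ hg]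
    simp [Ty_zero]
  have hinj0 : ∀ f ∈ Sol e z K, (∀ a, Ty (z i) f (ix a) = 0) → f = 0 := by
    intro f hf h
    by_contra hne
    obtain ⟨a, g, hg, hg0, hk⟩ := Sol_order e z K hz i ix hQ hf hne
    exact hg0 (by rw [← hcoef f a g hg hk, h a])
  have hinj : Function.Injective (jet e z K (z i) ix) := by
    rw [injective_iff_map_eq_zero]
    intro f hf
    apply Subtype.ext
    exact hinj0 f.1 f.2 fun a => congrFun hf a
  obtain ⟨u0, hu0⟩ := (good_conn z).nonempty
  have hsurj := jet_surj e z K hu0 (hT _ fun j => sub_ne_zero.2 (hu0 j))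
  haveI : FiniteDimensional ℂ (Sol e z K) := FiniteDimensional.of_injective _ hinj
  have hfr : Module.finrank ℂ (Sol e z K) = Module.finrank ℂ (Fin N → M) :=
    le_antisymm (LinearMap.finrank_le_finrank_of_injective hinj)
      (LinearMap.finrank_le_finrank_of_surjective hsurj)
  have hs2 := (LinearMap.injective_iff_surjective_of_finrank_eq_finrank hfr).1 hinj
  obtain ⟨⟨f, hf⟩, hf2⟩ := hs2 (Pi.single jj v)
  have hf3 : ∀ a, Ty (z i) f (ix a) = (Pi.single jj v : Fin N → M) a := fun a => congrFun hf2 a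
  refine ⟨f, hf, ?_, ?_⟩
  · intro u a
    have h1 := hinj0 _ (Sol_weight e z K hE a (m a) hf) (by
      intro b
      rw [Ty_end _ (hf.1.analyticAt _), cF_apply, hf3]
      by_cases hb : b = jj
      · subst hb; rw [Pi.single_eq_same]; exact hm a
      · rw [Pi.single_eq_of_ne hb, map_zero])
    exact congrFun h1 u
  · have hne : f ≠ 0 := by
      intro h
      have := hf3 jj
      rw [h, Ty_zero_fun, Pi.single_eq_same] at this
      exact hv this.symm
    obtain ⟨a, g, hg, hg0, hk⟩ := Sol_order e z K hz i ix hQ hf hne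
    have h1 := hcoef f a g hg hk
    rw [hf3] at h1
    have ha : a = jj := by
      by_contra h
      rw [Pi.single_eq_of_ne h] at h1
      exact hg0 h1.symm
    subst ha
    rw [Pi.single_eq_same] at h1
    exact ⟨g, hg, h1.symm, hk⟩

end Fin
end GaudinModel
end PartE2

namespace GaudinModel

/-- For every `i ∈ {1,…,n}`, every `j ∈ {1,…,N}` (encoded by
`jj : Fin N`, `j = jj + 1`), and every nonzero `v ∈ M[m]` there is an `M[m]`-valued
holomorphic function `f` on a neighborhood of `z_i` with `D_{K,M}(u,∂) f = 0` away from
`z_i` and `f(u) = v (u − z_i)^{Λ^{(i)}_j + N − j} + O((u − z_i)^{Λ^{(i)}_j + N − j + 1})`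
as `u → z_i`. -/
theorem statement_17
    {N n : ℕ} (hN : 2 ≤ N) (hn : 1 ≤ n)
    (V : Fin n → Type*) [∀ i, AddCommGroup (V i)] [∀ i, Module ℂ (V i)]
    [∀ i, FiniteDimensional ℂ (V i)]
    (M : Type*) [NormedAddCommGroup M] [NormedSpace ℂ M] [FiniteDimensional ℂ M]
    (Λ : Fin n → Fin N → ℤ)
    (hdom : ∀ i, ∀ a b : Fin N, a ≤ b → Λ i b ≤ Λ i a)
    (hpoly : ∀ i a, 0 ≤ Λ i a)
    (hlast : ∀ i, Λ i ⟨N - 1, by omega⟩ = 0)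
    (E : ∀ i : Fin n, Fin N → Fin N → (V i →ₗ[ℂ] V i))
    (hrel : GlRel V E)
    (hhw : IsHW V E Λ)
    (φ : M ≃ₗ[ℂ] PiTensorProduct ℂ V)
    (z : Fin n → ℂ) (hz : Function.Injective z)
    (K : Fin N → ℂ)
    (m : Fin N → ℤ)
    (i : Fin n) (jj : Fin N)
    (v : M) (hv : v ∈ Wt V M E φ m) (hvne : v ≠ 0) :
    ∃ (f : ℂ → M) (r : ℝ), 0 < r ∧
      DifferentiableOn ℂ f (Metric.ball (z i) r) ∧
      (∀ u ∈ Metric.ball (z i) r, f u ∈ Wt V M E φ m) ∧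
      (∀ u ∈ Metric.ball (z i) r, u ≠ z i →
        Dg V M E φ z (Matrix.diagonal K) f u = 0) ∧
      (fun u : ℂ => f u - ((u - z i) ^ ((Λ i jj).toNat + (N - 1 - (jj : ℕ)))) • v)
        =O[nhds (z i)]
          (fun u : ℂ => (u - z i) ^ ((Λ i jj).toNat + (N - 1 - (jj : ℕ)) + 1)) := by
  haveI : CompleteSpace M := FiniteDimensional.complete ℂ M
  obtain ⟨f, hf, hw, g, hg, hgv, hk⟩ := core (EE V M E φ) z K hz i
    (fun a => (Λ i a).toNat + (N - 1 - (a : ℕ)))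
    (by
      intro s x
      rw [EE_Qd V M E φ Λ hrel hhw i s x]
      congr 1
      refine Finset.prod_congr rfl fun a _ => ?_
      have h1 : (((Λ i a).toNat : ℤ) : ℂ) = (Λ i a : ℂ) := by
        rw [Int.toNat_of_nonneg (hpoly i a)]
      have h2 : ((N - 1 - (a : ℕ) : ℕ) : ℂ) = (N : ℂ) - 1 - (a : ℕ) := by
        have := a.2
        rw [Nat.cast_sub (by omega), Nat.cast_sub (by omega)]; simp
      push_cast at h1 ⊢
      rw [h1, h2]; ring)
    (fun c hc => EE_TT V M E φ Λ (by omega) hdom hpoly hrel hhw K c hc)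
    (EE_sys V M E φ hrel) jj v hvne (fun a => (m a : ℂ)) (by
      intro a
      exact LinearMap.mem_ker.1 ((Submodule.mem_iInf _).1 hv a))
  obtain ⟨r, hr, hgood⟩ := good_punct z i hz
  refine ⟨f, r, hr, hf.1.differentiableOn, fun u _ => ?_, fun u hu hne => ?_, ?_⟩
  · exact (Submodule.mem_iInf _).2 fun a => LinearMap.mem_ker.2 (hw u a)
  · exact Sol.de (EE V M E φ) z K hf (hgood u hu hne)
  · have h1 : (fun u => g u - v) =O[nhds (z i)] (fun u : ℂ => u - z i) := by
      have := hg.differentiableAt.isBigO_sub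
      rwa [hgv] at this
    have h2 := (Asymptotics.isBigO_refl (fun u : ℂ => (u - z i) ^ ((Λ i jj).toNat + (N - 1 - (jj : ℕ))))
      (nhds (z i))).smul h1
    refine (h2.congr' ?_ ?_)
    · filter_upwards [hk] with u hu
      rw [hu]; exact smul_sub _ _ _
    · filter_upwards with u
      exact (pow_succ _ _).symm

end GaudinModel
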